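/- arXiv:2307.07962 — 6 statements merged into one kernel-verified Lean document; each statement's English description precedes it below -/
import Mathlib

section
/- Let k ≥ 2, and let n, t be integers with 1 ≤ t ≤ 2k−2 and n ≥ 318t²k. If G is a C_{2k+1}-free graph on n vertices with d₂(G) ≥ t, then e(G) ≤ ⌊(n−t−1)²/4⌋ + (t+2 choose 2). -/
/-- A graph `G` is `Cₘ`-free if it contains no subgraph isomorphic to the cycle of length `m`,
i.e. there is no injective graph homomorphism from `cycleGraph m` to `G`. -/
def CycleFree {V : Type*} (G : SimpleGraph V) (m : ℕ) : Prop :=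
  ∀ f : SimpleGraph.cycleGraph m →g G, ¬ Function.Injective f

namespace VertexStability

open Finset

/-! ### Paths of prescribed length avoiding a set -/

/-- There is a path of length `l` from `u` to `v` in `G` none of whose vertices lies in `F`. -/
def PathAvoiding {V : Type*} (G : SimpleGraph V) (F : Finset V) (l : ℕ) (u v : V) : Prop :=
  ∃ p : G.Walk u v, p.IsPath ∧ p.length = l ∧ ∀ x ∈ p.support, x ∉ F

section Paths

variable {V : Type*} {G : SimpleGraph V}

theorem PathAvoiding.cons [DecidableEq V] {F : Finset V} {l : ℕ} {u v w : V}
    (h : PathAvoiding G (insert w F) l u v) (hw : w ∉ F) (hadj : G.Adj w u) :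
    PathAvoiding G F (l + 1) w v := by
  obtain ⟨p, hp, hl, hF⟩ := h
  refine ⟨SimpleGraph.Walk.cons hadj p, ?_, by simp [hl], ?_⟩
  · rw [SimpleGraph.Walk.cons_isPath_iff]
    exact ⟨hp, fun hmem => hF w hmem (mem_insert_self _ _)⟩
  · intro x hx
    rw [SimpleGraph.Walk.support_cons, List.mem_cons] at hx
    rcases hx with rfl | hx
    · exact hw
    · exact fun hxF => hF x hx (mem_insert_of_mem hxF)

theorem PathAvoiding.not_adj {k : ℕ} (hfree : CycleFree G (2 * k + 1))
    {F : Finset V} {u v : V} (h : PathAvoiding G F (2 * k) u v) : ¬ G.Adj u v := by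
  intro hadj
  obtain ⟨p, hp, hl, -⟩ := h
  have hstep : ∀ i j : Fin (2 * k + 1), (j - i).val = 1 → G.Adj (p.getVert i) (p.getVert j) := by
    intro i j hij
    have hi := i.isLt
    have hj := j.isLt
    rcases le_or_gt i j with hle | hlt
    · rw [Fin.sub_val_of_le hle] at hij
      have : (j : ℕ) = i + 1 := by have : (i : ℕ) ≤ j := hle; omega
      rw [this]
      exact p.adj_getVert_succ (by omega)
    · rw [Fin.coe_sub_iff_lt.mpr hlt] at hij
      have hlt' : (j : ℕ) < i := hlt
      have h0 : (j : ℕ) = 0 := by omega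
      have h1 : (i : ℕ) = p.length := by omega
      rw [h0, h1, p.getVert_zero, p.getVert_length]
      exact hadj.symm
  refine hfree ⟨fun i => p.getVert i, ?_⟩ ?_
  · intro i j hij
    rw [SimpleGraph.cycleGraph_adj'] at hij
    rcases hij with h | h
    · exact (hstep j i h).symm
    · exact hstep i j h
  · intro i j hij
    have hi := i.isLt
    have hj := j.isLt
    exact Fin.ext (hp.getVert_injOn (by simp only [Set.mem_ofPred_eq]; omega)
      (by simp only [Set.mem_ofPred_eq]; omega) hij)

/-! ### Linked vertices -/

variable [DecidableRel G.Adj]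

/-- The number of neighbours of `v` in `W`. -/
def degIn (G : SimpleGraph V) [DecidableRel G.Adj] (W : Finset V) (v : V) : ℕ :=
  #{z ∈ W | G.Adj v z}

/-- `x` and `y` have at least `m` common neighbours in `W`. -/
def Linked (G : SimpleGraph V) [DecidableRel G.Adj] (W : Finset V) (m : ℕ) (x y : V) : Prop :=
  m ≤ #{z ∈ W | G.Adj x z ∧ G.Adj y z}

variable {W : Finset V} {m : ℕ}

theorem Linked.symm {x y : V} (h : Linked G W m x y) : Linked G W m y x := by
  unfold Linked at *
  simpa only [and_comm] using h

variable [DecidableEq V]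

/-- A chain of pairwise distinct, consecutively linked vertices yields a path of twice its length
through the same vertices. -/
theorem pathAvoiding_of_isChain (l : List V) : ∀ (y : V) (F : Finset V),
    (y :: l).IsChain (Linked G W m) → (y :: l).Nodup → (∀ x ∈ y :: l, x ∉ F) →
    #F + 2 * l.length + 1 ≤ m →
    PathAvoiding G F (2 * l.length) y ((y :: l).getLast (List.cons_ne_nil _ _)) := by
  induction l with
  | nil =>
    intro y F _ _ hF _
    exact ⟨SimpleGraph.Walk.nil, by simp, by simp, by simpa using hF⟩
  | cons z l ih =>
    intro y F hchain hnodup hF hm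
    rw [List.isChain_cons_cons] at hchain
    have hyz := hchain.1
    rw [List.nodup_cons] at hnodup
    have hyF : y ∉ F := hF y (by simp)
    simp only [List.length_cons] at hm
    obtain ⟨p, hp, hl, hpF⟩ := ih z (insert y F) hchain.2 hnodup.2
      (by
        intro x hx
        rw [mem_insert, not_or]
        refine ⟨?_, hF x (List.mem_cons_of_mem _ hx)⟩
        rintro rfl
        exact hnodup.1 hx)
      (by rw [card_insert_of_notMem hyF]; omega)
    have hcard : #(F ∪ p.support.toFinset) < #{z' ∈ W | G.Adj y z' ∧ G.Adj z z'} := by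
      refine lt_of_lt_of_le ?_ hyz
      refine lt_of_le_of_lt (card_union_le _ _) ?_
      have := List.toFinset_card_le p.support
      rw [SimpleGraph.Walk.length_support, hl] at this
      omega
    obtain ⟨b, hb, hbF⟩ := exists_mem_notMem_of_card_lt_card hcard
    rw [mem_filter] at hb
    rw [mem_union, not_or, List.mem_toFinset] at hbF
    have hyb : y ≠ b := hb.2.1.ne
    have h1 : PathAvoiding G (insert b (insert y F)) (2 * l.length) z
        ((z :: l).getLast (List.cons_ne_nil _ _)) := by
      refine ⟨p, hp, hl, fun x hx => ?_⟩
      rw [mem_insert, not_or]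
      refine ⟨?_, hpF x hx⟩
      rintro rfl
      exact hbF.2 hx
    have h2 := h1.cons (by rw [mem_insert, not_or]; exact ⟨hyb.symm, hbF.1⟩) hb.2.2.symm
    have h3 := h2.cons hyF hb.2.1
    simpa [mul_add] using h3

/-- Distinct vertices of a set of pairwise linked vertices are joined by paths of every short even
length. -/
theorem pathAvoiding_of_pairwise_linked {A F : Finset V}
    (hA : ∀ x ∈ A, ∀ y ∈ A, Linked G W m x y) (hAF : Disjoint A F) {j : ℕ} (hj : 1 ≤ j)
    (hcard : j + 1 ≤ #A) (hm : #F + 2 * j + 1 ≤ m) {a a' : V} (ha : a ∈ A) (ha' : a' ∈ A)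
    (hne : a ≠ a') : PathAvoiding G F (2 * j) a a' := by
  obtain ⟨i, rfl⟩ : ∃ i, j = i + 1 := ⟨j - 1, by omega⟩
  have h1 : i ≤ #((A.erase a).erase a') := by
    rw [card_erase_of_mem (by simp [ha', hne.symm]), card_erase_of_mem ha]
    omega
  obtain ⟨S, hS, hSc⟩ := exists_subset_card_eq h1
  have hSA : ∀ x ∈ S, x ≠ a' ∧ x ≠ a ∧ x ∈ A := by
    intro x hx
    simpa using hS hx
  have hmem : ∀ x ∈ a :: (S.toList ++ [a']), x ∈ A := by
    intro x hx
    simp only [List.mem_cons, List.mem_append, mem_toList, List.not_mem_nil, or_false] at hx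
    rcases hx with rfl | hx | rfl
    · exact ha
    · exact (hSA x hx).2.2
    · exact ha'
  have hlen : (S.toList ++ [a']).length = i + 1 := by simp [hSc]
  have := pathAvoiding_of_isChain (G := G) (W := W) (m := m) (S.toList ++ [a']) a F
    (List.Pairwise.isChain (List.pairwise_of_forall_mem_list
      fun x hx y hy => hA x (hmem x hx) y (hmem y hy)))
    (by
      rw [List.nodup_cons, List.nodup_append]
      refine ⟨?_, S.nodup_toList, by simp, ?_⟩
      · simp only [List.mem_append, mem_toList, List.mem_singleton, not_or]
        exact ⟨fun h => (hSA a h).2.1 rfl, hne⟩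
      · intro x hx y hy
        rw [List.mem_singleton] at hy
        subst hy
        exact (hSA x (by simpa using hx)).1)
    (fun x hx => disjoint_left.mp hAF (hmem x hx))
    (by rw [hlen]; exact hm)
  rw [hlen] at this
  simpa using this

/-- If among any three vertices of `X` two are linked, then `X` contains a long chain of
consecutively linked vertices. -/
theorem exists_isChain_linked {X : Finset V}
    (hX : ∀ x ∈ X, ∀ y ∈ X, ∀ z ∈ X, Linked G W m x y ∨ Linked G W m x z ∨ Linked G W m y z) :
    ∀ r : ℕ, 2 * r + 1 ≤ #X → ∃ (y : V) (l : List V), l.length = r ∧ (∀ x ∈ y :: l, x ∈ X) ∧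
      (y :: l).Nodup ∧ (y :: l).IsChain (Linked G W m) := by
  intro r
  induction r with
  | zero =>
    intro h
    obtain ⟨y, hy⟩ := card_pos.mp (show 0 < #X by omega)
    exact ⟨y, [], by simp, by simpa using hy, by simp, by simp⟩
  | succ r ih =>
    intro h
    obtain ⟨y, l, hl, hmem, hnd, hch⟩ := ih (by omega)
    by_cases hz : ∃ z ∈ X, z ∉ y :: l ∧ Linked G W m z y
    · obtain ⟨z, hzX, hzl, hzy⟩ := hz
      refine ⟨z, y :: l, by simp [hl], ?_, List.nodup_cons.mpr ⟨hzl, hnd⟩,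
        List.isChain_cons_cons.mpr ⟨hzy, hch⟩⟩
      intro x hx
      rcases List.mem_cons.mp hx with rfl | hx
      · exact hzX
      · exact hmem x hx
    · push Not at hz
      have hcard : r + 2 ≤ #(X \ (y :: l).toFinset) := by
        have h1 := le_card_sdiff (y :: l).toFinset X
        have h2 := List.toFinset_card_le (y :: l)
        rw [List.length_cons, hl] at h2
        omega
      obtain ⟨S, hS, hSc⟩ := exists_subset_card_eq hcard
      have hSX : ∀ x ∈ S, x ∈ X ∧ x ∉ y :: l := by
        intro x hx
        have := hS hx
        rwa [mem_sdiff, List.mem_toFinset] at this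
      have hpw : S.toList.Pairwise (Linked G W m) := by
        refine List.pairwise_of_forall_mem_list fun x hx x' hx' => ?_
        rw [mem_toList] at hx hx'
        obtain ⟨hxX, hxl⟩ := hSX x hx
        obtain ⟨hxX', hxl'⟩ := hSX x' hx'
        rcases hX x hxX x' hxX' y (hmem y (by simp)) with h | h | h
        · exact h
        · exact absurd h (hz x hxX hxl)
        · exact absurd h (hz x' hxX' hxl')
      rcases hT : S.toList with _ | ⟨y', l'⟩
      · have := S.length_toList
        rw [hT, hSc] at this
        simp at this
      · have hlen := S.length_toList
        rw [hT, hSc, List.length_cons] at hlen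
        refine ⟨y', l', by omega, ?_, ?_, ?_⟩
        · intro x hx
          rw [← hT, mem_toList] at hx
          exact (hSX x hx).1
        · rw [← hT]
          exact S.nodup_toList
        · rw [← hT]
          exact hpw.isChain

end Paths
/-! ### Short connections in a graph without a given odd cycle -/

section CycleFree

variable {V : Type*} [DecidableEq V] {G : SimpleGraph V} [DecidableRel G.Adj] {W : Finset V}
  {k : ℕ}

/-- Two adjacent vertices outside a set of pairwise linked vertices cannot have distinct
neighbours in it. -/
theorem eq_of_adj_of_pairwise_linked (hk : 2 ≤ k) (hfree : CycleFree G (2 * k + 1))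
    {A : Finset V} (hA : ∀ x ∈ A, ∀ y ∈ A, Linked G W (2 * k + 1) x y) (hcard : k ≤ #A)
    {v w a a' : V} (hv : v ∉ A) (hw : w ∉ A) (ha : a ∈ A) (ha' : a' ∈ A) (hvw : G.Adj v w)
    (hva : G.Adj v a) (hwa : G.Adj w a') : a = a' := by
  by_contra hne
  have hvw' : v ≠ w := hvw.ne
  have h0 : PathAvoiding G {v, w} (2 * (k - 1)) a a' := by
    refine pathAvoiding_of_pairwise_linked hA ?_ (by omega) (by omega) ?_ ha ha' hne
    · rw [disjoint_insert_right, disjoint_singleton_right]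
      exact ⟨hv, hw⟩
    · rw [card_pair hvw']
      omega
  have h1 : PathAvoiding G {w} _ v a' := h0.cons (by simpa using hvw') hva
  have h2 : PathAvoiding G ∅ _ w a' := PathAvoiding.cons h1 (by simp) hvw.symm
  rw [show 2 * (k - 1) + 1 + 1 = 2 * k by omega] at h2
  exact h2.not_adj hfree hwa

/-- Linked vertices are not adjacent. -/
theorem not_adj_of_linked (hk : 2 ≤ k) (hfree : CycleFree G (2 * k + 1))
    (hW : ∀ x ∈ W, ∀ y ∈ W, ∀ z ∈ W, Linked G W (2 * k + 1) x y ∨ Linked G W (2 * k + 1) x z ∨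
      Linked G W (2 * k + 1) y z) {u x : V} (hux : Linked G W (2 * k + 1) u x) :
    ¬ G.Adj u x := by
  intro hadj
  have hX : ∀ z ∈ {z ∈ W | G.Adj u z ∧ G.Adj x z}, z ∈ W ∧ G.Adj u z ∧ G.Adj x z := by
    intro z hz
    rwa [mem_filter] at hz
  obtain ⟨y, l, hl, hmem, hnd, hch⟩ := exists_isChain_linked
    (fun a ha b hb c hc => hW a (hX a ha).1 b (hX b hb).1 c (hX c hc).1) (k - 1)
    (le_trans (by omega) hux)
  have hne : u ≠ x := hadj.ne
  have h0 := pathAvoiding_of_isChain l y {u, x} hch hnd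
    (by
      intro z hz
      rw [mem_insert, mem_singleton, not_or]
      have := hX z (hmem z hz)
      exact ⟨this.2.1.ne', this.2.2.ne'⟩)
    (by rw [card_pair hne, hl]; omega)
  have hlast := hX _ (hmem _ (List.getLast_mem (List.cons_ne_nil y l)))
  have h1 : PathAvoiding G {x} _ u _ :=
    h0.cons (by simpa using hne) (hX y (hmem y (by simp))).2.1
  have h2 : PathAvoiding G ∅ _ x _ := PathAvoiding.cons h1 (by simp) hadj.symm
  rw [hl, show 2 * (k - 1) + 1 + 1 = 2 * k by omega] at h2
  exact h2.not_adj hfree hlast.2.2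

/-- The vertices linked to a given vertex form an independent set. -/
theorem not_adj_of_linked_of_linked (hk : 2 ≤ k) (hfree : CycleFree G (2 * k + 1))
    (hW : ∀ x ∈ W, ∀ y ∈ W, ∀ z ∈ W, Linked G W (2 * k + 1) x y ∨ Linked G W (2 * k + 1) x z ∨
      Linked G W (2 * k + 1) y z) {v x x' : V} (hx : Linked G W (2 * k + 1) v x)
    (hx' : Linked G W (2 * k + 1) v x') : ¬ G.Adj x x' := by
  intro hadj
  by_cases hvx : v = x
  · subst hvx
    exact not_adj_of_linked hk hfree hW hx' hadj
  by_cases hvx' : v = x'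
  · subst hvx'
    exact not_adj_of_linked hk hfree hW hx hadj.symm
  have hxx' : x ≠ x' := hadj.ne
  obtain ⟨y', hy', hy'x⟩ : ∃ y' ∈ {z ∈ W | G.Adj v z ∧ G.Adj x' z}, y' ∉ ({x} : Finset V) :=
    exists_mem_notMem_of_card_lt_card (lt_of_lt_of_le (by rw [card_singleton]; omega) hx')
  rw [mem_filter] at hy'
  rw [mem_singleton] at hy'x
  set X := {z ∈ W | G.Adj v z ∧ G.Adj x z} \ {x', y'} with hXdef
  have hX : ∀ z ∈ X, (z ∈ W ∧ G.Adj v z ∧ G.Adj x z) ∧ z ≠ x' ∧ z ≠ y' := by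
    intro z hz
    simpa [hXdef] using hz
  have hXc : 2 * (k - 2) + 1 ≤ #X := by
    have h1 : _ ≤ #X := le_card_sdiff {x', y'} {z ∈ W | G.Adj v z ∧ G.Adj x z}
    have h2 : #({x', y'} : Finset V) ≤ 2 := card_le_two
    have h3 : 2 * k + 1 ≤ #{z ∈ W | G.Adj v z ∧ G.Adj x z} := hx
    omega
  obtain ⟨y, l, hl, hmem, hnd, hch⟩ := exists_isChain_linked
    (fun a ha b hb c hc => hW a (hX a ha).1.1 b (hX b hb).1.1 c (hX c hc).1.1) (k - 2) hXc
  have hy'v : y' ≠ v := hy'.2.1.ne'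
  have hy'x' : y' ≠ x' := hy'.2.2.ne'
  have h0 := pathAvoiding_of_isChain l y (insert v (insert y' (insert x' {x}))) hch hnd
    (by
      intro z hz
      obtain ⟨⟨-, h1, h2⟩, h3, h4⟩ := hX z (hmem z hz)
      simp only [mem_insert, mem_singleton, not_or]
      exact ⟨h1.ne', h4, h3, h2.ne'⟩)
    (by
      have := card_le_four (a := v) (b := y') (c := x') (d := x)
      rw [hl]
      omega)
  have hlast := hX _ (hmem _ (List.getLast_mem (List.cons_ne_nil y l)))
  have h1 := h0.cons (by simp [hy'v.symm, hvx, hvx']) (hX y (hmem y (by simp))).1.2.1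
  have h2 := h1.cons (by simp [hy'x', hy'x]) hy'.2.1.symm
  have h3 := h2.cons (by simp [hxx'.symm]) hy'.2.2
  have h4 : PathAvoiding G ∅ _ x _ := PathAvoiding.cons h3 (by simp) hadj
  rw [hl, show 2 * (k - 2) + 1 + 1 + 1 + 1 = 2 * k by omega] at h4
  exact h4.not_adj hfree hlast.1.2.2

/-- If `a ∈ A` and `b` are adjacent, where `A` consists of pairwise linked vertices, then there is
no path of length four from `b` to `a` outside `A`. -/
theorem not_adj_of_path_four (hk : 2 ≤ k) (hfree : CycleFree G (2 * k + 1))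
    {A : Finset V} (hA : ∀ x ∈ A, ∀ y ∈ A, Linked G W (2 * k + 1) x y) (hcard : k ≤ #A)
    {v x y a b : V} (ha : a ∈ A) (hb : b ∉ A) (hx : x ∉ A) (hy : y ∉ A) (hv : v ∉ A)
    (hxy : x ≠ y) (hby : b ≠ y) (hbv : b ≠ v) (hvx : G.Adj v x) (hvy : G.Adj v y)
    (hxb : G.Adj x b) (hya : G.Adj y a) (hdeg : 2 ≤ degIn G A b) : ¬ G.Adj b a := by
  intro hba
  obtain ⟨a', hba', h0⟩ : ∃ a', G.Adj b a' ∧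
      PathAvoiding G (insert b (insert x (insert v {y}))) (2 * (k - 2)) a' a := by
    have hdisj : Disjoint A (insert b (insert x (insert v {y}))) := by
      simp only [disjoint_insert_right, disjoint_singleton_right]
      exact ⟨hb, hx, hv, hy⟩
    rcases hk.eq_or_lt with rfl | hk3
    · exact ⟨a, hba, SimpleGraph.Walk.nil, by simp, by simp,
        by simpa using disjoint_left.mp hdisj ha⟩
    · obtain ⟨a', ha', hne⟩ : ∃ a' ∈ {z ∈ A | G.Adj b z}, a' ∉ ({a} : Finset V) :=
        exists_mem_notMem_of_card_lt_card (lt_of_lt_of_le (by rw [card_singleton]; omega) hdeg)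
      rw [mem_filter] at ha'
      rw [mem_singleton] at hne
      refine ⟨a', ha'.2, pathAvoiding_of_pairwise_linked hA hdisj (by omega) (by omega) ?_
        ha'.1 ha hne⟩
      have := card_le_four (a := b) (b := x) (c := v) (d := y)
      omega
  have h1 := h0.cons (by simp [hxb.ne', hby, hbv]) hba'
  have h2 := h1.cons (by simp [hvx.ne', hxy]) hxb
  have h3 := h2.cons (by simp [hvy.ne]) hvx
  have h4 : PathAvoiding G ∅ _ y _ := PathAvoiding.cons h3 (by simp) hvy.symm
  rw [show 2 * (k - 2) + 1 + 1 + 1 + 1 = 2 * k by omega] at h4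
  exact h4.not_adj hfree hya

end CycleFree
/-! ### Counting edges -/

/-- A set of vertices whose complement is a union of two independent sets is an odd cycle
transversal. -/
theorem le_card_compl_union {V : Type*} [Fintype V] [DecidableEq V] {G : SimpleGraph V} {t : ℕ}
    (hd2 : ∀ T : Finset V, (G.induce ((↑T : Set V)ᶜ)).Colorable 2 → t ≤ T.card)
    {X Y : Finset V} (hX : ∀ x ∈ X, ∀ y ∈ X, ¬ G.Adj x y)
    (hY : ∀ x ∈ Y, ∀ y ∈ Y, ¬ G.Adj x y) : t ≤ #(X ∪ Y)ᶜ := by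
  refine hd2 _ ⟨SimpleGraph.Coloring.mk (fun v => if v.1 ∈ X then (0 : Fin 2) else 1) ?_⟩
  rintro ⟨u, hu⟩ ⟨v, hv⟩ huv
  simp only [coe_compl, compl_compl, mem_coe, coe_union, Set.mem_union] at hu hv
  simp only [SimpleGraph.comap_adj, Function.Embedding.subtype_apply] at huv
  have h1 := hX u
  have h2 := hY u
  by_cases hu' : u ∈ X <;> by_cases hv' : v ∈ X <;> simp [hu', hv']
  · exact h1 hu' v hv' huv
  · exact h2 (by tauto) v (by tauto) huv

section Counting

variable {V : Type*} {G : SimpleGraph V} [DecidableRel G.Adj]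

theorem degIn_eq_sum (W : Finset V) (v : V) :
    degIn G W v = ∑ z ∈ W, if G.Adj v z then 1 else 0 := by
  rw [degIn, card_filter]

theorem degIn_le_card (W : Finset V) (v : V) : degIn G W v ≤ #W :=
  card_filter_le _ _

theorem degIn_mono {W W' : Finset V} (h : W ⊆ W') (v : V) : degIn G W v ≤ degIn G W' v :=
  card_le_card (filter_subset_filter _ h)

theorem sum_degIn_comm (S T : Finset V) :
    ∑ v ∈ S, degIn G T v = ∑ v ∈ T, degIn G S v := by
  simp only [degIn_eq_sum]
  rw [sum_comm]
  simp only [G.adj_comm]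

theorem degIn_eq_zero {S : Finset V} {v : V} (h : ∀ x ∈ S, ¬ G.Adj v x) : degIn G S v = 0 := by
  rw [degIn, card_eq_zero, filter_eq_empty_iff]
  exact fun x hx => h x hx

theorem sum_degIn_univ [Fintype V] : ∑ v, degIn G univ v = 2 * #G.edgeFinset := by
  rw [← G.sum_degrees_eq_twice_card_edges]
  refine sum_congr rfl fun v _ => ?_
  rw [degIn, ← G.card_neighborFinset_eq_degree, G.neighborFinset_eq_filter]

variable [DecidableEq V]

theorem degIn_union {S T : Finset V} (h : Disjoint S T) (v : V) :
    degIn G (S ∪ T) v = degIn G S v + degIn G T v := by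
  simp only [degIn_eq_sum, sum_union h]

theorem degIn_self_lt {Q : Finset V} {v : V} (hv : v ∈ Q) : degIn G Q v + 1 ≤ #Q := by
  have : {z ∈ Q | G.Adj v z} ⊆ Q.erase v := by
    intro z hz
    rw [mem_filter] at hz
    exact mem_erase.mpr ⟨hz.2.ne', hz.1⟩
  have h := card_le_card this
  rw [card_erase_of_mem hv] at h
  have := card_pos.mpr ⟨v, hv⟩
  unfold degIn
  omega

theorem sum_degIn_insert {W : Finset V} {v : V} (hv : v ∉ W) :
    ∑ u ∈ insert v W, degIn G (insert v W) u = ∑ u ∈ W, degIn G W u + 2 * degIn G W v := by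
  have h1 : ∀ u, degIn G (insert v W) u = (if G.Adj u v then 1 else 0) + degIn G W u := by
    intro u
    rw [degIn_eq_sum, sum_insert hv, degIn_eq_sum]
  have h2 : ∑ u ∈ W, (if G.Adj u v then 1 else 0) = degIn G W v := by
    rw [degIn_eq_sum]
    simp only [G.adj_comm]
  rw [sum_insert hv]
  simp only [h1, sum_add_distrib, h2, G.irrefl, if_false]
  ring

theorem sum_degIn_le {X Y : Finset V} (hX : ∀ x ∈ X, ∀ y ∈ X, ¬ G.Adj x y)
    (hY : ∀ x ∈ Y, ∀ y ∈ Y, ¬ G.Adj x y) (hXY : Disjoint X Y) :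
    ∑ v ∈ X ∪ Y, degIn G (X ∪ Y) v ≤ 2 * (#X * #Y) := by
  rw [sum_union hXY]
  have h1 : ∑ v ∈ X, degIn G (X ∪ Y) v ≤ #X * #Y := by
    refine sum_le_card_nsmul _ _ _ fun v hv => ?_
    rw [degIn_union hXY, degIn_eq_zero (hX v hv), zero_add]
    exact degIn_le_card _ _
  have h2 : ∑ v ∈ Y, degIn G (X ∪ Y) v ≤ #Y * #X := by
    refine sum_le_card_nsmul _ _ _ fun v hv => ?_
    rw [degIn_union hXY, degIn_eq_zero (hY v hv), add_zero]
    exact degIn_le_card _ _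
  rw [mul_comm #Y] at h2
  omega

variable [Fintype V]

/-- The number of edges of a graph, in terms of an induced bipartite subgraph. -/
theorem two_mul_card_edgeFinset_le {X Y : Finset V} (hX : ∀ x ∈ X, ∀ y ∈ X, ¬ G.Adj x y)
    (hY : ∀ x ∈ Y, ∀ y ∈ Y, ¬ G.Adj x y) (hXY : Disjoint X Y) :
    2 * #G.edgeFinset ≤ 2 * (#X * #Y) + 2 * ∑ v ∈ (X ∪ Y)ᶜ, degIn G (X ∪ Y) v +
      #(X ∪ Y)ᶜ * (#(X ∪ Y)ᶜ - 1) := by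
  rw [← sum_degIn_univ, ← sum_add_sum_compl (X ∪ Y)]
  have hdeg : ∀ v, degIn G univ v = degIn G (X ∪ Y) v + degIn G (X ∪ Y)ᶜ v := by
    intro v
    rw [← degIn_union disjoint_compl_right, union_compl]
  simp only [hdeg, sum_add_distrib]
  have h1 := sum_degIn_le hX hY hXY
  have h2 := sum_degIn_comm (G := G) (X ∪ Y) (X ∪ Y)ᶜ
  have h3 : ∑ v ∈ (X ∪ Y)ᶜ, degIn G (X ∪ Y)ᶜ v ≤ #(X ∪ Y)ᶜ * (#(X ∪ Y)ᶜ - 1) := by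
    refine sum_le_card_nsmul _ _ _ fun v hv => ?_
    have := degIn_self_lt (G := G) hv
    omega
  omega

variable (G) in
/-- Every graph has an induced subgraph of large minimum degree which is at least as dense. -/
theorem exists_dense_subset : ∃ W : Finset V, (∀ v ∈ W, 6 * #W ≤ 16 * degIn G W v + 3) ∧
    16 * #G.edgeFinset + 3 * #W ^ 2 ≤
      8 * ∑ v ∈ W, degIn G W v + 3 * Fintype.card V ^ 2 := by
  obtain ⟨W, -, hW⟩ := exists_max_image (univ : Finset (Finset V))
    (fun W => (8 * (∑ v ∈ W, degIn G W v : ℕ) - 3 * (#W : ℤ) ^ 2 : ℤ)) univ_nonempty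
  refine ⟨W, fun v hv => ?_, ?_⟩
  · have h1 := hW (W.erase v) (mem_univ _)
    have h2 := sum_degIn_insert (G := G) (notMem_erase v W)
    rw [insert_erase hv] at h2
    have h3 : #W = #(W.erase v) + 1 := (card_erase_add_one hv).symm
    have h4 : degIn G (W.erase v) v ≤ degIn G W v := degIn_mono (erase_subset _ _) v
    rw [h2, h3] at h1
    rw [h3]
    push_cast at h1
    zify at h4 ⊢
    nlinarith
  · have h1 := hW univ (mem_univ _)
    rw [sum_degIn_univ, card_univ] at h1
    zify
    push_cast at h1
    linarith

end Counting

section Links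

variable {V : Type*} {G : SimpleGraph V} [DecidableRel G.Adj] [DecidableEq V] {W : Finset V}
  {m : ℕ}

theorem linked_of_degIn {B : Finset V} (hB : B ⊆ W) {x y : V}
    (h : m + #B ≤ degIn G B x + degIn G B y) : Linked G W m x y := by
  have h1 := card_union_add_card_inter {z ∈ B | G.Adj x z} {z ∈ B | G.Adj y z}
  have h2 : #({z ∈ B | G.Adj x z} ∪ {z ∈ B | G.Adj y z}) ≤ #B :=
    card_le_card (union_subset (filter_subset _ _) (filter_subset _ _))
  have h3 : {z ∈ B | G.Adj x z} ∩ {z ∈ B | G.Adj y z} ⊆ {z ∈ W | G.Adj x z ∧ G.Adj y z} := by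
    intro z hz
    simp only [mem_inter, mem_filter] at hz ⊢
    exact ⟨hB hz.1.1, hz.1.2, hz.2.2⟩
  have h4 := card_le_card h3
  unfold degIn at h
  unfold Linked
  omega

theorem linked_or_linked_or_linked {x y z : V}
    (h : 3 * m + #W ≤ degIn G W x + degIn G W y + degIn G W z + 2) :
    Linked G W m x y ∨ Linked G W m x z ∨ Linked G W m y z := by
  unfold Linked
  unfold degIn at h
  by_contra! hcon
  have h1 := card_union_add_card_inter {u ∈ W | G.Adj x u} {u ∈ W | G.Adj y u}
  have h2 := card_union_add_card_inter ({u ∈ W | G.Adj x u} ∪ {u ∈ W | G.Adj y u})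
    {u ∈ W | G.Adj z u}
  have h3 : #({u ∈ W | G.Adj x u} ∪ {u ∈ W | G.Adj y u} ∪ {u ∈ W | G.Adj z u}) ≤ #W :=
    card_le_card (union_subset (union_subset (filter_subset _ _) (filter_subset _ _))
      (filter_subset _ _))
  rw [union_inter_distrib_right] at h2
  have h4 := card_union_le ({u ∈ W | G.Adj x u} ∩ {u ∈ W | G.Adj z u})
    ({u ∈ W | G.Adj y u} ∩ {u ∈ W | G.Adj z u})
  simp only [← filter_and] at h1 h2 h4
  omega

/-- A graph of large minimum degree without a given odd cycle is bipartite. -/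
theorem exists_bipartition {k : ℕ} (hk : 2 ≤ k) (hfree : CycleFree G (2 * k + 1))
    (hdeg : ∀ v ∈ W, 6 * #W ≤ 16 * degIn G W v + 3) (hcard : 48 * k + 20 ≤ #W) :
    ∃ A B : Finset V, A ∪ B = W ∧ Disjoint A B ∧ (∀ x ∈ A, ∀ y ∈ A, ¬ G.Adj x y) ∧
      (∀ x ∈ B, ∀ y ∈ B, ¬ G.Adj x y) := by
  have hW : ∀ x ∈ W, ∀ y ∈ W, ∀ z ∈ W, Linked G W (2 * k + 1) x y ∨
      Linked G W (2 * k + 1) x z ∨ Linked G W (2 * k + 1) y z := by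
    intro x hx y hy z hz
    refine linked_or_linked_or_linked ?_
    have h1 := hdeg x hx
    have h2 := hdeg y hy
    have h3 := hdeg z hz
    omega
  obtain ⟨u, hu⟩ := card_pos.mp (show 0 < #W by omega)
  obtain ⟨v, hv⟩ := card_pos.mp (show 0 < #{z ∈ W | G.Adj u z} by
    have h1 := hdeg u hu
    unfold degIn at h1
    omega)
  rw [mem_filter] at hv
  have huv : ¬ Linked G W (2 * k + 1) u v := fun h => not_adj_of_linked hk hfree hW h hv.2
  classical
  refine ⟨{x ∈ W | Linked G W (2 * k + 1) u x}, {x ∈ W | ¬ Linked G W (2 * k + 1) u x},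
    filter_union_filter_not_eq _ _, disjoint_filter_filter_not _ _ _, ?_, ?_⟩
  · intro x hx y hy
    rw [mem_filter] at hx hy
    exact not_adj_of_linked_of_linked hk hfree hW hx.2 hy.2
  · intro x hx y hy
    rw [mem_filter] at hx hy
    have h1 := hW u hu v hv.1 x hx.1
    have h2 := hW u hu v hv.1 y hy.1
    exact not_adj_of_linked_of_linked hk hfree hW (v := v) (by tauto) (by tauto)

end Links

/-! ### Dense bipartite cores -/

/-- Disjoint sets `A` and `B`, each consisting of pairwise linked vertices, such that every vertex
of one has several neighbours in the other. -/
structure IsCore {V : Type*} (G : SimpleGraph V) [DecidableRel G.Adj] (W : Finset V) (k : ℕ)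
    (A B : Finset V) : Prop where
  disjoint : Disjoint A B
  indep_left : ∀ x ∈ A, ∀ y ∈ A, ¬ G.Adj x y
  indep_right : ∀ x ∈ B, ∀ y ∈ B, ¬ G.Adj x y
  linked_left : ∀ x ∈ A, ∀ y ∈ A, Linked G W (2 * k + 1) x y
  linked_right : ∀ x ∈ B, ∀ y ∈ B, Linked G W (2 * k + 1) x y
  card_left : k ≤ #A
  card_right : k ≤ #B
  degIn_left : ∀ x ∈ A, 2 ≤ degIn G B x
  degIn_right : ∀ x ∈ B, 2 ≤ degIn G A x

theorem not_adj_insert {V : Type*} [DecidableEq V] {G : SimpleGraph V} {X : Finset V}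
    (hX : ∀ x ∈ X, ∀ y ∈ X, ¬ G.Adj x y) {v : V}
    (hv : ∀ x ∈ X, ¬ G.Adj v x) : ∀ x ∈ insert v X, ∀ y ∈ insert v X, ¬ G.Adj x y := by
  intro x hx y hy
  rw [mem_insert] at hx hy
  rcases hx with rfl | hx <;> rcases hy with rfl | hy
  · exact G.irrefl
  · exact hv y hy
  · exact fun h => hv x hx h.symm
  · exact hX x hx y hy

section Core

variable {V : Type*} {G : SimpleGraph V} [DecidableRel G.Adj] {W A B : Finset V} {k : ℕ}

theorem IsCore.symm (h : IsCore G W k A B) : IsCore G W k B A :=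
  ⟨h.disjoint.symm, h.indep_right, h.indep_left, h.linked_right, h.linked_left, h.card_right,
    h.card_left, h.degIn_right, h.degIn_left⟩

theorem exists_adj_of_degIn_pos {v : V} (h : 1 ≤ degIn G A v) : ∃ a ∈ A, G.Adj v a := by
  obtain ⟨a, ha⟩ := card_pos.mp h
  exact ⟨a, mem_filter.mp ha⟩

theorem exists_adj_ne_of_two_le_degIn {v : V} (h : 2 ≤ degIn G A v) (x : V) :
    ∃ a ∈ A, G.Adj v a ∧ a ≠ x := by
  obtain ⟨a, ha, hne⟩ : ∃ a ∈ {z ∈ A | G.Adj v z}, a ∉ ({x} : Finset V) :=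
    exists_mem_notMem_of_card_lt_card (lt_of_lt_of_le (by rw [card_singleton]; omega) h)
  rw [mem_filter] at ha
  exact ⟨a, ha.1, ha.2, by simpa using hne⟩

variable [DecidableEq V]

/-- A vertex outside a core has neighbours on at most one side. -/
theorem IsCore.not_adj (h : IsCore G W k A B) (hk : 2 ≤ k) (hfree : CycleFree G (2 * k + 1))
    {v a b : V} (hvA : v ∉ A) (ha : a ∈ A) (hb : b ∈ B) (hva : G.Adj v a) : ¬ G.Adj v b := by
  intro hvb
  obtain ⟨a', ha', hba', hne⟩ := exists_adj_ne_of_two_le_degIn (h.degIn_right b hb) a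
  exact hne (eq_of_adj_of_pairwise_linked hk hfree h.linked_left h.card_left hvA
    (disjoint_right.mp h.disjoint hb) ha ha' hvb hva hba').symm

/-- One side of a core stays independent when outer vertices with two neighbours on the other side
are added to it. -/
theorem IsCore.indep_union (h : IsCore G W k A B) (hk : 2 ≤ k)
    (hfree : CycleFree G (2 * k + 1)) {M : Finset V}
    (hM : ∀ v ∈ M, v ∉ A ∧ v ∉ B ∧ 2 ≤ degIn G B v) :
    ∀ x ∈ A ∪ M, ∀ y ∈ A ∪ M, ¬ G.Adj x y := by
  have hAM : ∀ x ∈ A, ∀ y ∈ M, ¬ G.Adj y x := by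
    intro x hx y hy hadj
    obtain ⟨hyA, -, hyB⟩ := hM y hy
    obtain ⟨b, hb, hyb⟩ := exists_adj_of_degIn_pos (show 1 ≤ degIn G B y by omega)
    exact h.not_adj hk hfree hyA hx hb hadj hyb
  intro x hx y hy hadj
  rcases mem_union.mp hx with hx | hx <;> rcases mem_union.mp hy with hy | hy
  · exact h.indep_left x hx y hy hadj
  · exact hAM x hx y hy hadj.symm
  · exact hAM y hy x hx hadj
  · obtain ⟨-, hxB, hx2⟩ := hM x hx
    obtain ⟨-, hyB, hy2⟩ := hM y hy
    obtain ⟨b, hb, hxb⟩ := exists_adj_of_degIn_pos (show 1 ≤ degIn G B x by omega)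
    obtain ⟨b', hb', hyb', hne⟩ := exists_adj_ne_of_two_le_degIn hy2 b
    exact hne (eq_of_adj_of_pairwise_linked hk hfree h.linked_right h.card_right hxB hyB hb hb'
      hadj hxb hyb').symm

/-- Two disjoint independent sets whose vertices have many neighbours in a dense bipartite graph
form a core. -/
theorem isCore_of_degIn (hAB : Disjoint A B) (hcard : 48 * k + 20 ≤ #(A ∪ B))
    (hA : 16 * #A ≤ 10 * #(A ∪ B) + 3) (hB : 16 * #B ≤ 10 * #(A ∪ B) + 3)
    {X Y : Finset V} (hAX : A ⊆ X) (hBY : B ⊆ Y) (hXY : Disjoint X Y)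
    (hX : ∀ x ∈ X, ∀ y ∈ X, ¬ G.Adj x y) (hY : ∀ x ∈ Y, ∀ y ∈ Y, ¬ G.Adj x y)
    (hdX : ∀ x ∈ X, 6 * #(A ∪ B) ≤ 16 * degIn G B x + 3)
    (hdY : ∀ x ∈ Y, 6 * #(A ∪ B) ≤ 16 * degIn G A x + 3) :
    IsCore G (A ∪ B) k X Y := by
  have hc := card_union_of_disjoint hAB
  refine ⟨hXY, hX, hY, ?_, ?_, ?_, ?_, ?_, ?_⟩
  · intro x hx y hy
    have h1 := hdX x hx
    have h2 := hdX y hy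
    exact linked_of_degIn subset_union_right (by omega)
  · intro x hx y hy
    have h1 := hdY x hx
    have h2 := hdY y hy
    exact linked_of_degIn subset_union_left (by omega)
  · have := card_le_card hAX
    omega
  · have := card_le_card hBY
    omega
  · intro x hx
    have h1 := hdX x hx
    have h2 := degIn_mono (G := G) hBY x
    omega
  · intro x hx
    have h1 := hdY x hx
    have h2 := degIn_mono (G := G) hAX x
    omega

variable [Fintype V]

theorem IsCore.degIn_left_le_one {t : ℕ} (h : IsCore G W k A B) (hk : 2 ≤ k)
    (hfree : CycleFree G (2 * k + 1)) (ht : 1 ≤ t)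
    (hd2 : ∀ T : Finset V, (G.induce ((↑T : Set V)ᶜ)).Colorable 2 → t ≤ T.card)
    (hcard : #(A ∪ B)ᶜ = t + 1) {v : V} (hv : v ∈ (A ∪ B)ᶜ) : degIn G A v ≤ 1 := by
  by_contra! hdeg
  obtain ⟨w, hw, hwv⟩ : ∃ w ∈ (A ∪ B)ᶜ, w ∉ ({v} : Finset V) :=
    exists_mem_notMem_of_card_lt_card (by rw [card_singleton]; omega)
  rw [mem_singleton] at hwv
  have hsmall : ∀ X : Finset V, A ∪ B ⊆ X → v ∈ X → w ∈ X → #Xᶜ < t := by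
    intro X hX hvX hwX
    have h1 : Xᶜ ⊆ ((A ∪ B)ᶜ.erase v).erase w := by
      intro z hz
      rw [mem_compl] at hz
      simp only [mem_erase, mem_compl]
      refine ⟨?_, ?_, fun hzX => hz (hX hzX)⟩
      · rintro rfl
        exact hz hwX
      · rintro rfl
        exact hz hvX
    have h2 := card_le_card h1
    rw [card_erase_of_mem (mem_erase.mpr ⟨hwv, hw⟩), card_erase_of_mem hv, hcard] at h2
    omega
  obtain ⟨p, hp, hvp⟩ := exists_adj_of_degIn_pos (show 1 ≤ degIn G A v by omega)
  have hvA : v ∉ A := fun hvA => mem_compl.mp hv (mem_union_left _ hvA)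
  have hwA : w ∉ A := fun hwA => mem_compl.mp hw (mem_union_left _ hwA)
  have hB := not_adj_insert h.indep_right fun b hb => h.not_adj hk hfree hvA hp hb hvp
  by_cases hwx : ∃ x ∈ A, G.Adj w x
  · obtain ⟨x, hx, hwx⟩ := hwx
    obtain ⟨q, hq, hvq, hqx⟩ := exists_adj_ne_of_two_le_degIn hdeg x
    have hvw : ¬ G.Adj w v := fun hwv => hqx (eq_of_adj_of_pairwise_linked hk hfree
      h.linked_left h.card_left hvA hwA hq hx hwv.symm hvq hwx)
    have hB' := not_adj_insert hB (v := w) (by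
      intro b hb
      rcases mem_insert.mp hb with rfl | hb
      · exact hvw
      · exact h.not_adj hk hfree hwA hx hb hwx)
    have h1 := le_card_compl_union hd2 h.indep_left hB'
    have h2 := hsmall (A ∪ insert w (insert v B)) (by grind) (by simp) (by simp)
    omega
  · push Not at hwx
    have h1 := le_card_compl_union hd2 (not_adj_insert h.indep_left hwx) hB
    have h2 := hsmall (insert w A ∪ insert v B) (by grind) (by simp) (by simp)
    omega

/-- If `t + 1` vertices lie outside a core, then each has at most one neighbour in it. -/
theorem IsCore.degIn_le_one {t : ℕ} (h : IsCore G W k A B) (hk : 2 ≤ k)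
    (hfree : CycleFree G (2 * k + 1)) (ht : 1 ≤ t)
    (hd2 : ∀ T : Finset V, (G.induce ((↑T : Set V)ᶜ)).Colorable 2 → t ≤ T.card)
    (hcard : #(A ∪ B)ᶜ = t + 1) {v : V} (hv : v ∈ (A ∪ B)ᶜ) : degIn G (A ∪ B) v ≤ 1 := by
  have h1 := h.degIn_left_le_one hk hfree ht hd2 hcard hv
  have h2 := h.symm.degIn_left_le_one hk hfree ht hd2 (by rwa [union_comm])
    (by rwa [union_comm])
  rw [degIn_union h.disjoint]
  by_contra! hcon
  obtain ⟨a, ha, hva⟩ := exists_adj_of_degIn_pos (show 1 ≤ degIn G A v by omega)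
  obtain ⟨b, hb, hvb⟩ := exists_adj_of_degIn_pos (show 1 ≤ degIn G B v by omega)
  exact h.not_adj hk hfree (fun hvA => mem_compl.mp hv (mem_union_left _ hvA)) ha hb hva hvb

/-- If only `t` vertices lie outside the extension of a core, then the extension contains two
vertices of small degree. -/
theorem IsCore.exists_pair {t : ℕ} (h : IsCore G W k A B) (hk : 2 ≤ k)
    (hfree : CycleFree G (2 * k + 1)) (ht : 1 ≤ t)
    (hd2 : ∀ T : Finset V, (G.induce ((↑T : Set V)ᶜ)).Colorable 2 → t ≤ T.card)
    {M N : Finset V} (hM : ∀ v ∈ M, v ∉ A ∧ v ∉ B ∧ 2 ≤ degIn G B v)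
    (hN : ∀ v ∈ N, v ∉ A ∧ v ∉ B ∧ 2 ≤ degIn G A v) (hMN : Disjoint M N)
    (hcard : #(A ∪ M ∪ (B ∪ N))ᶜ = t) :
    ∃ x ∈ M, ∃ y ∈ N, (∃ b ∈ B, degIn G A b + degIn G A y ≤ #A) ∧
      ∃ a ∈ A, degIn G B a + degIn G B x ≤ #B := by
  have hX := h.indep_union hk hfree hM
  have hY := h.symm.indep_union hk hfree fun v hv => ⟨(hN v hv).2.1, (hN v hv).1, (hN v hv).2.2⟩
  obtain ⟨v, hv⟩ := card_pos.mp (show 0 < #(A ∪ M ∪ (B ∪ N))ᶜ by omega)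
  have hsmall : ∀ X : Finset V, A ∪ M ∪ (B ∪ N) ⊆ X → v ∈ X → #Xᶜ < t := by
    intro X hX hvX
    rw [← hcard]
    refine card_lt_card ⟨compl_subset_compl.mpr hX, fun hsub => ?_⟩
    exact mem_compl.mp (hsub hv) hvX
  have hv' : v ∉ A ∧ v ∉ B := by
    simp only [mem_compl, mem_union, not_or] at hv
    exact ⟨hv.1.1, hv.2.1⟩
  obtain ⟨x, hx, hvx⟩ : ∃ x ∈ A ∪ M, G.Adj v x := by
    by_contra! hcon
    have h1 := le_card_compl_union hd2 (not_adj_insert hX hcon) hY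
    have h2 := hsmall (insert v (A ∪ M) ∪ (B ∪ N)) (by grind) (by simp)
    omega
  obtain ⟨y, hy, hvy⟩ : ∃ y ∈ B ∪ N, G.Adj v y := by
    by_contra! hcon
    have h1 := le_card_compl_union hd2 hX (not_adj_insert hY hcon)
    have h2 := hsmall (A ∪ M ∪ insert v (B ∪ N)) (by grind) (by simp)
    omega
  rcases mem_union.mp hx with hx | hx <;> rcases mem_union.mp hy with hy | hy
  · exact absurd hvy (h.not_adj hk hfree hv'.1 hx hy hvx)
  · obtain ⟨hyA, -, hy2⟩ := hN y hy
    obtain ⟨a, ha, hya, hne⟩ := exists_adj_ne_of_two_le_degIn hy2 x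
    exact absurd (eq_of_adj_of_pairwise_linked hk hfree h.linked_left h.card_left hv'.1 hyA hx ha
      hvy hvx hya) hne.symm
  · obtain ⟨-, hxB, hx2⟩ := hM x hx
    obtain ⟨b, hb, hxb, hne⟩ := exists_adj_ne_of_two_le_degIn hx2 y
    exact absurd (eq_of_adj_of_pairwise_linked hk hfree h.linked_right h.card_right hv'.2 hxB hy
      hb hvx hvy hxb) hne.symm
  · obtain ⟨hxA, hxB, hx2⟩ := hM x hx
    obtain ⟨hyA, hyB, hy2⟩ := hN y hy
    have hxy : x ≠ y := fun hxy => disjoint_left.mp hMN hx (hxy ▸ hy)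
    have hno : ∀ a ∈ A, ∀ b ∈ B, G.Adj x b → G.Adj y a → ¬ G.Adj b a := by
      intro a ha b hb hxb hya
      refine not_adj_of_path_four hk hfree h.linked_left h.card_left ha
        (disjoint_right.mp h.disjoint hb) hxA hyA hv'.1 hxy ?_ ?_ hvx hvy hxb hya
        (h.degIn_right b hb)
      · rintro rfl
        exact hyB hb
      · rintro rfl
        exact hv'.2 hb
    have hadd : ∀ (S : Finset V) (u u' : V), (∀ z ∈ S, G.Adj u z → ¬ G.Adj u' z) →
        degIn G S u + degIn G S u' ≤ #S := by
      intro S u u' hS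
      rw [degIn, degIn, ← card_union_of_disjoint (disjoint_filter.mpr hS)]
      exact card_le_card (union_subset (filter_subset _ _) (filter_subset _ _))
    obtain ⟨a, ha, hya⟩ := exists_adj_of_degIn_pos (show 1 ≤ degIn G A y by omega)
    obtain ⟨b, hb, hxb⟩ := exists_adj_of_degIn_pos (show 1 ≤ degIn G B x by omega)
    refine ⟨x, hx, y, hy, ⟨b, hb, hadd A b y fun z hz hbz hyz => hno z hz b hb hxb hyz hbz⟩,
      ⟨a, ha, hadd B a x fun z hz haz hxz => hno a ha z hz hxz hya haz.symm⟩⟩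

end Core
/-! ### Numerical estimates -/

section Estimates

variable {k n t e w : ℕ}

theorem lt_card_of_dense (hk : 2 ≤ k) (ht : 1 ≤ t) (hn : 318 * t ^ 2 * k ≤ n)
    (he : (n - t - 1) ^ 2 ≤ 4 * e) (hw : 16 * e + 3 * w ^ 2 ≤ 8 * w ^ 2 + 3 * n ^ 2) :
    48 * k + 20 ≤ w := by
  by_contra! hcon
  have hn1 : 318 * k ≤ n := by nlinarith [Nat.pow_le_pow_left ht 2]
  have hn2 : 318 * (t + 1) ≤ n := by nlinarith [Nat.mul_le_mul ht ht, Nat.mul_le_mul hk ht]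
  obtain ⟨r, rfl⟩ : ∃ r, n = r + t + 1 := ⟨n - t - 1, by omega⟩
  rw [show r + t + 1 - t - 1 = r by omega] at he
  have hw58 : 5 * w ≤ r + t + 1 := by omega
  have hr : 317 * (t + 1) ≤ r := by omega
  nlinarith [Nat.mul_le_mul hw58 hw58, Nat.mul_le_mul hr hr]

theorem sub_le_of_dense {s : ℕ} (hk : 2 ≤ k) (ht : 1 ≤ t) (hn : 318 * t ^ 2 * k ≤ n)
    (he : (n - t - 1) ^ 2 ≤ 4 * e) (hw : 16 * e ≤ w ^ 2 + 3 * n ^ 2) (hs : w + s = n) :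
    s ≤ 5 * (t + 1) := by
  have hn2 : 318 * (t + 1) ≤ n := by nlinarith [Nat.mul_le_mul ht ht, Nat.mul_le_mul hk ht]
  have h1 : n ^ 2 ≤ w ^ 2 + 8 * (t + 1) * n := by
    obtain ⟨r, rfl⟩ : ∃ r, n = r + t + 1 := ⟨n - t - 1, by omega⟩
    rw [show r + t + 1 - t - 1 = r by omega] at he
    nlinarith
  have h2 : s * (n + w) ≤ 8 * (t + 1) * n := by
    subst hs
    nlinarith
  have h3 : s ≤ 8 * (t + 1) := by
    by_contra! hcon
    nlinarith
  by_contra! hcon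
  have h4 : 310 * n ≤ 318 * w := by omega
  nlinarith

theorem false_of_dense {s q E : ℕ} (hk : 2 ≤ k) (ht : 1 ≤ t) (hn : 318 * t ^ 2 * k ≤ n)
    (he : (n - t - 1) ^ 2 ≤ 4 * e) (hq : t + 2 ≤ q) (hqs : q ≤ s) (hs : s ≤ 5 * (t + 1))
    (hE : 16 * E ≤ 16 * q + 6 * n + 16 * (q * s))
    (hbound : 4 * e ≤ (n - q) ^ 2 + 4 * E + 2 * (q * (q - 1))) : False := by
  have hn1 : 636 * t ^ 2 ≤ n := by nlinarith [Nat.mul_le_mul ht ht]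
  have ht2 : t ≤ t ^ 2 := by nlinarith
  obtain ⟨j, rfl⟩ : ∃ j, q = t + 1 + (j + 1) := ⟨q - t - 2, by omega⟩
  obtain ⟨r, rfl⟩ : ∃ r, n = r + (t + 1 + (j + 1)) := ⟨n - (t + 1 + (j + 1)), by omega⟩
  rw [show r + (t + 1 + (j + 1)) - t - 1 = r + (j + 1) by omega] at he
  rw [show r + (t + 1 + (j + 1)) - (t + 1 + (j + 1)) = r by omega,
    show t + 1 + (j + 1) - 1 = t + 1 + j by omega] at hbound
  set q := t + 1 + (j + 1) with hqdef
  have hq1 : q ≤ (t + 2) * (j + 1) := by nlinarith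
  have hq2 : t + 1 + j ≤ 5 * (t + 1) := by omega
  have h1 : q * (4 + 4 * s + 2 * (t + 1 + j)) ≤
      (t + 2) * (j + 1) * (4 + 30 * (t + 1)) :=
    Nat.mul_le_mul hq1 (by omega)
  have h2 : 2 * r * (j + 1) + (j + 1) ^ 2 ≤
      q * (4 + 4 * s + 2 * (t + 1 + j)) + (3 * (r + q)) / 2 + 1 := by
    have : 8 * E ≤ 8 * q + 3 * (r + q) + 8 * (q * s) := by omega
    have h3 : (r + (j + 1)) ^ 2 ≤ r ^ 2 + 4 * E + 2 * (q * (t + 1 + j)) := he.trans hbound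
    have h4 : 2 * r * (j + 1) + (j + 1) ^ 2 ≤ 4 * E + 2 * (q * (t + 1 + j)) := by nlinarith
    have h5 : q * (4 + 4 * s + 2 * (t + 1 + j)) = 4 * q + 4 * (q * s) + 2 * (q * (t + 1 + j)) := by
      ring
    omega
  have h3 : 4 * r * (j + 1) ≤ 2 * ((t + 2) * (j + 1) * (4 + 30 * (t + 1))) + 3 * (r + q) + 2 := by
    have : 4 * r * (j + 1) = 2 * (2 * r * (j + 1)) := by ring
    have : 0 ≤ (j + 1) ^ 2 := Nat.zero_le _
    omega
  have h4 : 3 * r ≤ 3 * r * (j + 1) := by nlinarith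
  have h5 : r * (j + 1) ≤ (2 * ((t + 2) * (4 + 30 * (t + 1))) + 3 * (t + 2) + 2) * (j + 1) := by
    nlinarith
  have h6 := Nat.le_of_mul_le_mul_right h5 (Nat.succ_pos j)
  nlinarith

end Estimates

end VertexStability

open VertexStability Finset in
/-- Theorem (vertex-stability, bound): if `G` is a `C_{2k+1}`-free graph on `n` vertices with
`d₂(G) ≥ t` (every vertex set whose removal makes `G` bipartite has size at least `t`),
`1 ≤ t ≤ 2k-2` and `n ≥ 318 t² k`, then `e(G) ≤ ⌊(n-t-1)²/4⌋ + C(t+2, 2)`. -/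
theorem stmt0 {V : Type*} [Fintype V] [DecidableEq V]
    (k n t : ℕ) (hk : 2 ≤ k) (ht1 : 1 ≤ t) (ht2 : t ≤ 2 * k - 2)
    (hn : 318 * t ^ 2 * k ≤ n)
    (G : SimpleGraph V) [DecidableRel G.Adj]
    (hcard : Fintype.card V = n)
    (hfree : CycleFree G (2 * k + 1))
    (hd2 : ∀ T : Finset V, (G.induce ((↑T : Set V)ᶜ)).Colorable 2 → t ≤ T.card) :
    G.edgeFinset.card ≤ (n - t - 1) ^ 2 / 4 + (t + 2).choose 2 := by
  by_contra! hcon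
  have hbig : (n - t - 1) ^ 2 + 2 * ((t + 2) * (t + 1)) + 1 ≤ 4 * #G.edgeFinset := by
    have h1 : 2 * (t + 2).choose 2 = (t + 2) * (t + 1) := by
      rw [Nat.choose_two_right, Nat.mul_div_cancel' (Nat.even_mul_pred_self (t + 2)).two_dvd]
      simp
    omega
  have hbig' : (n - t - 1) ^ 2 ≤ 4 * #G.edgeFinset := by omega
  obtain ⟨W, hdeg, hpot⟩ := exists_dense_subset G
  rw [hcard] at hpot
  have hw : 48 * k + 20 ≤ #W := by
    refine lt_card_of_dense hk ht1 hn hbig' (hpot.trans ?_)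
    have : ∑ v ∈ W, degIn G W v ≤ #W * #W :=
      sum_le_card_nsmul _ _ _ fun v _ => degIn_le_card _ _
    rw [pow_two #W]
    omega
  obtain ⟨A, B, rfl, hAB, hA, hB⟩ := exists_bipartition hk hfree hdeg hw
  have hABc := card_union_of_disjoint hAB
  have hs : #(A ∪ B) + #(A ∪ B)ᶜ = n := by rw [card_add_card_compl, hcard]
  have hs5 : #(A ∪ B)ᶜ ≤ 5 * (t + 1) := by
    refine sub_le_of_dense hk ht1 hn hbig' ?_ hs
    have h1 := sum_degIn_le hA hB hAB
    have h2 : 4 * (#A * #B) ≤ #(A ∪ B) ^ 2 := by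
      rw [hABc, ← mul_assoc]
      exact four_mul_le_pow_two_add _ _
    omega
  have hdA : ∀ a ∈ A, 6 * #(A ∪ B) ≤ 16 * degIn G B a + 3 := by
    intro a ha
    have := hdeg a (mem_union_left _ ha)
    rwa [degIn_union hAB, degIn_eq_zero (hA a ha), zero_add] at this
  have hdB : ∀ b ∈ B, 6 * #(A ∪ B) ≤ 16 * degIn G A b + 3 := by
    intro b hb
    have := hdeg b (mem_union_right _ hb)
    rwa [degIn_union hAB, degIn_eq_zero (hB b hb), add_zero] at this
  have hAle : ∀ b ∈ B, 6 * #(A ∪ B) ≤ 16 * #A + 3 := fun b hb =>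
    (hdB b hb).trans (by have := degIn_le_card (G := G) A b; omega)
  have hBle : ∀ a ∈ A, 6 * #(A ∪ B) ≤ 16 * #B + 3 := fun a ha =>
    (hdA a ha).trans (by have := degIn_le_card (G := G) B a; omega)
  have hAne : A.Nonempty := by
    rw [nonempty_iff_ne_empty]
    rintro rfl
    obtain ⟨b, hb⟩ := card_pos.mp (show 0 < #B by simp at hw; omega)
    have := hAle b hb
    simp at this hw
    omega
  obtain ⟨a₀, ha₀⟩ := hAne
  have hBcard := hBle a₀ ha₀
  obtain ⟨b₀, hb₀⟩ := card_pos.mp (show 0 < #B by omega)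
  have hAcard := hAle b₀ hb₀
  have hcore : IsCore G (A ∪ B) k A B := isCore_of_degIn hAB hw (by omega) (by omega)
    subset_rfl subset_rfl hAB hA hB hdA hdB
  obtain ⟨M, hMdef⟩ : ∃ M : Finset V, M = {v ∈ (A ∪ B)ᶜ | 2 ≤ degIn G B v} := ⟨_, rfl⟩
  obtain ⟨N, hNdef⟩ : ∃ N : Finset V, N = {v ∈ (A ∪ B)ᶜ | 2 ≤ degIn G A v} := ⟨_, rfl⟩
  have hM : ∀ v ∈ M, v ∉ A ∧ v ∉ B ∧ 2 ≤ degIn G B v := by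
    intro v hv
    simpa [hMdef, and_assoc] using hv
  have hN : ∀ v ∈ N, v ∉ A ∧ v ∉ B ∧ 2 ≤ degIn G A v := by
    intro v hv
    simpa [hNdef, and_assoc] using hv
  have hside : ∀ v, v ∉ A → 1 ≤ degIn G A v → degIn G B v = 0 := by
    intro v hvA hv
    obtain ⟨a, ha, hva⟩ := exists_adj_of_degIn_pos hv
    exact degIn_eq_zero fun b hb => hcore.not_adj hk hfree hvA ha hb hva
  have hMN : Disjoint M N := by
    rw [disjoint_left]
    intro v hvM hvN
    have h1 := hM v hvM
    have h2 := hside v h1.1 (by have := hN v hvN; omega)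
    omega
  have hX := hcore.indep_union hk hfree hM
  have hY := hcore.symm.indep_union hk hfree fun v hv =>
    ⟨(hN v hv).2.1, (hN v hv).1, (hN v hv).2.2⟩
  have hXY : Disjoint (A ∪ M) (B ∪ N) := by
    simp only [disjoint_union_left, disjoint_union_right]
    exact ⟨⟨hAB, disjoint_left.mpr fun v hv => (hM v hv).2.1⟩,
      ⟨disjoint_right.mpr fun v hv => (hN v hv).1, hMN⟩⟩
  have hQ : ∀ v ∈ (A ∪ M ∪ (B ∪ N))ᶜ, v ∈ (A ∪ B)ᶜ ∧ degIn G (A ∪ B) v ≤ 1 := by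
    intro v hv
    simp only [mem_compl, mem_union, not_or, hMdef, hNdef, mem_filter, not_and, not_le] at hv ⊢
    have hv' : v ∉ A ∧ v ∉ B := ⟨hv.1.1, hv.2.1⟩
    have h1 := hv.1.2 hv'
    have h2 := hv.2.2 hv'
    have h3 := hside v hv'.1
    rw [degIn_union hAB]
    exact ⟨hv', by omega⟩
  have hremove : ∀ P ⊆ (A ∪ B)ᶜ, t + 2 ≤ #((A ∪ M ∪ (B ∪ N))ᶜ ∪ P) →
      16 * ∑ v ∈ P, degIn G (A ∪ B) v ≤ 6 * n → False := by
    intro P hP hq hsum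
    have hcompl : ((A ∪ M) \ P ∪ (B ∪ N) \ P)ᶜ = (A ∪ M ∪ (B ∪ N))ᶜ ∪ P := by
      rw [← union_sdiff_distrib, sdiff_eq_inter_compl, compl_inter, compl_compl]
    have hQP : (A ∪ M ∪ (B ∪ N))ᶜ ∪ P ⊆ (A ∪ B)ᶜ :=
      union_subset (fun v hv => (hQ v hv).1) hP
    have hXP : Disjoint ((A ∪ M) \ P) ((B ∪ N) \ P) :=
      hXY.mono sdiff_subset sdiff_subset
    have h1 := two_mul_card_edgeFinset_le
      (fun x hx y hy => hX x (mem_sdiff.mp hx).1 y (mem_sdiff.mp hy).1)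
      (fun x hx y hy => hY x (mem_sdiff.mp hx).1 y (mem_sdiff.mp hy).1) hXP
    have h2 := card_add_card_compl ((A ∪ M) \ P ∪ (B ∪ N) \ P)
    rw [hcompl, card_union_of_disjoint hXP, hcard] at h2
    rw [hcompl] at h1
    have h3 := four_mul_le_pow_two_add #((A ∪ M) \ P) #((B ∪ N) \ P)
    rw [show #((A ∪ M) \ P) + #((B ∪ N) \ P) = n - #((A ∪ M ∪ (B ∪ N))ᶜ ∪ P) by omega,
      mul_assoc] at h3
    have h4 : ∑ v ∈ (A ∪ M ∪ (B ∪ N))ᶜ ∪ P, degIn G ((A ∪ M) \ P ∪ (B ∪ N) \ P) v ≤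
        ∑ v ∈ (A ∪ M ∪ (B ∪ N))ᶜ ∪ P, (degIn G (A ∪ B) v + #(A ∪ B)ᶜ) := by
      refine sum_le_sum fun v _ => ?_
      refine (degIn_mono (subset_univ _) v).trans ?_
      rw [← union_compl (A ∪ B), degIn_union disjoint_compl_right]
      exact Nat.add_le_add_left (degIn_le_card _ _) _
    rw [sum_add_distrib, sum_const, smul_eq_mul] at h4
    have h5 : ∑ v ∈ (A ∪ M ∪ (B ∪ N))ᶜ ∪ P, degIn G (A ∪ B) v ≤
        #((A ∪ M ∪ (B ∪ N))ᶜ ∪ P) + ∑ v ∈ P, degIn G (A ∪ B) v := by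
      rw [← sdiff_union_self_eq_union, sum_union sdiff_disjoint]
      refine Nat.add_le_add_right ?_ _
      have h6 : ∑ v ∈ (A ∪ M ∪ (B ∪ N))ᶜ \ P, degIn G (A ∪ B) v ≤
          #((A ∪ M ∪ (B ∪ N))ᶜ \ P) • 1 :=
        sum_le_card_nsmul _ _ _ fun v hv => (hQ v (mem_sdiff.mp hv).1).2
      rw [smul_eq_mul, mul_one] at h6
      exact h6.trans (card_le_card subset_union_left)
    exact false_of_dense hk ht1 hn hbig' hq (card_le_card hQP) hs5 (by omega)
      (show _ ≤ _ + 4 * ∑ v ∈ (A ∪ M ∪ (B ∪ N))ᶜ ∪ P,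
        degIn G ((A ∪ M) \ P ∪ (B ∪ N) \ P) v + _ by omega)
  have hMW : M ⊆ (A ∪ B)ᶜ := by
    rw [hMdef]
    exact filter_subset _ _
  have hNW : N ⊆ (A ∪ B)ᶜ := by
    rw [hNdef]
    exact filter_subset _ _
  have hMdeg : ∀ v ∈ M, degIn G (A ∪ B) v = degIn G B v := by
    intro v hv
    have h1 := hM v hv
    have h2 := hside v h1.1
    rw [degIn_union hAB]
    omega
  have hNdeg : ∀ v ∈ N, degIn G (A ∪ B) v = degIn G A v := by
    intro v hv
    have h1 := hN v hv
    have h2 := hside v h1.1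
    rw [degIn_union hAB]
    omega
  have hMNQ : Disjoint (A ∪ M ∪ (B ∪ N))ᶜ (M ∪ N) := by
    rw [disjoint_left]
    intro v hv hv'
    simp only [mem_compl, mem_union, not_or] at hv hv'
    tauto
  have hlow := le_card_compl_union hd2 hX hY
  rcases Nat.lt_or_ge #(A ∪ M ∪ (B ∪ N))ᶜ (t + 2) with hlt | hge
  swap
  · exact hremove ∅ (empty_subset _) (by simpa using hge) (by simp)
  rcases (show #(A ∪ M ∪ (B ∪ N))ᶜ = t ∨ #(A ∪ M ∪ (B ∪ N))ᶜ = t + 1 by omega) with hq | hq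
  · obtain ⟨x, hx, y, hy, ⟨b, hb, hby⟩, a, ha, hax⟩ :=
      hcore.exists_pair hk hfree ht1 hd2 hM hN hMN hq
    have hxy : x ≠ y := fun hxy => disjoint_left.mp hMN hx (hxy ▸ hy)
    refine hremove {x, y} (insert_subset (hMW hx) (singleton_subset_iff.mpr (hNW hy))) ?_ ?_
    · rw [card_union_of_disjoint (hMNQ.mono_right (insert_subset (mem_union_left _ hx)
        (singleton_subset_iff.mpr (mem_union_right _ hy)))), hq, card_pair hxy]
    · rw [sum_pair hxy, hMdeg x hx, hNdeg y hy]
      have h1 := hdA a ha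
      have h2 := hdB b hb
      omega
  · have hlarge : ∀ v ∈ M ∪ N, 6 * #(A ∪ B) ≤ 16 * degIn G (A ∪ B) v + 3 := by
      intro v hv
      by_contra! hlt
      have hvW : v ∈ (A ∪ B)ᶜ := union_subset hMW hNW hv
      refine hremove {v} (singleton_subset_iff.mpr hvW) ?_ ?_
      · rw [card_union_of_disjoint (hMNQ.mono_right (singleton_subset_iff.mpr hv)), hq,
          card_singleton]
      · rw [sum_singleton]
        omega
    have hcore' : IsCore G (A ∪ B) k (A ∪ M) (B ∪ N) := by
      refine isCore_of_degIn hAB hw (by omega) (by omega) subset_union_left subset_union_left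
        hXY hX hY ?_ ?_
      · intro v hv
        rcases mem_union.mp hv with hv | hv
        · exact hdA v hv
        · rw [← hMdeg v hv]
          exact hlarge v (mem_union_left _ hv)
      · intro v hv
        rcases mem_union.mp hv with hv | hv
        · exact hdB v hv
        · rw [← hNdeg v hv]
          exact hlarge v (mem_union_right _ hv)
    have h1 := two_mul_card_edgeFinset_le hX hY hXY
    have h2 : ∑ v ∈ (A ∪ M ∪ (B ∪ N))ᶜ, degIn G (A ∪ M ∪ (B ∪ N)) v ≤
        #(A ∪ M ∪ (B ∪ N))ᶜ • 1 :=
      sum_le_card_nsmul _ _ _ fun v hv => hcore'.degIn_le_one hk hfree ht1 hd2 hq hv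
    have h3 := card_add_card_compl (A ∪ M ∪ (B ∪ N))
    rw [card_union_of_disjoint hXY, hcard, hq] at h3
    have h4 := four_mul_le_pow_two_add #(A ∪ M) #(B ∪ N)
    rw [show #(A ∪ M) + #(B ∪ N) = n - t - 1 by omega, mul_assoc] at h4
    rw [hq, smul_eq_mul, mul_one] at h2
    rw [hq, show t + 1 - 1 = t by omega] at h1
    nlinarith
end

section
/- Let k ≥ 2, and let n, t be integers with 1 ≤ t ≤ 2k−2 and n ≥ 252t²k. If G is a C_{2k+1}-free graph on n vertices with γ₂(G) ≥ (⌊(t+2)/2⌋ choose 2) + (⌈(t+2)/2⌉ choose 2), then e(G) ≤ ⌊(n−t−1)²/4⌋ + (t+2 choose 2). -/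
namespace SimpleGraph

variable {V : Type*} {G : SimpleGraph V}

/-- There is a path of length `l` from `x` to `y` whose vertices all lie in `S`. -/
def HasPathIn (G : SimpleGraph V) (S : Set V) (x y : V) (l : ℕ) : Prop :=
  ∃ p : G.Walk x y, p.IsPath ∧ p.length = l ∧ ∀ v ∈ p.support, v ∈ S

/-- Two distinct vertices of `W` are joined inside `W` by paths of every length in `[l, M]`
whose parity is compatible with the colouring `χ`. -/
def Linked (G : SimpleGraph V) (χ : V → Bool) (W : Set V) (l M : ℕ) : Prop :=
  ∀ x ∈ W, ∀ y ∈ W, x ≠ y → ∀ L, l ≤ L → L ≤ M → (Even L ↔ χ x = χ y) → G.HasPathIn W x y L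

/-- The colouring `χ` is proper on the subgraph induced by `W`. -/
def ProperOn (G : SimpleGraph V) (χ : V → Bool) (W : Set V) : Prop :=
  ∀ x ∈ W, ∀ y ∈ W, G.Adj x y → χ x ≠ χ y

lemma HasPathIn.mono {S T : Set V} (hST : S ⊆ T) {x y : V} {l : ℕ}
    (h : G.HasPathIn S x y l) : G.HasPathIn T x y l := by
  obtain ⟨p, hp, hl, hs⟩ := h
  exact ⟨p, hp, hl, fun v hv => hST (hs v hv)⟩

lemma HasPathIn.symm {S : Set V} {x y : V} {l : ℕ}
    (h : G.HasPathIn S x y l) : G.HasPathIn S y x l := by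
  obtain ⟨p, hp, hl, hs⟩ := h
  exact ⟨p.reverse, hp.reverse, by simpa using hl, fun v hv => hs v (by simpa using hv)⟩

lemma HasPathIn.cons {S : Set V} {x y z : V} {l : ℕ} (h : G.HasPathIn S y z l)
    (hxy : G.Adj x y) (hx : x ∉ S) : G.HasPathIn (insert x S) x z (l + 1) := by
  obtain ⟨p, hp, hl, hs⟩ := h
  refine ⟨.cons hxy p, (Walk.cons_isPath_iff _ _).2 ⟨hp, fun h => hx (hs _ h)⟩, by simp [hl], ?_⟩
  intro v hv
  rw [Walk.support_cons, List.mem_cons] at hv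
  exact hv.imp id (hs v)

lemma hasPathIn_two {S : Set V} {x y z : V} (hxy : G.Adj x y) (hyz : G.Adj y z) (hxz : x ≠ z)
    (hx : x ∈ S) (hy : y ∈ S) (hz : z ∈ S) : G.HasPathIn S x z 2 := by
  refine ⟨.cons hxy (.cons hyz .nil), ?_, rfl, ?_⟩
  · simp [Walk.cons_isPath_iff, hxy.ne, hyz.ne, hxz]
  · simp [hx, hy, hz]

lemma _root_.CycleFree.not_isPath {m : ℕ} (hfree : CycleFree G (m + 1)) {u v : V}
    (p : G.Walk u v) (hp : p.IsPath) (hl : p.length = m) (h : G.Adj v u) : False := by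
  have hstep : ∀ i j : Fin (m + 1), i - j = 1 → G.Adj (p.getVert i) (p.getVert j) := by
    intro i j hij
    have hi : i = j + 1 := by rw [← hij]; abel
    subst hi
    by_cases hj : j = Fin.last m
    · subst hj
      have h0 : ((Fin.last m + 1 : Fin (m + 1)) : ℕ) = 0 := by simp
      rw [h0, Fin.val_last, Walk.getVert_zero, ← hl, Walk.getVert_length]
      exact h.symm
    · have hlt : (j : ℕ) < m := by
        have := j.2
        have : (j : ℕ) ≠ m := fun h' => hj (Fin.ext h')
        omega
      have h1 : ((j + 1 : Fin (m + 1)) : ℕ) = j + 1 := Fin.val_add_one_of_lt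
        (by simpa [Fin.lt_def] using hlt)
      rw [h1]
      exact (p.adj_getVert_succ (by omega)).symm
  refine hfree ⟨fun i => p.getVert i, ?_⟩ ?_
  · intro i j hij
    rw [cycleGraph_eq_circulantGraph, circulantGraph] at hij
    simp only [fromRel_adj, Set.mem_singleton_iff] at hij
    rcases hij.2 with h' | h'
    · exact hstep i j h'
    · exact (hstep j i h').symm
  · intro i j hij
    have := hp.getVert_injOn (by simp; omega) (by simp; omega) hij
    exact Fin.ext this

/-- In a `C_{m+2}`-free graph, two neighbours of `x` are not joined by a path of length `m`
avoiding `x`. -/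
lemma _root_.CycleFree.not_hasPathIn {m : ℕ} (hfree : CycleFree G (m + 2))
    {S : Set V} {x u v : V} (hx : x ∉ S) (hu : G.Adj x u) (hv : G.Adj x v) :
    ¬ G.HasPathIn S u v m := by
  intro h
  obtain ⟨p, hp, hl, -⟩ := h.cons hu hx
  exact hfree.not_isPath p hp hl hv.symm

/-- A set in which every vertex has at least `L` neighbours contains a path of length `L`. -/
lemma exists_path_of_degree [DecidableEq V] [DecidableRel G.Adj] (X : Finset V) (L : ℕ)
    (hX : X.Nonempty) (hdeg : ∀ x ∈ X, L ≤ (X.filter (G.Adj x)).card) :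
    ∃ x y, G.HasPathIn X x y L := by
  suffices H : ∀ l ≤ L, ∃ x y, G.HasPathIn X x y l from H L le_rfl
  intro l
  induction l with
  | zero =>
    obtain ⟨x, hx⟩ := hX
    exact fun _ => ⟨x, x, .nil, by simp, rfl, by simpa using hx⟩
  | succ l ih =>
    intro hl
    obtain ⟨x, y, p, hp, hpl, hs⟩ := ih (by omega)
    have hxX : x ∈ X := hs x p.start_mem_support
    have hcard : (p.support.toFinset.erase x).card = l := by
      rw [Finset.card_erase_of_mem (by simp), List.toFinset_card_of_nodup hp.support_nodup,
        Walk.length_support, hpl]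
      rfl
    obtain ⟨z, hz, hzp⟩ := Finset.exists_mem_notMem_of_card_lt_card
      (s := p.support.toFinset.erase x) (t := X.filter (G.Adj x))
      (by have := hdeg x hxX; omega)
    rw [Finset.mem_filter] at hz
    have hzs : z ∉ p.support := fun h =>
      hzp (Finset.mem_erase.2 ⟨hz.2.ne', List.mem_toFinset.2 h⟩)
    refine ⟨z, y, .cons hz.2.symm p, (Walk.cons_isPath_iff _ _).2 ⟨hp, hzs⟩, by simp [hpl], ?_⟩
    intro v hv
    rw [Walk.support_cons, List.mem_cons] at hv
    rcases hv with rfl | hv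
    · exact hz.1
    · exact hs v hv

lemma Linked.color_eq {χ : V → Bool} {W : Set V} {k l : ℕ} (hk : 2 ≤ k)
    (hfree : CycleFree G (2 * k + 1)) (hW : G.Linked χ W l (2 * k - 1)) (hl : l ≤ 2 * k - 1)
    {x u v : V} (hx : x ∉ W) (hu : u ∈ W) (hv : v ∈ W) (hxu : G.Adj x u) (hxv : G.Adj x v) :
    χ u = χ v := by
  by_contra hne
  have hfree' : CycleFree G (2 * k - 1 + 2) := by
    rwa [show 2 * k - 1 + 2 = 2 * k + 1 by omega]
  refine hfree'.not_hasPathIn hx hxu hxv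
    (hW u hu v hv (fun h => hne (h ▸ rfl)) _ hl le_rfl ?_)
  have h1 : ¬ Even (2 * k - 1) := by
    rw [Nat.not_even_iff_odd]; exact ⟨k - 1, by omega⟩
  simp [h1, hne]
lemma Linked.exists_color {χ : V → Bool} {W : Set V} {k l : ℕ} (hk : 2 ≤ k)
    (hfree : CycleFree G (2 * k + 1)) (hW : G.Linked χ W l (2 * k - 1)) (hl : l ≤ 2 * k - 1)
    {x : V} (hx : x ∉ W) : ∃ c, ∀ u ∈ W, G.Adj x u → χ u ≠ c := by
  by_cases h : ∃ u ∈ W, G.Adj x u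
  · obtain ⟨u, hu, hxu⟩ := h
    refine ⟨!χ u, fun v hv hxv => ?_⟩
    rw [hW.color_eq hk hfree hl hx hu hv hxu hxv]
    simp
  · exact ⟨true, fun u hu hxu => absurd ⟨u, hu, hxu⟩ h⟩

section Core

variable [DecidableEq V] [DecidableRel G.Adj]

lemma core_hasPathIn {χ : V → Bool} {C H : Finset V} {K : ℕ} (hCH : C ⊆ H)
    (hdeg : ∀ v ∈ H, K ≤ (C.filter fun z => χ z ≠ χ v ∧ G.Adj v z).card)
    (hcom : ∀ v ∈ H, ∀ y ∈ C, χ v = χ y →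
      K ≤ (C.filter fun z => χ z ≠ χ v ∧ G.Adj v z ∧ G.Adj y z).card)
    (L : ℕ) (hL : 2 ≤ L) :
    ∀ x ∈ H, ∀ y ∈ C, x ≠ y → ∀ F : Finset V, x ∉ F → y ∉ F → F.card + L ≤ K →
      (Even L ↔ χ x = χ y) → G.HasPathIn (insert x (↑(C \ F) : Set V)) x y L := by
  induction L, hL using Nat.le_induction with
  | base =>
    intro x hx y hy hxy F _ hyF hF hpar
    obtain ⟨z, hz, hzF⟩ := Finset.exists_mem_notMem_of_card_lt_card
      (lt_of_lt_of_le (by omega : F.card < K) (hcom x hx y hy (hpar.1 even_two)))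
    rw [Finset.mem_filter] at hz
    exact hasPathIn_two hz.2.2.1 hz.2.2.2.symm hxy (by simp) (by simp [hz.1, hzF])
      (by simp [hy, hyF])
  | succ L hL ih =>
    intro x hx y hy hxy F hxF hyF hF hpar
    obtain ⟨z, hz, hzF⟩ := Finset.exists_mem_notMem_of_card_lt_card
      (lt_of_lt_of_le (by have := Finset.card_insert_le y F; omega : (insert y F).card < K)
        (hdeg x hx))
    rw [Finset.mem_filter] at hz
    rw [Finset.mem_insert, not_or] at hzF
    have hpar' : Even L ↔ χ z = χ y := by
      have h1 := hz.2.1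
      rw [Nat.even_add_one] at hpar
      revert hpar h1
      cases χ x <;> cases χ y <;> cases χ z <;> simp
    have h := ih z (hCH hz.1) y hy hzF.1 (insert x F)
      (by simp [hzF.2, hz.2.2.ne']) (by simp [hyF, hxy.symm])
      (by rw [Finset.card_insert_of_notMem hxF]; omega) hpar'
    refine (h.cons hz.2.2 ?_).mono ?_
    · simp [hz.2.2.ne]
    · intro v hv
      simp only [Set.mem_insert_iff, Finset.coe_sdiff, Set.mem_sdiff, Finset.mem_coe,
        Finset.mem_insert, not_or] at hv ⊢
      rcases hv with rfl | rfl | hv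
      · exact Or.inl rfl
      · exact Or.inr ⟨hz.1, hzF.2⟩
      · exact Or.inr ⟨hv.1, hv.2.2⟩

lemma core_properOn {χ : V → Bool} {C H : Finset V} {k : ℕ} (hk : 2 ≤ k)
    (hfree : CycleFree G (2 * k + 1)) (hCH : C ⊆ H)
    (hdeg : ∀ v ∈ H, 2 * k ≤ (C.filter fun z => χ z ≠ χ v ∧ G.Adj v z).card)
    (hcom : ∀ v ∈ H, ∀ y ∈ C, χ v = χ y →
      2 * k ≤ (C.filter fun z => χ z ≠ χ v ∧ G.Adj v z ∧ G.Adj y z).card) :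
    G.ProperOn χ H := by
  intro x hx y hy hxy hχ
  obtain ⟨z, hz, hzF⟩ := Finset.exists_mem_notMem_of_card_lt_card
    (s := {y}) (lt_of_lt_of_le (by simp; omega) (hdeg x hx))
  rw [Finset.mem_filter] at hz
  rw [Finset.mem_singleton] at hzF
  have h := core_hasPathIn hCH hdeg hcom (2 * k - 1) (by omega) y hy z hz.1 (Ne.symm hzF) {x}
    (by simp [hxy.ne']) (by simp [hz.2.2.ne']) (by simp; omega) (by
      have h1 : ¬ Even (2 * k - 1) := by
        rw [Nat.not_even_iff_odd]; exact ⟨k - 1, by omega⟩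
      have h2 := hz.2.1
      rw [← hχ]
      simp [h1, h2.symm])
  have hfree' : CycleFree G (2 * k - 1 + 2) := by
    rwa [show 2 * k - 1 + 2 = 2 * k + 1 by omega]
  exact hfree'.not_hasPathIn (by simp [hxy.ne]) hxy hz.2.2 h

lemma core_linked {χ : V → Bool} {C H : Finset V} {k : ℕ} (hk : 2 ≤ k) (hCH : C ⊆ H)
    (hdeg : ∀ v ∈ H, 2 * k ≤ (C.filter fun z => χ z ≠ χ v ∧ G.Adj v z).card)
    (hcom : ∀ v ∈ H, ∀ y ∈ C, χ v = χ y →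
      2 * k ≤ (C.filter fun z => χ z ≠ χ v ∧ G.Adj v z ∧ G.Adj y z).card) :
    G.Linked χ H 3 (2 * k - 1) := by
  intro x hx y hy hxy L hL hLk hpar
  obtain ⟨z, hz, hzF⟩ := Finset.exists_mem_notMem_of_card_lt_card
    (s := {x}) (lt_of_lt_of_le (by simp; omega) (hdeg y hy))
  rw [Finset.mem_filter] at hz
  rw [Finset.mem_singleton] at hzF
  obtain ⟨L, rfl⟩ : ∃ M, L = M + 1 := ⟨L - 1, by omega⟩
  have h := core_hasPathIn hCH hdeg hcom L (by omega) x hx z hz.1 (Ne.symm hzF) {y}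
    (by simp [hxy]) (by simp [hz.2.2.ne']) (by simp; omega) (by
      have h1 := hz.2.1
      rw [Nat.even_add_one] at hpar
      revert hpar h1
      cases χ x <;> cases χ y <;> cases χ z <;> simp)
  refine ((h.symm.cons hz.2.2 (by simp [hxy.symm])).symm).mono ?_
  intro v hv
  simp only [Set.mem_insert_iff, Finset.coe_sdiff, Set.mem_sdiff, Finset.mem_coe] at hv
  rcases hv with rfl | rfl | hv
  · exact hy
  · exact hx
  · exact hCH hv.1

/-- A dense bipartite-like core `C` forces the set of all vertices with many neighbours in `C` to
be bipartite and linked. -/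
lemma exists_coloring_of_core [Fintype V] {χ : V → Bool} {C : Finset V} {k m d : ℕ} (hk : 2 ≤ k)
    (hfree : CycleFree G (2 * k + 1)) (hd : m + 2 * k ≤ d)
    (hmiss : ∀ y ∈ C, (C.filter fun z => χ z ≠ χ y ∧ ¬ G.Adj y z).card ≤ m)
    (hdeg : ∀ y ∈ C, d ≤ (C.filter fun z => χ z ≠ χ y ∧ G.Adj y z).card) :
    ∃ χ' : V → Bool, (∀ v ∈ C, χ' v = χ v) ∧
      G.ProperOn χ' (Finset.univ.filter fun v => d ≤ (C.filter (G.Adj v)).card : Finset V) ∧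
      G.Linked χ' (Finset.univ.filter fun v => d ≤ (C.filter (G.Adj v)).card : Finset V)
        3 (2 * k - 1) := by
  have key : ∀ (χ : V → Bool) (H : Finset V),
      (∀ y ∈ C, (C.filter fun z => χ z ≠ χ y ∧ ¬ G.Adj y z).card ≤ m) →
      (∀ y ∈ H, d ≤ (C.filter fun z => χ z ≠ χ y ∧ G.Adj y z).card) →
      (∀ v ∈ H, 2 * k ≤ (C.filter fun z => χ z ≠ χ v ∧ G.Adj v z).card) ∧
      (∀ v ∈ H, ∀ y ∈ C, χ v = χ y →
        2 * k ≤ (C.filter fun z => χ z ≠ χ v ∧ G.Adj v z ∧ G.Adj y z).card) := by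
    intro χ H hmiss hdeg
    refine ⟨fun v hv => (by omega : 2 * k ≤ d).trans (hdeg v hv), fun v hv y hy hvy => ?_⟩
    have h1 := hdeg v hv
    have h2 := hmiss y hy
    have h3 : (C.filter fun z => χ z ≠ χ v ∧ G.Adj v z) ⊆
        (C.filter fun z => χ z ≠ χ v ∧ G.Adj v z ∧ G.Adj y z) ∪
        (C.filter fun z => χ z ≠ χ y ∧ ¬ G.Adj y z) := by
      intro z hz
      simp only [Finset.mem_union, Finset.mem_filter, hvy] at hz ⊢
      tauto
    have h4 := (Finset.card_le_card h3).trans (Finset.card_union_le _ _)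
    omega
  obtain ⟨a1, a2⟩ := key χ C hmiss hdeg
  have hprop := core_properOn hk hfree subset_rfl a1 a2
  have hlink := core_linked hk subset_rfl a1 a2
  classical
  let χ' : V → Bool := fun v =>
    if v ∈ C then χ v else if ∃ u ∈ C, G.Adj v u ∧ χ u = true then false else true
  have hC : ∀ v ∈ C, χ' v = χ v := fun v hv => by simp [χ', hv]
  have hne : ∀ v, ∀ u ∈ C, G.Adj v u → χ' u ≠ χ' v := by
    intro v u hu hvu
    rw [hC u hu]
    by_cases hv : v ∈ C
    · rw [hC v hv]
      exact (hprop v hv u hu hvu).symm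
    · by_cases h : ∃ u ∈ C, G.Adj v u ∧ χ u = true
      · obtain ⟨w, hw, hvw, hχw⟩ := h
        have := hlink.color_eq hk hfree (by omega) hv hu hw hvu hvw
        have h' : ∃ u ∈ C, G.Adj v u ∧ χ u = true := ⟨w, hw, hvw, hχw⟩
        simp [χ', hv, h', this, hχw]
      · have : χ u ≠ true := fun h' => h ⟨u, hu, hvu, h'⟩
        simp only [χ', hv, h, if_false]
        exact this
  set H : Finset V := Finset.univ.filter fun v => d ≤ (C.filter (G.Adj v)).card with hH
  have heq : ∀ v, (C.filter fun z => χ' z ≠ χ' v ∧ G.Adj v z) = C.filter (G.Adj v) := by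
    intro v
    apply Finset.filter_congr
    intro z hz
    exact ⟨fun h => h.2, fun h => ⟨hne v z hz h, h⟩⟩
  have hCH : C ⊆ H := by
    intro v hv
    rw [hH, Finset.mem_filter]
    refine ⟨Finset.mem_univ _, (hdeg v hv).trans (Finset.card_le_card ?_)⟩
    intro z
    simp only [Finset.mem_filter]
    tauto
  obtain ⟨b1, b2⟩ := key χ' H (by
      intro y hy
      refine le_trans (le_of_eq ?_) (hmiss y hy)
      congr 1
      apply Finset.filter_congr
      intro z hz
      rw [hC z hz, hC y hy])
    (by
      intro y hy
      rw [heq]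
      exact (Finset.mem_filter.1 hy).2)
  exact ⟨χ', hC, core_properOn hk hfree hCH b1 b2, core_linked hk hCH b1 b2⟩

end Core

section Extension

variable [DecidableEq V] {χ : V → Bool} {W : Set V} {x : V}

lemma ProperOn.update_insert (h : G.ProperOn χ W) (hx : x ∉ W) (c : Bool)
    (hc : ∀ u ∈ W, G.Adj x u → χ u ≠ c) :
    G.ProperOn (Function.update χ x c) (insert x W) := by
  intro u hu v hv huv
  have hne : ∀ w ∈ W, w ≠ x := fun w hw h' => hx (h' ▸ hw)
  rcases hu with rfl | hu <;> rcases hv with rfl | hv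
  · exact absurd rfl huv.ne
  · rw [Function.update_self, Function.update_of_ne (hne v hv)]
    exact (hc v hv huv).symm
  · rw [Function.update_self, Function.update_of_ne (hne u hu)]
    exact hc u hu huv.symm
  · rw [Function.update_of_ne (hne u hu), Function.update_of_ne (hne v hv)]
    exact h u hu v hv huv

lemma Linked.update_insert {l M : ℕ} (h : G.Linked χ W l M) (hx : x ∉ W) (c : Bool)
    (hc : ∀ u ∈ W, G.Adj x u → χ u ≠ c) {a b : V} (ha : a ∈ W) (hb : b ∈ W) (hab : a ≠ b)
    (hxa : G.Adj x a) (hxb : G.Adj x b) :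
    G.Linked (Function.update χ x c) (insert x W) (l + 1) M := by
  have hne : ∀ w ∈ W, w ≠ x := fun w hw h' => hx (h' ▸ hw)
  have key : ∀ y ∈ W, ∀ L, l + 1 ≤ L → L ≤ M → (Even L ↔ c = χ y) →
      G.HasPathIn (insert x W) x y L := by
    intro y hy L hL hLM hpar
    obtain ⟨L, rfl⟩ : ∃ N, L = N + 1 := ⟨L - 1, by omega⟩
    obtain ⟨z, hz, hzy, hxz⟩ : ∃ z ∈ W, z ≠ y ∧ G.Adj x z := by
      by_cases hay : a = y
      · exact ⟨b, hb, hay ▸ hab.symm, hxb⟩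
      · exact ⟨a, ha, hay, hxa⟩
    refine (h z hz y hy hzy L (by omega) (by omega) ?_).cons hxz hx
    have h1 := hc z hz hxz
    rw [Nat.even_add_one] at hpar
    revert hpar h1
    cases χ z <;> cases χ y <;> cases c <;> simp
  intro u hu v hv huv L hL hLM hpar
  rcases hu with rfl | hu <;> rcases hv with rfl | hv
  · exact absurd rfl huv
  · rw [Function.update_self, Function.update_of_ne (hne v hv)] at hpar
    exact key v hv L hL hLM hpar
  · rw [Function.update_self, Function.update_of_ne (hne u hu)] at hpar
    exact (key u hu L hL hLM (hpar.trans eq_comm)).symm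
  · rw [Function.update_of_ne (hne u hu), Function.update_of_ne (hne v hv)] at hpar
    exact (h u hu v hv huv L (by omega) hLM hpar).mono (Set.subset_insert _ _)

/-- A linked bipartite set can be enlarged until every outside vertex has at most one neighbour in
it, unless the whole graph is one edge away from being bipartite. -/
lemma exists_maximal_properOn [Fintype V] [DecidableRel G.Adj] {k : ℕ} (hk : 2 ≤ k)
    (hfree : CycleFree G (2 * k + 1)) (m : ℕ) :
    ∀ (W : Finset V) (χ : V → Bool) (l : ℕ), Wᶜ.card = m → G.ProperOn χ W →
      G.Linked χ W l (2 * k - 1) → l ≤ 2 * k - 1 → l + m ≤ 2 * k + 1 →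
      (∃ (W' : Finset V) (χ' : V → Bool), W ⊆ W' ∧ G.ProperOn χ' W' ∧
        ∀ x ∉ W', (W'.filter (G.Adj x)).card ≤ 1) ∨
      (l + m = 2 * k + 1 ∧ ∃ (χ' : V → Bool) (x y : V), ∀ u v, G.Adj u v → χ' u = χ' v →
        s(u, v) = s(x, y)) := by
  induction m with
  | zero =>
    intro W χ l hm hp _ _ _
    refine Or.inl ⟨W, χ, subset_rfl, hp, fun x hx => ?_⟩
    have : x ∈ Wᶜ := Finset.mem_compl.2 hx
    rw [Finset.card_eq_zero.1 hm] at this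
    simp at this
  | succ m ih =>
    intro W χ l hm hp hl hlk hlm
    by_cases hx : ∃ x ∉ W, 1 < (W.filter (G.Adj x)).card
    · obtain ⟨x, hxW, hcard⟩ := hx
      obtain ⟨a, ha, b, hb, hab⟩ := Finset.one_lt_card.1 hcard
      rw [Finset.mem_filter] at ha hb
      have hxW' : x ∉ (W : Set V) := by simpa using hxW
      obtain ⟨c, hc⟩ := hl.exists_color hk hfree hlk hxW'
      have hp' := hp.update_insert hxW' c hc
      have hl' := hl.update_insert hxW' c hc (Finset.mem_coe.2 ha.1) (Finset.mem_coe.2 hb.1) hab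
        ha.2 hb.2
      rw [← Finset.coe_insert] at hp' hl'
      have hm' : (insert x W)ᶜ.card = m := by
        rw [Finset.compl_insert, Finset.card_erase_of_mem (by simpa using hxW), hm]
        rfl
      by_cases hlt : l + 1 ≤ 2 * k - 1
      · rcases ih _ _ _ hm' hp' hl' hlt (by omega) with ⟨W', χ', h1, h2, h3⟩ | ⟨h1, h2⟩
        · exact Or.inl ⟨W', χ', (Finset.subset_insert _ _).trans h1, h2, h3⟩
        · exact Or.inr ⟨by omega, h2⟩
      · obtain rfl | rfl : m = 0 ∨ m = 1 := by omega
        · refine Or.inl ⟨insert x W, _, Finset.subset_insert _ _, hp', fun y hy => ?_⟩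
          have : y ∈ (insert x W)ᶜ := Finset.mem_compl.2 hy
          rw [Finset.card_eq_zero.1 hm'] at this
          simp at this
        · obtain ⟨y, hy⟩ := Finset.card_eq_one.1 hm'
          have hyx : y ∉ insert x W := by
            rw [← Finset.mem_compl, hy]; simp
          rw [Finset.mem_insert, not_or] at hyx
          have hyW : y ∉ (W : Set V) := by simpa using hyx.2
          have hall : ∀ u, u = x ∨ u = y ∨ u ∈ W := by
            intro u
            by_contra! h
            have : u ∈ (insert x W)ᶜ := by simp [h]
            rw [hy] at this
            simp [h] at this
          obtain ⟨c', hc'⟩ := hl.exists_color hk hfree hlk hyW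
          refine Or.inr ⟨by omega, Function.update (Function.update χ x c) y c', x, y, ?_⟩
          have hW : ∀ w ∈ W, Function.update (Function.update χ x c) y c' w = χ w := by
            intro w hw
            rw [Function.update_of_ne (by rintro rfl; exact hyx.2 hw),
              Function.update_of_ne (by rintro rfl; exact hxW hw)]
          have hxc : Function.update (Function.update χ x c) y c' x = c := by
            rw [Function.update_of_ne (Ne.symm hyx.1), Function.update_self]
          have hyc : Function.update (Function.update χ x c) y c' y = c' := Function.update_self ..
          intro u v huv hχ
          rcases hall u with rfl | rfl | hu <;> rcases hall v with rfl | rfl | hv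
          · exact absurd rfl huv.ne
          · rfl
          · rw [hxc, hW v hv] at hχ
            exact absurd hχ.symm (hc v hv huv)
          · exact Sym2.eq_swap
          · exact absurd rfl huv.ne
          · rw [hyc, hW v hv] at hχ
            exact absurd hχ.symm (hc' v hv huv)
          · rw [hxc, hW u hu] at hχ
            exact absurd hχ (hc u hu huv.symm)
          · rw [hyc, hW u hu] at hχ
            exact absurd hχ (hc' u hu huv.symm)
          · rw [hW u hu, hW v hv] at hχ
            exact absurd hχ (hp u hu v hv huv)
    · push Not at hx
      exact Or.inl ⟨W, χ, subset_rfl, hp, hx⟩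

end Extension

section Counting

/-- The number of ordered pairs in `S ×ˢ T` that are edges of `G`. -/
def edgeSum (G : SimpleGraph V) [DecidableRel G.Adj] (S T : Finset V) : ℕ :=
  ∑ x ∈ S, (T.filter (G.Adj x)).card

/-- The subgraph of edges with both ends of the same colour. -/
def monoGraph (G : SimpleGraph V) (χ : V → Bool) : SimpleGraph V where
  Adj u v := G.Adj u v ∧ χ u = χ v
  symm := ⟨fun _ _ h => ⟨h.1.symm, h.2.symm⟩⟩
  loopless := ⟨fun _ h => h.1.ne rfl⟩

instance [DecidableRel G.Adj] (χ : V → Bool) : DecidableRel (G.monoGraph χ).Adj :=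
  fun u v => inferInstanceAs (Decidable (G.Adj u v ∧ χ u = χ v))

lemma four_mul_filter_mul_le (W : Finset V) (p : V → Prop) [DecidablePred p] :
    4 * ((W.filter p).card * (W.filter fun v => ¬ p v).card) ≤ W.card ^ 2 := by
  rw [← Finset.card_filter_add_card_filter_not (s := W) p]
  nlinarith [sq_nonneg (((W.filter p).card : ℤ) - (W.filter fun v => ¬ p v).card)]

lemma deleteEdges_monoGraph_colorable (χ : V → Bool) :
    (G.deleteEdges (G.monoGraph χ).edgeSet).Colorable 2 := by
  have : (G.deleteEdges (G.monoGraph χ).edgeSet).Coloring Bool :=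
    Coloring.mk χ fun {u v} h => by
      rw [deleteEdges_adj, mem_edgeSet] at h
      exact fun h' => h.2 ⟨h.1, h'⟩
  simpa using this.colorable

lemma monoGraph_edgeSet_subset (χ : V → Bool) : (G.monoGraph χ).edgeSet ⊆ G.edgeSet :=
  edgeSet_subset_edgeSet.2 fun _ _ h => h.1

variable [DecidableRel G.Adj]

lemma edgeSum_comm (S T : Finset V) : G.edgeSum S T = G.edgeSum T S := by
  simp only [edgeSum, Finset.card_filter]
  rw [Finset.sum_comm]
  simp only [G.adj_comm]

lemma edgeSum_univ [Fintype V] : G.edgeSum Finset.univ Finset.univ = 2 * G.edgeFinset.card := by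
  rw [← sum_degrees_eq_twice_card_edges, edgeSum]
  refine Finset.sum_congr rfl fun x _ => ?_
  rw [← card_neighborFinset_eq_degree, neighborFinset_eq_filter]

lemma edgeSum_le_mul (S T : Finset V) : G.edgeSum S T ≤ S.card * T.card := by
  rw [edgeSum, ← smul_eq_mul]
  exact Finset.sum_le_card_nsmul _ _ _ fun x _ => Finset.card_filter_le _ _

variable [DecidableEq V]

lemma edgeSum_union_left {S S' : Finset V} (h : Disjoint S S') (T : Finset V) :
    G.edgeSum (S ∪ S') T = G.edgeSum S T + G.edgeSum S' T :=
  Finset.sum_union h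

lemma edgeSum_union_right {T T' : Finset V} (h : Disjoint T T') (S : Finset V) :
    G.edgeSum S (T ∪ T') = G.edgeSum S T + G.edgeSum S T' := by
  rw [edgeSum_comm, edgeSum_union_left h, edgeSum_comm T, edgeSum_comm T']

lemma edgeSum_union_self {S T : Finset V} (h : Disjoint S T) :
    G.edgeSum (S ∪ T) (S ∪ T) = G.edgeSum S S + 2 * G.edgeSum S T + G.edgeSum T T := by
  rw [edgeSum_union_left h, edgeSum_union_right h, edgeSum_union_right h, edgeSum_comm T S]
  ring

lemma edgeSum_insert_self {x : V} {S : Finset V} (hx : x ∉ S) :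
    G.edgeSum (insert x S) (insert x S) =
      G.edgeSum S S + 2 * (S.filter (G.Adj x)).card := by
  rw [Finset.insert_eq, Finset.union_comm, edgeSum_union_self (by simpa using hx),
    edgeSum_comm S {x}]
  simp [edgeSum, Finset.filter_singleton]

/-- A proper colouring of `W` extends to the vertices of `X`, each having at most one neighbour in
`W`, with at most half of the new edges monochromatic. -/
lemma exists_extension {χ : V → Bool} {W : Finset V} (hp : G.ProperOn χ W) (X : Finset V)
    (hdisj : Disjoint W X) (hX : ∀ x ∈ X, (W.filter (G.Adj x)).card ≤ 1) :
    G.edgeSum (W ∪ X) (W ∪ X) ≤ G.edgeSum W W + 2 * (X.card + 1).choose 2 ∧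
    ∃ χ' : V → Bool,
      (G.monoGraph χ').edgeSum (W ∪ X) (W ∪ X) ≤ (X.card + 1).choose 2 := by
  induction X using Finset.induction_on with
  | empty =>
    refine ⟨by simp, χ, le_of_eq ?_⟩
    simp only [Finset.union_empty, edgeSum, Finset.card_empty, zero_add]
    refine Finset.sum_eq_zero fun x hx => ?_
    rw [Finset.card_eq_zero, Finset.filter_eq_empty_iff]
    exact fun y hy h => hp x hx y hy h.1 h.2
  | insert x X hx ih =>
    rw [Finset.disjoint_insert_right] at hdisj
    obtain ⟨h1, χ', h2⟩ := ih hdisj.2 fun y hy => hX y (Finset.mem_insert_of_mem hy)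
    have hxY : x ∉ W ∪ X := by simp [hdisj.1, hx]
    have hdeg : ((W ∪ X).filter (G.Adj x)).card ≤ X.card + 1 := by
      rw [Finset.filter_union]
      refine (Finset.card_union_le _ _).trans ?_
      have := hX x (Finset.mem_insert_self _ _)
      have := Finset.card_filter_le X (G.Adj x)
      omega
    have hch : (X.card + 1 + 1).choose 2 = (X.card + 1) + (X.card + 1).choose 2 := by
      rw [Nat.choose_succ_succ' (X.card + 1) 1, Nat.choose_one_right]
    rw [Finset.union_insert, Finset.card_insert_of_notMem hx, edgeSum_insert_self hxY, hch]
    refine ⟨by omega, ?_⟩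
    obtain ⟨c, hc⟩ : ∃ c : Bool, 2 * ((W ∪ X).filter fun y => G.Adj x y ∧ c = χ' y).card ≤
        ((W ∪ X).filter (G.Adj x)).card := by
      have h3 : ((W ∪ X).filter fun y => G.Adj x y ∧ true = χ' y).card +
          ((W ∪ X).filter fun y => G.Adj x y ∧ false = χ' y).card =
          ((W ∪ X).filter (G.Adj x)).card := by
        rw [← Finset.card_union_of_disjoint]
        · congr 1
          ext y
          simp only [Finset.mem_union, Finset.mem_filter]
          cases χ' y <;> simp
        · rw [Finset.disjoint_left]
          intro y hy hy'
          rw [Finset.mem_filter] at hy hy'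
          exact absurd (hy.2.2.trans hy'.2.2.symm) (by simp)
      by_contra! h
      have := h true
      have := h false
      omega
    refine ⟨Function.update χ' x c, ?_⟩
    have hne : ∀ y ∈ W ∪ X, Function.update χ' x c y = χ' y := fun y hy =>
      Function.update_of_ne (by rintro rfl; exact hxY hy) _ _
    have h4 : (G.monoGraph (Function.update χ' x c)).edgeSum (W ∪ X) (W ∪ X) =
        (G.monoGraph χ').edgeSum (W ∪ X) (W ∪ X) := by
      refine Finset.sum_congr rfl fun u hu => congrArg _ (Finset.filter_congr fun v hv => ?_)
      simp only [monoGraph, hne u hu, hne v hv]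
    have h5 : (W ∪ X).filter ((G.monoGraph (Function.update χ' x c)).Adj x) =
        (W ∪ X).filter fun y => G.Adj x y ∧ c = χ' y := by
      refine Finset.filter_congr fun v hv => ?_
      simp only [monoGraph, hne v hv, Function.update_self]
    rw [edgeSum_insert_self hxY, h4, h5]
    omega

lemma ProperOn.edgeSum_self {χ : V → Bool} {W : Finset V} (hp : G.ProperOn χ W) (c : Bool) :
    G.edgeSum W W = 2 * G.edgeSum (W.filter fun v => χ v = c) (W.filter fun v => ¬ χ v = c) := by
  conv_lhs => rw [← Finset.filter_union_filter_not_eq (fun v => χ v = c) W]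
  rw [edgeSum_union_self (Finset.disjoint_filter_filter_not _ _ _)]
  have h : ∀ b : Bool, ∀ S : Finset V, S ⊆ W → (∀ x ∈ S, χ x = b) → G.edgeSum S S = 0 := by
    intro b S hS hb
    refine Finset.sum_eq_zero fun x hx => ?_
    rw [Finset.card_eq_zero, Finset.filter_eq_empty_iff]
    exact fun y hy hxy => hp x (hS hx) y (hS hy) hxy ((hb x hx).trans (hb y hy).symm)
  rw [h c _ (Finset.filter_subset _ _) (by simp),
    h (!c) _ (Finset.filter_subset _ _) (by cases c <;> simp)]
  ring

end Counting

section Finish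

variable [Fintype V] [DecidableRel G.Adj]

lemma le_card_monoGraph_edgeFinset (f : ℕ)
    (hγ2 : ∀ E' : Finset (Sym2 V), (↑E' : Set (Sym2 V)) ⊆ G.edgeSet →
      (G.deleteEdges ↑E').Colorable 2 → f ≤ E'.card) (χ : V → Bool) :
    f ≤ (G.monoGraph χ).edgeFinset.card := by
  refine hγ2 _ ?_ ?_
  · rw [coe_edgeFinset]
    exact monoGraph_edgeSet_subset χ
  · rw [coe_edgeFinset]
    exact deleteEdges_monoGraph_colorable χ

lemma choose_lt_two_mul_choose_add (t : ℕ) (ht : 1 ≤ t) :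
    (t + 1).choose 2 < 2 * (((t + 2) / 2).choose 2 + ((t + 3) / 2).choose 2) := by
  have hc : ∀ s : ℕ, 2 * (s + 1).choose 2 = (s + 1) * s := by
    intro s
    rw [Nat.choose_two_right, Nat.add_sub_cancel,
      Nat.mul_div_cancel' (by rw [mul_comm]; exact (Nat.even_mul_succ_self s).two_dvd)]
  obtain ⟨s, rfl | rfl⟩ := Nat.even_or_odd' t
  · rw [show (2 * s + 2) / 2 = s + 1 by omega, show (2 * s + 3) / 2 = s + 1 by omega]
    have h1 := hc s
    have h2 := hc (2 * s)
    nlinarith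
  · rw [show (2 * s + 1 + 2) / 2 = s + 1 by omega, show (2 * s + 1 + 3) / 2 = s + 1 + 1 by omega]
    have h1 := hc s
    have h2 := hc (s + 1)
    have h3 := hc (2 * s + 1)
    nlinarith

variable [DecidableEq V]

/-- The edge bound for a graph containing a large linked bipartite set. -/
lemma card_edgeFinset_le_of_linked {k n t l : ℕ} (hk : 2 ≤ k) (ht1 : 1 ≤ t) (ht2 : t ≤ 2 * k - 2)
    (hcard : Fintype.card V = n) (hfree : CycleFree G (2 * k + 1))
    (hγ2 : ∀ E' : Finset (Sym2 V), (↑E' : Set (Sym2 V)) ⊆ G.edgeSet →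
      (G.deleteEdges ↑E').Colorable 2 →
      ((t + 2) / 2).choose 2 + ((t + 3) / 2).choose 2 ≤ E'.card)
    {W : Finset V} {χ : V → Bool} (hp : G.ProperOn χ W) (hW : G.Linked χ W l (2 * k - 1))
    (hl : l = 3 ∧ Wᶜ.card ≤ t ∨ l = 2 ∧ Wᶜ.card = t + 1) :
    G.edgeFinset.card ≤ (n - t - 1) ^ 2 / 4 + (t + 2).choose 2 := by
  have hf := choose_lt_two_mul_choose_add t ht1
  rcases exists_maximal_properOn hk hfree _ W χ l rfl hp hW (by omega) (by omega) with
    ⟨W', χ', hWW', hp', hdeg⟩ | ⟨h1, χ', x, y, h2⟩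
  · have hcompl : W'ᶜ.card ≤ t + 1 :=
      (Finset.card_le_card (Finset.compl_subset_compl.2 hWW')).trans (by omega)
    obtain ⟨h1, χ'', h2⟩ := exists_extension hp' W'ᶜ disjoint_compl_right
      (fun x hx => hdeg x (Finset.mem_compl.1 hx))
    rw [Finset.union_compl, edgeSum_univ] at h1 h2
    have h3 := le_card_monoGraph_edgeFinset _ hγ2 χ''
    obtain h4 | h4 : W'ᶜ.card = t + 1 ∨ W'ᶜ.card ≤ t := by omega
    · rw [h4, hp'.edgeSum_self true, show t + 1 + 1 = t + 2 from rfl] at h1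
      have h5 := G.edgeSum_le_mul (W'.filter fun v => χ' v = true)
        (W'.filter fun v => ¬ χ' v = true)
      have h6 := four_mul_filter_mul_le W' fun v => χ' v = true
      have h7 : W'.card = n - t - 1 := by
        rw [Finset.card_compl, hcard] at h4
        have := Finset.card_le_univ W'
        omega
      rw [h7] at h6
      have h8 := Nat.div_le_div_right (c := 4) h6
      rw [Nat.mul_div_cancel_left _ (by norm_num)] at h8
      omega
    · have := Nat.choose_le_choose 2 (by omega : W'ᶜ.card + 1 ≤ t + 1)
      omega
  · have h3 := le_card_monoGraph_edgeFinset _ hγ2 χ'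
    have h4 : (G.monoGraph χ').edgeFinset ⊆ {s(x, y)} := by
      intro e
      induction e using Sym2.ind with
      | _ u v =>
        rw [mem_edgeFinset, mem_edgeSet, Finset.mem_singleton]
        exact fun h => h2 u v h.1 h.2
    have h5 := Finset.card_le_card h4
    rw [Finset.card_singleton] at h5
    have h6 : (2 + 1).choose 2 ≤ (t + 1).choose 2 := Nat.choose_le_choose 2 (by omega)
    have h7 : (2 + 1).choose 2 = 3 := rfl
    omega

end Finish

section Structure

variable [DecidableRel G.Adj]

/-- The number of vertices of `W` of the colour opposite to that of `y` that are not adjacent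
to `y`. -/
def missCount (G : SimpleGraph V) [DecidableRel G.Adj] (χ : V → Bool) (W : Finset V) (y : V) : ℕ :=
  (W.filter fun z => χ z ≠ χ y ∧ ¬ G.Adj y z).card

lemma missCount_add (χ : V → Bool) (W : Finset V) (y : V) :
    G.missCount χ W y + (W.filter fun z => χ z ≠ χ y ∧ G.Adj y z).card =
      (W.filter fun z => χ z ≠ χ y).card := by
  rw [missCount, add_comm, ← Finset.card_filter_add_card_filter_not
    (s := W.filter fun z => χ z ≠ χ y) (G.Adj y), Finset.filter_filter, Finset.filter_filter]

lemma edgeSum_le_mul_of_degree_le [Fintype V] {D : ℕ} (S T : Finset V)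
    (hD : ∀ v ∈ S, G.degree v ≤ D) : G.edgeSum S T ≤ S.card * D := by
  rw [edgeSum, ← smul_eq_mul]
  refine Finset.sum_le_card_nsmul _ _ _ fun x hx => le_trans (Finset.card_le_card ?_) (hD x hx)
  intro y hy
  rw [mem_neighborFinset]
  exact (Finset.mem_filter.1 hy).2

lemma sum_missCount (χ : V → Bool) (W : Finset V) :
    ∑ y ∈ W, G.missCount χ W y +
      2 * G.edgeSum (W.filter fun v => χ v = true) (W.filter fun v => ¬ χ v = true) =
    2 * ((W.filter fun v => χ v = true).card * (W.filter fun v => ¬ χ v = true).card) := by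
  rw [← Finset.sum_filter_add_sum_filter_not W fun v => χ v = true]
  have h1 : ∑ y ∈ W.filter (fun v => χ v = true), G.missCount χ W y +
      G.edgeSum (W.filter fun v => χ v = true) (W.filter fun v => ¬ χ v = true) =
      (W.filter fun v => χ v = true).card * (W.filter fun v => ¬ χ v = true).card := by
    rw [edgeSum, ← Finset.sum_add_distrib, ← smul_eq_mul]
    refine Finset.sum_const_nat fun y hy => ?_
    have := G.missCount_add χ W y
    rw [(Finset.mem_filter.1 hy).2] at this
    rwa [Finset.filter_filter]
  have h2 : ∑ y ∈ W.filter (fun v => ¬ χ v = true), G.missCount χ W y +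
      G.edgeSum (W.filter fun v => ¬ χ v = true) (W.filter fun v => χ v = true) =
      (W.filter fun v => ¬ χ v = true).card * (W.filter fun v => χ v = true).card := by
    rw [edgeSum, ← Finset.sum_add_distrib, ← smul_eq_mul]
    refine Finset.sum_const_nat fun y hy => ?_
    have := G.missCount_add χ W y
    have hf := (Finset.mem_filter.1 hy).2
    rw [Bool.not_eq_true] at hf
    simp only [hf, ne_eq, Bool.not_eq_false] at this
    rwa [Finset.filter_filter]
  rw [edgeSum_comm, mul_comm] at h2
  omega

variable [DecidableEq V]

/-- In a `C_{2k+1}`-free graph, the neighbourhood of a vertex spans few edges. -/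
lemma edgeSum_le_of_subset_neighborSet {k : ℕ} (hk : 2 ≤ k) (hfree : CycleFree G (2 * k + 1))
    {v : V} (X : Finset V) (hX : ∀ x ∈ X, G.Adj v x) :
    G.edgeSum X X ≤ (4 * k - 4) * X.card := by
  induction X using Finset.strongInduction with
  | H X ih =>
    by_cases h : ∃ x ∈ X, (X.filter (G.Adj x)).card ≤ 2 * k - 2
    · obtain ⟨x, hx, hdeg⟩ := h
      have h1 := ih _ (Finset.erase_ssubset hx) fun y hy => hX y (Finset.mem_of_mem_erase hy)
      have h2 := edgeSum_insert_self (G := G) (Finset.notMem_erase x X)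
      have h3 := Finset.card_le_card
        (Finset.filter_subset_filter (G.Adj x) (Finset.erase_subset x X))
      rw [Finset.insert_erase hx] at h2
      rw [h2, ← Finset.card_erase_add_one hx, mul_add]
      omega
    · push Not at h
      obtain rfl | hne := X.eq_empty_or_nonempty
      · simp [edgeSum]
      · obtain ⟨x, y, hxy⟩ := G.exists_path_of_degree X (2 * k - 1) hne
          fun x hx => by have := h x hx; omega
        have hvX : v ∉ (X : Set V) := fun hv => (hX v hv).ne rfl
        have hfree' : CycleFree G (2 * k - 1 + 2) := by
          rwa [show 2 * k - 1 + 2 = 2 * k + 1 by omega]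
        have hmem := hxy
        obtain ⟨p, -, -, hp⟩ := hmem
        exact absurd hxy (hfree'.not_hasPathIn hvX (hX x (hp x p.start_mem_support))
          (hX y (hp y p.end_mem_support)))

/-- Deleting a set of vertices of small degree loses few edges. -/
lemma two_mul_card_edgeFinset_le [Fintype V] {D : ℕ} (H : Finset V)
    (hD : ∀ v ∉ H, G.degree v ≤ D) :
    2 * G.edgeFinset.card ≤ G.edgeSum H H + 2 * (Hᶜ.card * D) := by
  have h1 := edgeSum_union_self (G := G) (disjoint_compl_right (a := H))
  have h2 := edgeSum_union_right (G := G) (disjoint_compl_right (a := H)) Hᶜ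
  have h3 := edgeSum_le_mul_of_degree_le Hᶜ (H ∪ Hᶜ) fun v hv => hD v (Finset.mem_compl.1 hv)
  rw [Finset.union_compl, edgeSum_univ] at h1
  rw [edgeSum_comm H Hᶜ] at h1
  rw [Finset.union_compl] at h2 h3
  omega

/-- The colouring by the neighbourhood of a vertex of maximum degree. -/
lemma exists_coloring_sum_missCount_le [Fintype V] {k : ℕ} (hk : 2 ≤ k)
    (hfree : CycleFree G (2 * k + 1)) :
    ∃ χ : V → Bool, ∑ y, G.missCount χ Finset.univ y + 4 * G.edgeFinset.card ≤
      4 * ((Finset.univ.filter fun v => χ v = true).card *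
        (Finset.univ.filter fun v => ¬ χ v = true).card) +
      (8 * k - 8) * (Finset.univ.filter fun v => χ v = true).card := by
  obtain hV | hV := isEmpty_or_nonempty V
  · refine ⟨fun _ => true, ?_⟩
    have h : 2 * G.edgeFinset.card = 0 := by
      rw [← edgeSum_univ, edgeSum, Finset.univ_eq_empty, Finset.sum_empty]
    rw [Finset.univ_eq_empty, Finset.sum_empty]
    omega
  · obtain ⟨v, hv⟩ := G.exists_maximal_degree_vertex
    refine ⟨fun u => decide (G.Adj v u), ?_⟩
    have h1 := G.sum_missCount (fun u => decide (G.Adj v u)) Finset.univ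
    set P := Finset.univ.filter fun u => decide (G.Adj v u) = true with hP
    set Q := Finset.univ.filter fun u => ¬ decide (G.Adj v u) = true with hQ
    have hPQ : P ∪ Q = Finset.univ := Finset.filter_union_filter_not_eq _ _
    have hdisj : Disjoint P Q := Finset.disjoint_filter_filter_not _ _ _
    have hPcard : P.card = G.maxDegree := by
      rw [hv, hP, ← card_neighborFinset_eq_degree, neighborFinset_eq_filter]
      simp
    have h2 := edgeSum_union_self (G := G) hdisj
    have h3 := edgeSum_union_right (G := G) hdisj Q
    have h4 := edgeSum_le_mul_of_degree_le Q (P ∪ Q) fun u _ => G.degree_le_maxDegree u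
    have h5 := edgeSum_le_of_subset_neighborSet hk hfree (v := v) P fun u hu => by
      simpa [hP] using hu
    rw [← hPcard, mul_comm] at h4
    rw [hPQ, edgeSum_univ] at h2
    rw [edgeSum_comm Q P] at h3
    rw [show 8 * k - 8 = 2 * (4 * k - 4) by omega, mul_assoc]
    omega

/-- Discarding the vertices with many missing neighbours leaves a linked core. -/
lemma exists_coloring_of_missCount [Fintype V] {k m d r : ℕ} (hk : 2 ≤ k)
    (hfree : CycleFree G (2 * k + 1)) {χ : V → Bool} {W : Finset V} (hd : m + 2 * k ≤ d)
    (hr : (W.filter fun y => m < G.missCount χ W y).card ≤ r)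
    (hcol : ∀ b : Bool, d + m + r ≤ (W.filter fun z => χ z = b).card) :
    ∃ (H : Finset V) (χ' : V → Bool),
      (∀ b, (W.filter fun z => χ z = b).card ≤ (H.filter fun z => χ' z = b).card + r) ∧
      G.ProperOn χ' H ∧
      G.Linked χ' H 3 (2 * k - 1) ∧ (∀ v ∉ H, G.degree v ≤ d + r + Wᶜ.card) ∧
      Hᶜ.card ≤ r + Wᶜ.card := by
  set C := W.filter fun y => ¬ m < G.missCount χ W y with hC
  have hCW : C ⊆ W := Finset.filter_subset _ _
  have hsplit := Finset.card_filter_add_card_filter_not (s := W) fun y => m < G.missCount χ W y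
  rw [← hC] at hsplit
  have hmissCW : ∀ y ∈ C, (C.filter fun z => χ z ≠ χ y ∧ ¬ G.Adj y z).card ≤ m := fun y hy =>
    (Finset.card_le_card (Finset.filter_subset_filter _ hCW)).trans
      (not_lt.1 (Finset.mem_filter.1 hy).2)
  have hWC : ∀ p : V → Prop, ∀ _ : DecidablePred p,
      (W.filter p).card ≤ (C.filter p).card + r := by
    intro p _
    refine le_trans ?_ (Nat.add_le_add_left hr _)
    refine (Finset.card_le_card fun z hz => ?_).trans (Finset.card_union_le _ _)
    rw [Finset.mem_filter] at hz
    by_cases h : m < G.missCount χ W z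
    · simp [hz, h]
    · simp only [Finset.mem_union, hC, Finset.mem_filter, hz, h, not_false_iff, and_self, true_or]
  have hdegC : ∀ y ∈ C, d ≤ (C.filter fun z => χ z ≠ χ y ∧ G.Adj y z).card := by
    intro y hy
    have h1 := hcol (!χ y)
    have h2 := G.missCount_add χ W y
    have h3 := not_lt.1 (Finset.mem_filter.1 hy).2
    have h4 := hWC (fun z => χ z ≠ χ y ∧ G.Adj y z) inferInstance
    have h5 : (W.filter fun z => χ z = !χ y) = W.filter fun z => χ z ≠ χ y :=
      Finset.filter_congr fun z _ => by cases χ z <;> cases χ y <;> simp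
    rw [h5] at h1
    omega
  obtain ⟨χ', h1, h2, h3⟩ := exists_coloring_of_core hk hfree hd hmissCW hdegC
  set H := Finset.univ.filter fun v => d ≤ (C.filter (G.Adj v)).card with hH
  have hCH : C ⊆ H := fun y hy => by
    rw [hH, Finset.mem_filter]
    refine ⟨Finset.mem_univ _, (hdegC y hy).trans (Finset.card_le_card ?_)⟩
    exact fun z hz => Finset.mem_filter.2
      ⟨(Finset.mem_filter.1 hz).1, (Finset.mem_filter.1 hz).2.2⟩
  refine ⟨H, χ', fun b => ?_, h2, h3, fun v hv => ?_, ?_⟩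
  · refine (hWC (fun z => χ z = b) inferInstance).trans
      (Nat.add_le_add_right (Finset.card_le_card fun y hy => ?_) _)
    rw [Finset.mem_filter] at hy ⊢
    exact ⟨hCH hy.1, (h1 y hy.1).trans hy.2⟩
  · have h4 : (C.filter (G.Adj v)).card < d := by simpa [hH] using hv
    have h5 := hWC (G.Adj v) inferInstance
    have h6 : G.degree v ≤ (W.filter (G.Adj v)).card + Wᶜ.card := by
      rw [← card_neighborFinset_eq_degree, neighborFinset_eq_filter]
      refine (Finset.card_le_card fun z hz => ?_).trans (Finset.card_union_le _ _)
      by_cases h : z ∈ W <;> simp_all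
    omega
  · have h4 := Finset.card_le_card (Finset.compl_subset_compl.2 hCH)
    have h5 := Finset.card_add_card_compl W
    have h6 := Finset.card_add_card_compl C
    omega

/-- A linked set missing `t + 1` vertices is linked from length two on if it is dense enough. -/
lemma Linked.two_of_edgeSum {χ : V → Bool} {W : Finset V} {M : ℕ}
    (hp : G.ProperOn χ W) (h : G.Linked χ W 3 M)
    (hW : (W.card - 1) ^ 2 < 2 * G.edgeSum W W) : G.Linked χ W 2 M := by
  intro u hu v hv huv L hL hLM hpar
  obtain hL3 | rfl : 3 ≤ L ∨ L = 2 := by omega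
  · exact h u hu v hv huv L hL3 hLM hpar
  have hχ : χ u = χ v := hpar.1 even_two
  by_cases hw : ∃ w ∈ W, G.Adj u w ∧ G.Adj w v
  · obtain ⟨w, hw, huw, hwv⟩ := hw
    exact hasPathIn_two huw hwv huv hu hw hv
  push Not at hw
  rw [hp.edgeSum_self (χ u)] at hW
  set P := W.filter fun w => χ w = χ u with hP
  set Q := W.filter fun w => ¬ χ w = χ u with hQ
  have hPQ : P.card + Q.card = W.card := Finset.card_filter_add_card_filter_not _
  have huP : u ∈ P := Finset.mem_filter.2 ⟨hu, rfl⟩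
  have hvP : v ∈ P := Finset.mem_filter.2 ⟨hv, hχ.symm⟩
  have hsum : G.edgeSum Q P ≤ Q.card * (P.card - 1) := by
    rw [edgeSum, ← smul_eq_mul]
    refine Finset.sum_le_card_nsmul _ _ _ fun w hw' => ?_
    have hwW := (Finset.mem_filter.1 hw').1
    obtain ⟨z, hz, hwz⟩ : ∃ z ∈ P, ¬ G.Adj w z := by
      by_cases huw : G.Adj u w
      · exact ⟨v, hvP, hw w hwW huw⟩
      · exact ⟨u, huP, fun h' => huw h'.symm⟩
    rw [← Finset.card_erase_of_mem hz]
    refine Finset.card_le_card fun x hx => ?_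
    rw [Finset.mem_filter] at hx
    exact Finset.mem_erase.2 ⟨by rintro rfl; exact hwz hx.2, hx.1⟩
  rw [edgeSum_comm Q P] at hsum
  obtain ⟨p, hp'⟩ : ∃ p, P.card = p + 1 := ⟨P.card - 1, by
    have := Finset.card_pos.2 ⟨u, huP⟩
    omega⟩
  rw [← hPQ, hp', show p + 1 + Q.card - 1 = p + Q.card by omega] at hW
  rw [hp', Nat.add_sub_cancel] at hsum
  zify at hW hsum
  nlinarith [sq_nonneg ((p : ℤ) - Q.card)]

end Structure

/-- The missing edges and the class sizes in a colouring by a maximum neighbourhood. -/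
lemma card_classes_of_edge_bound {k n t P Q S e : ℕ} (hk : 2 ≤ k) (ht : 1 ≤ t) (hn : 252 * t ^ 2 * k ≤ n)
    (hPQ : P + Q = n) (hχ : S + 4 * e ≤ 4 * (P * Q) + (8 * k - 8) * P)
    (he : n ^ 2 ≤ 4 * e + 2 * (t + 1) * n) :
    62 * S ≤ n ^ 2 ∧ 43 * n ≤ 100 * P ∧ 43 * n ≤ 100 * Q := by
  have hk252 : 252 * k ≤ n := by nlinarith [Nat.one_le_pow 2 t ht]
  have hkt : 63 * (4 * k + 2 * t) ≤ n + 126 := by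
    have : 4 * k + 2 * t ≤ 4 * (t ^ 2 * k) + 2 := by
      obtain ⟨s, rfl⟩ : ∃ s, t = s + 1 := ⟨t - 1, by omega⟩
      nlinarith [Nat.zero_le (s ^ 2 * k), Nat.mul_le_mul_left s hk]
    linarith
  obtain ⟨j, rfl⟩ : ∃ j, k = j + 1 := ⟨k - 1, by omega⟩
  rw [show 8 * (j + 1) - 8 = 8 * j by omega] at hχ
  have hsq : (63 * S : ℤ) + 63 * (P - Q - 2 * j) ^ 2 ≤ n ^ 2 + 63 * (2 * j) ^ 2 := by
    have h1 : (n : ℤ) * (63 * (4 * (j + 1) + 2 * t)) ≤ n * (n + 126) :=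
      mul_le_mul_of_nonneg_left (by exact_mod_cast hkt) (by positivity)
    zify at hχ he hPQ
    rw [← hPQ] at he h1 ⊢
    linarith
  have hjn : 126 * (2 * j : ℤ) ≤ n := by
    zify at hk252
    linarith
  have hj2 : 15876 * (2 * j : ℤ) ^ 2 ≤ n ^ 2 := by nlinarith
  have hS : (62 * S : ℤ) ≤ n ^ 2 := by nlinarith [sq_nonneg ((P : ℤ) - Q - 2 * j)]
  have hx := abs_le_of_sq_le_sq' (a := 1000 * ((P : ℤ) - Q - 2 * j)) (b := 127 * n)
    (by nlinarith) (by positivity)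
  refine ⟨by exact_mod_cast hS, ?_, ?_⟩
  · zify at hPQ ⊢
    linarith [hx.1]
  · zify at hPQ ⊢
    linarith [hx.2]

section Main

variable [Fintype V] [DecidableEq V] [DecidableRel G.Adj]

lemma four_mul_card_edgeFinset_add_le {χ : V → Bool} {H : Finset V} {D : ℕ}
    (hp : G.ProperOn χ H) (hD : ∀ v ∉ H, G.degree v ≤ D) :
    4 * G.edgeFinset.card + 2 * ∑ y ∈ H, G.missCount χ H y ≤
      H.card ^ 2 + 4 * (Hᶜ.card * D) := by
  have h1 := two_mul_card_edgeFinset_le H hD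
  have h2 := G.sum_missCount χ H
  have h3 := four_mul_filter_mul_le H fun v => χ v = true
  rw [hp.edgeSum_self true] at h1
  omega

lemma card_filter_lt_mul_le {α : Type*} (S : Finset α) (f : α → ℕ) (m : ℕ) :
    (S.filter fun y => m < f y).card * (m + 1) ≤ ∑ y ∈ S, f y := by
  rw [← smul_eq_mul]
  exact (Finset.card_nsmul_le_sum _ _ _ fun x hx => (Finset.mem_filter.1 hx).2).trans
    (Finset.sum_le_sum_of_subset (Finset.filter_subset _ _))

/-- A dense `C_{2k+1}`-free graph contains a large induced bipartite subgraph. -/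
lemma exists_properOn_of_dense {k n t : ℕ} (hk : 2 ≤ k) (ht : 1 ≤ t) (hn : 252 * t ^ 2 * k ≤ n)
    (hcard : Fintype.card V = n) (hfree : CycleFree G (2 * k + 1))
    (he : n ^ 2 ≤ 4 * G.edgeFinset.card + 2 * (t + 1) * n) :
    ∃ (H : Finset V) (χ : V → Bool), G.ProperOn χ H ∧ 100 * Hᶜ.card ≤ 13 * n ∧
      (∀ v ∉ H, 100 * G.degree v ≤ 27 * n) ∧
      ∀ b, 30 * n ≤ 100 * (H.filter fun v => χ v = b).card := by
  obtain ⟨χ, hχ⟩ := exists_coloring_sum_missCount_le hk hfree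
  have hbad := card_filter_lt_mul_le Finset.univ (G.missCount χ Finset.univ) (n / 8)
  set S := ∑ y, G.missCount χ Finset.univ y
  set P := Finset.univ.filter fun v => χ v = true with hP
  set Q := Finset.univ.filter fun v => ¬ χ v = true with hQ
  set B := Finset.univ.filter fun y => n / 8 < G.missCount χ Finset.univ y with hB
  have hPQ : P.card + Q.card = n := by
    rw [← hcard]
    exact Finset.card_filter_add_card_filter_not _
  have hk252 : 252 * k ≤ n := by nlinarith [Nat.one_le_pow 2 t ht]
  obtain ⟨hS, hx⟩ := card_classes_of_edge_bound hk ht hn hPQ hχ he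
  have hn0 : 0 < n := by omega
  have hBn : 100 * B.card ≤ 13 * n := by
    have h1 : n ≤ 8 * (n / 8 + 1) := by omega
    have h2 : 62 * B.card * n ≤ 8 * n * n := by
      have := Nat.mul_le_mul_left B.card h1
      linarith
    have h3 : 62 * B.card ≤ 8 * n := by
      exact Nat.le_of_mul_le_mul_right h2 hn0
    omega
  have hcol : ∀ b : Bool, 43 * n ≤ 100 * (Finset.univ.filter fun v => χ v = b).card := by
    intro b
    cases b
    · simpa [hQ] using hx.2
    · exact hx.1
  obtain ⟨H, χ', h1, h2, -, h4, h5⟩ := exists_coloring_of_missCount (d := n / 8 + 2 * k)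
    (r := B.card) (W := Finset.univ) (χ := χ) hk hfree le_rfl le_rfl fun b => by
      have := hcol b
      omega
  rw [Finset.compl_univ, Finset.card_empty] at h4 h5
  refine ⟨H, χ', h2, ?_, fun v hv => ?_, fun b => ?_⟩
  · omega
  · have := h4 v hv
    omega
  · have := h1 b
    have := hcol b
    omega

/-- A dense `C_{2k+1}`-free graph contains a linked induced bipartite subgraph on all but
boundedly many vertices. -/
lemma exists_linked_of_dense {k n t : ℕ} (hk : 2 ≤ k) (ht : 1 ≤ t) (hn : 252 * t ^ 2 * k ≤ n)
    (hcard : Fintype.card V = n) (hfree : CycleFree G (2 * k + 1))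
    (he : n ^ 2 ≤ 4 * G.edgeFinset.card + 2 * (t + 1) * n) :
    ∃ (H : Finset V) (χ : V → Bool), G.ProperOn χ H ∧ G.Linked χ H 3 (2 * k - 1) ∧
      Hᶜ.card ≤ 4 * ((t + 1) * (t + 2)) ∧
      ∀ v ∉ H, G.degree v ≤ n / (4 * (t + 2)) + 2 * k + 4 * ((t + 1) * (t + 2)) := by
  obtain ⟨W, χ, hp, hτ, hdeg, hcol⟩ := exists_properOn_of_dense hk ht hn hcard hfree he
  have hk252 : 252 * k ≤ n := by nlinarith [Nat.one_le_pow 2 t ht]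
  have ht2 : 84 * ((t + 1) * (t + 2)) ≤ n := by nlinarith
  have hn0 : 0 < n := by omega
  have hWn : W.card + Wᶜ.card = n := by rw [Finset.card_add_card_compl, hcard]
  have hbad := card_filter_lt_mul_le W (G.missCount χ W) (n / (4 * (t + 2)))
  have hcount := four_mul_card_edgeFinset_add_le hp (D := 27 * n / 100)
    fun v hv => by have := hdeg v hv; omega
  set B := W.filter fun y => n / (4 * (t + 2)) < G.missCount χ W y with hB
  have hS : 200 * ∑ y ∈ W, G.missCount χ W y + 79 * (n * Wᶜ.card) ≤ 200 * ((t + 1) * n) := by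
    have hD : Wᶜ.card * (27 * n / 100) * 100 ≤ Wᶜ.card * (27 * n) := by
      rw [mul_assoc]
      exact Nat.mul_le_mul_left _ (Nat.div_mul_le_self _ _)
    have hτ2 := Nat.mul_le_mul_right Wᶜ.card hτ
    zify at *
    have : (W.card : ℤ) = n - Wᶜ.card := by linarith
    rw [this] at hcount
    nlinarith
  have hR : B.card + Wᶜ.card ≤ 4 * ((t + 1) * (t + 2)) := by
    have h1 : n ≤ 4 * (t + 2) * (n / (4 * (t + 2)) + 1) := by
      have := Nat.lt_mul_div_succ n (by positivity : 0 < 4 * (t + 2))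
      exact this.le
    have h2 : B.card * n ≤ 4 * (t + 2) * ∑ y ∈ W, G.missCount χ W y :=
      calc B.card * n ≤ B.card * (4 * (t + 2) * (n / (4 * (t + 2)) + 1)) := Nat.mul_le_mul_left _ h1
        _ = 4 * (t + 2) * (B.card * (n / (4 * (t + 2)) + 1)) := by ring
        _ ≤ _ := Nat.mul_le_mul_left _ hbad
    have h3 := Nat.mul_le_mul_left (4 * (t + 2)) hS
    have h4 : 200 * (B.card + Wᶜ.card) * n ≤ 200 * (4 * ((t + 1) * (t + 2))) * n := by
      nlinarith [Nat.zero_le (t * (n * Wᶜ.card))]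
    have := Nat.le_of_mul_le_mul_right h4 hn0
    omega
  have hz : 12 * (n / (4 * (t + 2))) ≤ n :=
    (Nat.mul_le_mul_right _ (by omega)).trans (Nat.mul_div_le n (4 * (t + 2)))
  obtain ⟨H, χ', -, h2, h3, h4, h5⟩ := exists_coloring_of_missCount
    (d := n / (4 * (t + 2)) + 2 * k) (W := W) (χ := χ) hk hfree le_rfl le_rfl fun b => by
      have := hcol b
      rw [← hB]
      omega
  refine ⟨H, χ', h2, h3, h5.trans hR, fun v hv => (h4 v hv).trans ?_⟩
  rw [← hB]
  omega

lemma mul_degree_bound_lt {k n t : ℕ} (ht1 : 1 ≤ t) (ht2 : t ≤ 2 * k - 2)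
    (hk : 2 ≤ k) (hn : 252 * t ^ 2 * k ≤ n) :
    (t + 2) * (4 * (n / (4 * (t + 2)) + 2 * k + 4 * ((t + 1) * (t + 2))) +
      4 * ((t + 1) * (t + 2))) < 2 * n := by
  have h1 : (t + 2) * (8 * k + 20 * ((t + 1) * (t + 2))) < n := by
    refine lt_of_lt_of_le ?_ hn
    obtain ⟨j, rfl⟩ : ∃ j, k = j + 2 := ⟨k - 2, by omega⟩
    obtain rfl | ht : t = 1 ∨ 2 ≤ t := by omega
    · omega
    · have h2 : (t + 1) * (t + 2) ≤ 3 * t ^ 2 := by nlinarith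
      have h3 : (t + 2) * ((t + 1) * (t + 2)) ≤ 2 * (j + 2) * (3 * t ^ 2) :=
        Nat.mul_le_mul (by omega) h2
      have h4 : (t + 2) * (8 * (j + 2)) ≤ 8 * t ^ 2 * (j + 2) := by nlinarith
      have h5 : 0 < t ^ 2 * (j + 2) := by positivity
      nlinarith
  have h2 := Nat.mul_div_le n (4 * (t + 2))
  nlinarith

lemma sq_sub_add_lt_sq_sub {n t s D : ℕ} (hs : t + 2 ≤ s) (hsn : s ≤ n)
    (hD : (t + 2) * (4 * D + s) < 2 * n) :
    (n - s) ^ 2 + 4 * (s * D) < (n - t - 1) ^ 2 := by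
  obtain ⟨a, rfl⟩ : ∃ a, s = t + 2 + a := ⟨s - (t + 2), by omega⟩
  obtain ⟨m, rfl⟩ : ∃ m, n = m + (t + 2 + a) := ⟨n - (t + 2 + a), by omega⟩
  rw [Nat.add_sub_cancel, show m + (t + 2 + a) - t - 1 = m + (a + 1) by omega]
  have h1 := Nat.mul_le_mul_right (4 * D + (t + 2 + a))
    (show t + 2 + a ≤ (t + 2) * (a + 1) by nlinarith)
  have h2 := Nat.mul_lt_mul_of_pos_left hD a.succ_pos
  nlinarith

end Main

end SimpleGraph

open SimpleGraph

/-- Theorem (edge-stability, bound): if `G` is a `C_{2k+1}`-free graph on `n` vertices with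
`γ₂(G) ≥ C(⌊(t+2)/2⌋, 2) + C(⌈(t+2)/2⌉, 2)` (every edge set whose deletion makes `G` bipartite
has at least that many edges), `1 ≤ t ≤ 2k-2` and `n ≥ 252 t² k`, then
`e(G) ≤ ⌊(n-t-1)²/4⌋ + C(t+2, 2)`. -/
theorem stmt2 {V : Type*} [Fintype V] [DecidableEq V]
    (k n t : ℕ) (hk : 2 ≤ k) (ht1 : 1 ≤ t) (ht2 : t ≤ 2 * k - 2)
    (hn : 252 * t ^ 2 * k ≤ n)
    (G : SimpleGraph V) [DecidableRel G.Adj]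
    (hcard : Fintype.card V = n)
    (hfree : CycleFree G (2 * k + 1))
    (hγ2 : ∀ E' : Finset (Sym2 V), (↑E' : Set (Sym2 V)) ⊆ G.edgeSet →
      (G.deleteEdges ↑E').Colorable 2 →
      ((t + 2) / 2).choose 2 + ((t + 3) / 2).choose 2 ≤ E'.card) :
    G.edgeFinset.card ≤ (n - t - 1) ^ 2 / 4 + (t + 2).choose 2 := by

  by_contra! hcon
  have hchoose : 2 * (t + 2).choose 2 = (t + 2) * (t + 1) := by
    rw [Nat.choose_two_right, Nat.add_sub_assoc (by norm_num),
      Nat.two_mul_div_two_of_even (by rw [mul_comm]; exact Nat.even_mul_succ_self (t + 1))]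
  have hnum := mul_degree_bound_lt ht1 ht2 hk hn
  have hnt : t + 2 ≤ n := by nlinarith
  have he : (n - t - 1) ^ 2 + 2 * ((t + 2) * (t + 1)) + 1 ≤ 4 * G.edgeFinset.card := by
    omega
  have hdense : n ^ 2 ≤ 4 * G.edgeFinset.card + 2 * (t + 1) * n := by
    obtain ⟨m, rfl⟩ : ∃ m, n = m + (t + 1) := ⟨n - (t + 1), by omega⟩
    rw [Nat.sub_sub, Nat.add_sub_cancel] at he
    nlinarith
  obtain ⟨H, χ, hp, hlink, hH, hdeg⟩ := exists_linked_of_dense hk ht1 hn hcard hfree hdense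
  have hcount := four_mul_card_edgeFinset_add_le hp hdeg
  have hedge := two_mul_card_edgeFinset_le H hdeg
  have hHn : H.card + Hᶜ.card = n := by rw [Finset.card_add_card_compl, hcard]
  set D := n / (4 * (t + 2)) + 2 * k + 4 * ((t + 1) * (t + 2)) with hD
  refine hcon.not_ge ?_
  rcases lt_trichotomy Hᶜ.card (t + 1) with h | h | h
  · exact card_edgeFinset_le_of_linked hk ht1 ht2 hcard hfree hγ2 hp hlink (.inl ⟨rfl, by omega⟩)
  · refine card_edgeFinset_le_of_linked hk ht1 ht2 hcard hfree hγ2 hp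
      (hlink.two_of_edgeSum hp ?_) (.inr ⟨rfl, h⟩)
    obtain ⟨m, rfl⟩ : ∃ m, n = m + (t + 2) := ⟨n - (t + 2), by omega⟩
    rw [show m + (t + 2) - t - 1 = m + 1 by omega] at he
    rw [show H.card - 1 = m by omega]
    rw [h] at hedge
    nlinarith
  · have := sq_sub_add_lt_sq_sub h (by omega) (D := D)
      ((Nat.mul_le_mul_left _ (by omega)).trans_lt hnum)
    rw [show H.card = n - Hᶜ.card by omega] at hcount
    omega
end

section
/- Let k ≥ 2, and let n, t be integers with 1 ≤ t ≤ 2k−2 and n ≥ 318t²k. If G is a C_{2k+1}-free graph on n vertices with e(G) > ⌊(n−t−1)²/4⌋ + (t+2 choose 2), then G can be made bipartite either by deleting at most t−1 vertices or by deleting at most (⌊(t+2)/2⌋ choose 2) + (⌈(t+2)/2⌉ choose 2) − 1 edges; that is, d₂(G) ≤ t−1 or γ₂(G) ≤ (⌊(t+2)/2⌋ choose 2) + (⌈(t+2)/2⌉ choose 2) − 1. -/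
section OddCycle

open Finset SimpleGraph

variable {V : Type*} {G : SimpleGraph V} {k : ℕ}

/-- A path with `2k` edges whose ends are adjacent closes up to a cycle of length `2k + 1`. -/
theorem CycleFree.not_adj_of_isPath (h : CycleFree G (2 * k + 1)) (hk : 1 ≤ k) {u v : V}
    (p : G.Walk u v) (hp : p.IsPath) (hl : p.length = 2 * k) : ¬ G.Adj v u := by
  intro hadj
  have hcyc : (Walk.cons hadj p).IsCycle := by
    rw [Walk.cons_isCycle_iff]
    refine ⟨hp, ?_⟩
    cases p with
    | nil => simp
    | cons h' q =>
      rw [Walk.cons_isPath_iff] at hp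
      simp only [Walk.edges_cons, List.mem_cons, not_or]
      constructor
      · intro he
        rw [Sym2.eq_swap, Sym2.congr_right] at he
        subst he
        have hq := hp.1
        rw [Walk.isPath_iff_nil, ← Walk.length_eq_zero_iff] at hq
        simp only [hq, Walk.length_cons] at hl
        omega
      · intro he
        exact hp.2 (Walk.snd_mem_support_of_mem_edges _ he)
  obtain ⟨f⟩ := (cycleGraph_isContained_iff (G := G) (n := 2 * k + 1) (by omega)).2
    ⟨v, _, hcyc, by simp [hl]⟩
  exact h f.toHom f.injective

theorem CycleFree.induce (h : CycleFree G k) (s : Set V) : CycleFree (G.induce s) k := by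
  intro f hf
  exact h ((Embedding.induce s).toHom.comp f) (Subtype.val_injective.comp hf)

theorem colorable_induce_compl {T : Finset V} {c : V → Bool}
    (hc : ∀ u ∉ T, ∀ v ∉ T, G.Adj u v → c u ≠ c v) :
    (G.induce ((↑T : Set V)ᶜ)).Colorable 2 := by
  have C : (G.induce ((↑T : Set V)ᶜ)).Coloring Bool :=
    Coloring.mk (fun v => c v) fun {u v} huv =>
      hc u (mem_coe.not.1 ((Set.mem_compl_iff _ _).1 u.2)) v
        (mem_coe.not.1 ((Set.mem_compl_iff _ _).1 v.2)) huv
  simpa using C.colorable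

variable [DecidableRel G.Adj]

variable (G) in
/-- The neighbours of `v` inside `C`. -/
def nbrsIn (C : Finset V) (v : V) : Finset V := {w ∈ C | G.Adj v w}

@[simp]
theorem mem_nbrsIn {C : Finset V} {v w : V} : w ∈ nbrsIn G C v ↔ w ∈ C ∧ G.Adj v w := by
  simp [nbrsIn]

theorem two_mul_sum_card_nbrsIn_le {X : Finset V} {c : V → Bool}
    (hc : ∀ u ∈ X, ∀ v ∈ X, G.Adj u v → c u ≠ c v) :
    2 * ∑ v ∈ X, #(nbrsIn G X v) ≤ #X ^ 2 := by
  have key : ∀ b : Bool, ∑ v ∈ X with c v = b, #(nbrsIn G X v) ≤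
      #{v ∈ X | c v = b} * #{v ∈ X | c v = !b} := by
    intro b
    rw [← smul_eq_mul]
    refine sum_le_card_nsmul _ _ _ fun v hv => card_le_card fun w hw => ?_
    rw [mem_nbrsIn] at hw
    rw [mem_filter] at hv ⊢
    refine ⟨hw.1, ?_⟩
    have := hc v hv.1 w hw.1 hw.2
    rw [← hv.2]
    revert this
    cases c v <;> cases c w <;> simp
  have h1 := key true
  have h2 := key false
  simp only [Bool.not_true, Bool.not_false] at h1 h2
  have h3 := sum_filter_add_sum_filter_not X (fun v => c v = true) (fun v => #(nbrsIn G X v))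
  have h4 := card_filter_add_card_filter_not (s := X) (fun v => c v = true)
  simp only [Bool.not_eq_true] at h3 h4
  rw [← h3, ← h4]
  nlinarith [sq_nonneg ((#{v ∈ X | c v = true} : ℤ) - #{v ∈ X | c v = false})]

theorem sum_card_nbrsIn_univ [Fintype V] :
    ∑ v, #(nbrsIn G univ v) = 2 * #G.edgeFinset := by
  rw [← sum_degrees_eq_twice_card_edges]
  refine sum_congr rfl fun v _ => ?_
  rw [← card_neighborFinset_eq_degree]
  congr 1
  ext w
  simp

variable [DecidableEq V]

/-- In a bipartite graph in which vertices of one class have many common neighbours, any two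
distinct vertices are joined by paths of every short length at least two of the right parity. -/
theorem exists_isPath_of_codegree {C : Finset V} {c : V → Bool} {L : ℕ}
    (hc : ∀ u ∈ C, ∀ v ∈ C, G.Adj u v → c u ≠ c v)
    (hco : ∀ u ∈ C, ∀ v ∈ C, c u = c v → L ≤ #(nbrsIn G C u ∩ nbrsIn G C v)) :
    ∀ ℓ : ℕ, ∀ u ∈ C, ∀ v ∈ C, u ≠ v → ∀ F : Finset V, u ∉ F → v ∉ F →
      (c u = c v ↔ Even (ℓ + 2)) → #F + ℓ + 2 ≤ L →
      ∃ p : G.Walk u v, p.IsPath ∧ p.length = ℓ + 2 ∧ ∀ x ∈ p.support, x ∈ C ∧ x ∉ F := by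
  intro ℓ
  induction ℓ with
  | zero =>
    intro u hu v hv huv F huF hvF hpar hL
    have h1 := hco u hu v hv (hpar.2 (by decide))
    obtain ⟨w, hw, hwF⟩ := exists_mem_notMem_of_card_lt_card
      (show #F < #(nbrsIn G C u ∩ nbrsIn G C v) by omega)
    simp only [mem_inter, mem_nbrsIn] at hw
    refine ⟨.cons hw.1.2 (.cons hw.2.2.symm .nil), ?_, by simp, ?_⟩
    · simp [Walk.isPath_def, hw.1.2.ne, hw.2.2.ne.symm, huv]
    · simp only [Walk.support_cons, Walk.support_nil, List.mem_cons, List.not_mem_nil, or_false]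
      rintro x (rfl | rfl | rfl)
      · exact ⟨hu, huF⟩
      · exact ⟨hw.1.1, hwF⟩
      · exact ⟨hv, hvF⟩
  | succ ℓ ih =>
    intro u hu v hv huv F huF hvF hpar hL
    have h1 := hco u hu u hu rfl
    rw [inter_self] at h1
    have h2 : #(insert v F) ≤ #F + 1 := card_insert_le _ _
    obtain ⟨w, hw, hwF⟩ := exists_mem_notMem_of_card_lt_card
      (show #(insert v F) < #(nbrsIn G C u) by omega)
    simp only [mem_nbrsIn] at hw
    simp only [mem_insert, not_or] at hwF
    have h3 : #(insert u F) ≤ #F + 1 := card_insert_le _ _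
    have hcw := hc u hu w hw.1 hw.2
    obtain ⟨p, hp, hl, hs⟩ := ih w hw.1 v hv hwF.1 (insert u F)
      (by simp [hw.2.ne.symm, hwF.2]) (by simp [huv.symm, hvF])
      (by
        rw [show ℓ + 1 + 2 = (ℓ + 2) + 1 by ring, Nat.even_add_one] at hpar
        rw [← not_iff_not, ← hpar]
        revert hcw
        cases c u <;> cases c v <;> cases c w <;> simp)
      (by omega)
    refine ⟨.cons hw.2 p, ?_, by simp [hl], ?_⟩
    · rw [Walk.cons_isPath_iff]
      exact ⟨hp, fun h => (hs u h).2 (mem_insert_self _ _)⟩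
    · simp only [Walk.support_cons, List.mem_cons]
      rintro x (rfl | hx)
      · exact ⟨hu, huF⟩
      · exact ⟨(hs x hx).1, fun h => (hs x hx).2 (mem_insert_of_mem h)⟩

/-- If every vertex of `U` has large codegree with many vertices of `U`, then long even paths
with both ends in `U` exist. -/
theorem exists_isPath_of_chain [Fintype V] {U : Finset V} {L : ℕ}
    (hU : ∀ u ∈ U, ∀ Q : Finset V, #Q < L →
      ∃ w ∈ U, w ∉ Q ∧ L ≤ #(nbrsIn G univ u ∩ nbrsIn G univ w)) :
    ∀ j : ℕ, ∀ u ∈ U, ∀ F : Finset V, u ∉ F → #F + 2 * j + 1 ≤ L →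
      ∃ v ∈ U, ∃ p : G.Walk u v, p.IsPath ∧ p.length = 2 * j ∧ ∀ x ∈ p.support, x ∉ F := by
  intro j
  induction j with
  | zero =>
    intro u hu F huF _
    exact ⟨u, hu, .nil, by simp, by simp, by simpa using huF⟩
  | succ j ih =>
    intro u hu F huF hL
    have h1 : #(insert u F) ≤ #F + 1 := card_insert_le _ _
    obtain ⟨w, hw, hwQ, hco⟩ := hU u hu (insert u F) (by omega)
    obtain ⟨r, hr, hrF⟩ := exists_mem_notMem_of_card_lt_card
      (show #(insert u F) < #(nbrsIn G univ u ∩ nbrsIn G univ w) by omega)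
    simp only [mem_inter, mem_nbrsIn, mem_univ, true_and] at hr
    have h2 : #(insert r (insert u F)) ≤ #(insert u F) + 1 := card_insert_le _ _
    obtain ⟨v, hv, p, hp, hl, hs⟩ := ih w hw (insert r (insert u F))
      (by
        rw [mem_insert, not_or]
        exact ⟨hr.2.ne, hwQ⟩) (by omega)
    refine ⟨v, hv, .cons hr.1 (.cons hr.2.symm p), ?_, by simp [hl]; ring, ?_⟩
    · rw [Walk.cons_isPath_iff, Walk.cons_isPath_iff]
      refine ⟨⟨hp, fun h => hs r h (by simp)⟩, ?_⟩
      simp only [Walk.support_cons, List.mem_cons, not_or]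
      exact ⟨hr.1.ne, fun h => hs u h (by simp)⟩
    · simp only [Walk.support_cons, List.mem_cons]
      rintro x (rfl | rfl | hx)
      · exact huF
      · exact fun h => hrF (mem_insert_of_mem h)
      · exact fun h => hs x hx (by simp [h])

/-- Among three vertices with large total degree, two have many common neighbours. -/
theorem sum_card_nbrsIn_le [Fintype V] (a b d : V) :
    G.degree a + G.degree b + G.degree d ≤ Fintype.card V +
      #(nbrsIn G univ a ∩ nbrsIn G univ b) + #(nbrsIn G univ a ∩ nbrsIn G univ d) +
      #(nbrsIn G univ b ∩ nbrsIn G univ d) := by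
  have hdeg : ∀ v, G.degree v = #(nbrsIn G univ v) := by
    intro v
    rw [← card_neighborFinset_eq_degree]
    congr 1
    ext w
    simp
  simp only [hdeg]
  generalize nbrsIn G univ a = A
  generalize nbrsIn G univ b = B
  generalize nbrsIn G univ d = D
  have h1 := card_union_add_card_inter A B
  have h2 := card_union_add_card_inter (A ∪ B) D
  have h3 : #((A ∪ B) ∩ D) ≤ #(A ∩ D) + #(B ∩ D) := by
    rw [union_inter_distrib_right]
    exact card_union_le _ _
  have h4 : #(A ∪ B ∪ D) ≤ Fintype.card V := card_le_univ _
  omega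

/-- A `C_{2k+1}`-free graph in which any three vertices contain two with many common neighbours
has no edge lying in many triangles. -/
theorem CycleFree.card_codegree_lt [Fintype V] (h : CycleFree G (2 * k + 1)) (hk : 2 ≤ k)
    (h3 : ∀ a b d : V, 8 * k ≤ #(nbrsIn G univ a ∩ nbrsIn G univ b) ∨
      8 * k ≤ #(nbrsIn G univ a ∩ nbrsIn G univ d) ∨
      8 * k ≤ #(nbrsIn G univ b ∩ nbrsIn G univ d)) {x y : V} (hxy : G.Adj x y) :
    #(nbrsIn G univ x ∩ nbrsIn G univ y) < 8 * k := by
  by_contra! hcon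
  set W := nbrsIn G univ x ∩ nbrsIn G univ y with hW
  obtain ⟨U, hUW, hne, hU⟩ : ∃ U ⊆ W, U.Nonempty ∧ ∀ u ∈ U, ∀ Q : Finset V, #Q < 4 * k →
      ∃ w ∈ U, w ∉ Q ∧ 4 * k ≤ #(nbrsIn G univ u ∩ nbrsIn G univ w) := by
    by_cases hbig : ∃ w ∈ W,
        4 * k ≤ #{u ∈ W | ¬ 8 * k ≤ #(nbrsIn G univ w ∩ nbrsIn G univ u)}
    · obtain ⟨w, _, hw⟩ := hbig
      refine ⟨{u ∈ W | ¬ 8 * k ≤ #(nbrsIn G univ w ∩ nbrsIn G univ u)}, filter_subset _ _,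
        card_pos.1 (by omega), ?_⟩
      intro u hu Q hQ
      obtain ⟨w', hw', hw'Q⟩ := exists_mem_notMem_of_card_lt_card (hQ.trans_le hw)
      refine ⟨w', hw', hw'Q, ?_⟩
      rw [mem_filter] at hu hw'
      rcases h3 w u w' with h' | h' | h'
      · exact absurd h' hu.2
      · exact absurd h' hw'.2
      · omega
    · push Not at hbig
      refine ⟨W, Subset.rfl, card_pos.1 (by omega), ?_⟩
      intro u hu Q hQ
      have hb := hbig u hu
      set B := {w ∈ W | ¬ 8 * k ≤ #(nbrsIn G univ u ∩ nbrsIn G univ w)} with hB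
      have hb' : #B < 4 * k := by simpa [hB] using hb
      have := card_union_le Q B
      obtain ⟨w, hw, hwQ⟩ := exists_mem_notMem_of_card_lt_card (show #(Q ∪ B) < #W by omega)
      simp only [hB, mem_union, mem_filter, not_or, not_and, not_not] at hwQ
      exact ⟨w, hw, hwQ.1, by have := hwQ.2 hw; omega⟩
  obtain ⟨u, hu⟩ := hne
  have hWadj : ∀ w ∈ W, G.Adj x w ∧ G.Adj y w := by
    intro w hw
    simpa [hW] using hw
  have hcard : #({x, y} : Finset V) ≤ 2 := card_le_two
  obtain ⟨v, hv, p, hp, hl, hs⟩ := exists_isPath_of_chain hU (k - 1) u hu {x, y}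
    (by simp [(hWadj u (hUW hu)).1.ne.symm, (hWadj u (hUW hu)).2.ne.symm]) (by omega)
  have hxs : x ∉ p.support := fun h' => hs x h' (by simp)
  have hys : y ∉ p.support := fun h' => hs y h' (by simp)
  refine h.not_adj_of_isPath (by omega)
    (.cons hxy.symm (.cons (hWadj u (hUW hu)).1 p)) ?_ ?_ (hWadj v (hUW hv)).2.symm
  · rw [Walk.cons_isPath_iff, Walk.cons_isPath_iff]
    exact ⟨⟨hp, hxs⟩, by simp [hxy.ne.symm, hys]⟩
  · simp [hl]
    omega

/-- A `C_{2k+1}`-free graph with large minimum degree is bipartite. -/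
theorem CycleFree.colorable_two [Fintype V] (h : CycleFree G (2 * k + 1)) (hk : 2 ≤ k)
    (hN : 79 * k ≤ Fintype.card V)
    (hdeg : ∀ v, 18 * Fintype.card V ≤ 40 * G.degree v + 9) : G.Colorable 2 := by
  have h3 : ∀ a b d : V, 8 * k ≤ #(nbrsIn G univ a ∩ nbrsIn G univ b) ∨
      8 * k ≤ #(nbrsIn G univ a ∩ nbrsIn G univ d) ∨
      8 * k ≤ #(nbrsIn G univ b ∩ nbrsIn G univ d) := by
    intro a b d
    have := sum_card_nbrsIn_le (G := G) a b d
    have := hdeg a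
    have := hdeg b
    have := hdeg d
    omega
  have : Nonempty V := Fintype.card_pos_iff.1 (by omega)
  apply colorable_of_cliqueFree_lt_minDegree
  · intro s hs
    obtain ⟨x, y, z, hxy, hxz, hyz, _⟩ := is3Clique_iff.1 hs
    rcases h3 x y z with h' | h' | h'
    · exact (h.card_codegree_lt hk h3 hxy).not_ge h'
    · exact (h.card_codegree_lt hk h3 hxz).not_ge h'
    · exact (h.card_codegree_lt hk h3 hyz).not_ge h'
  · obtain ⟨v, hv⟩ := G.exists_minimal_degree_vertex
    rw [hv]
    have := hdeg v
    omega

/-- Splitting a degree sum along a subset. -/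
theorem sum_card_nbrsIn_of_subset {X Y : Finset V} (h : X ⊆ Y) :
    ∑ v ∈ Y, #(nbrsIn G Y v) = ∑ v ∈ X, #(nbrsIn G X v) +
      ∑ v ∈ Y \ X, #(nbrsIn G (Y \ X) v) + 2 * ∑ v ∈ X, #(nbrsIn G (Y \ X) v) := by
  have hsplit : ∀ v, #(nbrsIn G Y v) = #(nbrsIn G X v) + #(nbrsIn G (Y \ X) v) := by
    intro v
    rw [← card_union_of_disjoint]
    · congr 1
      ext w
      have := @h w
      simp only [mem_union, mem_nbrsIn, mem_sdiff]
      tauto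
    · rw [Finset.disjoint_left]
      intro w
      simp only [mem_nbrsIn, mem_sdiff]
      tauto
  have hcross : ∑ v ∈ X, #(nbrsIn G (Y \ X) v) = ∑ v ∈ Y \ X, #(nbrsIn G X v) := by
    rw [show ∑ v ∈ X, #(nbrsIn G (Y \ X) v) = ∑ v ∈ X, #(bipartiteAbove G.Adj (Y \ X) v) from rfl,
      sum_card_bipartiteAbove_eq_sum_card_bipartiteBelow]
    refine sum_congr rfl fun v _ => ?_
    congr 1
    ext w
    simp [bipartiteBelow, G.adj_comm]
  rw [← sum_sdiff h]
  simp only [hsplit, sum_add_distrib]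
  rw [← hcross]
  ring

theorem sum_card_nbrsIn_le_sq (X : Finset V) :
    ∑ v ∈ X, #(nbrsIn G X v) ≤ #X * (#X - 1) := by
  rw [← smul_eq_mul]
  refine sum_le_card_nsmul _ _ _ fun v hv => ?_
  rw [← card_erase_of_mem hv]
  refine card_le_card fun w hw => ?_
  rw [mem_nbrsIn] at hw
  exact mem_erase.2 ⟨hw.2.ne.symm, hw.1⟩

/-- The number of edges of a graph that is bipartite outside `X`. -/
theorem card_edgeFinset_le [Fintype V] {X : Finset V} {c : V → Bool}
    (hc : ∀ u ∉ X, ∀ v ∉ X, G.Adj u v → c u ≠ c v) :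
    #G.edgeFinset ≤ (Fintype.card V - #X) ^ 2 / 4 + (#X).choose 2 +
      ∑ v ∈ X, #(nbrsIn G (univ \ X) v) := by
  have h1 := sum_card_nbrsIn_of_subset (G := G) (subset_univ X)
  rw [sum_card_nbrsIn_univ] at h1
  have h2 := sum_card_nbrsIn_le_sq (G := G) X
  have h3 := two_mul_sum_card_nbrsIn_le (G := G) (X := univ \ X) (c := c)
    (fun u hu v hv => hc u (by simpa using hu) v (by simpa using hv))
  rw [card_sdiff_of_subset (subset_univ X), card_univ] at h3
  have h4 : 2 * (#X).choose 2 = #X * (#X - 1) := by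
    rw [Nat.choose_two_right, Nat.mul_div_cancel' (Nat.even_mul_pred_self _).two_dvd]
  omega

/-- A `C_{2k+1}`-free graph with nearly the maximum number of edges has a bipartite induced
subgraph of large minimum degree that misses few vertices. -/
theorem CycleFree.exists_core [Fintype V] {n t : ℕ} (h : CycleFree G (2 * k + 1)) (hk : 2 ≤ k)
    (ht : 1 ≤ t) (hn : 318 * t ^ 2 * k ≤ n) (hcard : Fintype.card V = n)
    (hedge : (n - t - 1) ^ 2 ≤ 4 * #G.edgeFinset) :
    ∃ (C : Finset V) (c : V → Bool), (∀ u ∈ C, ∀ v ∈ C, G.Adj u v → c u ≠ c v) ∧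
      n ≤ #C + 32 * t ∧ ∀ v ∈ C, 18 * #C ≤ 40 * #(nbrsIn G C v) + 9 := by
  obtain ⟨C, hC⟩ := Finite.exists_max
    (fun X : Finset V => 20 * (∑ v ∈ X, #(nbrsIn G X v) : ℤ) - 9 * (#X : ℤ) ^ 2)
  have htk : 2 * t ≤ t ^ 2 * k := by nlinarith
  have htk' : k ≤ t ^ 2 * k := Nat.le_mul_of_pos_left _ (by positivity)
  have hdeg : ∀ v ∈ C, 18 * #C ≤ 40 * #(nbrsIn G C v) + 9 := by
    intro v hv
    have h1 := hC (C.erase v)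
    have h2 := sum_card_nbrsIn_of_subset (G := G) (singleton_subset_iff.2 hv)
    rw [sdiff_singleton_eq_erase, sum_singleton, sum_singleton] at h2
    have h3 : #(nbrsIn G {v} v) = 0 := by
      rw [card_eq_zero, eq_empty_iff_forall_notMem]
      intro w hw
      rw [mem_nbrsIn, mem_singleton] at hw
      exact hw.2.ne hw.1.symm
    have h4 : #(nbrsIn G (C.erase v) v) ≤ #(nbrsIn G C v) :=
      card_le_card (filter_subset_filter _ (erase_subset _ _))
    have h5 := card_erase_add_one hv
    have h5' : (#(C.erase v) : ℤ) = #C - 1 := by omega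
    zify at h2 h3 h4
    rw [h5'] at h1
    zify
    nlinarith
  have hmax := hC univ
  have huniv := sum_card_nbrsIn_univ (G := G)
  zify at huniv
  rw [huniv, card_univ, hcard] at hmax
  have hlow : (n : ℤ) ^ 2 - 20 * (t + 1) * n ≤
      20 * (∑ v ∈ C, #(nbrsIn G C v) : ℤ) - 9 * (#C : ℤ) ^ 2 := by
    have : ((n - t - 1 : ℕ) : ℤ) = n - t - 1 := by
      have : t + 1 ≤ n := by nlinarith
      omega
    zify at hedge
    rw [this] at hedge
    nlinarith
  have hCn : #C ≤ n := hcard ▸ card_le_univ C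
  have hnt : (636 * t : ℤ) ≤ n := by
    have : 636 * t ≤ n := by nlinarith
    exact_mod_cast this
  have hquarter : n ≤ 4 * #C := by
    have h1 := sum_card_nbrsIn_le_sq (G := G) C
    have h2 : #C * (#C - 1) ≤ #C ^ 2 := by
      rw [sq]
      exact Nat.mul_le_mul_left _ (Nat.sub_le _ _)
    have h3 := h1.trans h2
    zify at h3
    by_contra! hlt
    zify at hlt ht
    nlinarith
  have hcol : (G.induce (C : Set V)).Colorable 2 := by
    have hcC : Fintype.card (C : Set V) = #C := by simp
    refine (h.induce (C : Set V)).colorable_two hk ?_ ?_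
    · rw [hcC]
      nlinarith
    · rintro ⟨v, hv⟩
      rw [hcC]
      have h1 : (G.induce (C : Set V)).degree ⟨v, hv⟩ = #(nbrsIn G C v) := by
        rw [← card_neighborFinset_eq_degree, ← card_map (Function.Embedding.subtype _)]
        congr 1
        ext w
        simp [and_comm]
      rw [h1]
      exact hdeg v hv
  obtain ⟨f⟩ := hcol
  let c : V → Bool := fun v => if hv : v ∈ (C : Set V) then f ⟨v, hv⟩ = 0 else false
  have hc : ∀ u ∈ C, ∀ v ∈ C, G.Adj u v → c u ≠ c v := by
    intro u hu v hv huv heq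
    have hne : f ⟨u, hu⟩ ≠ f ⟨v, hv⟩ := f.valid (by simpa using huv)
    simp only [c, mem_coe, hu, hv, dif_pos, decide_eq_decide] at heq
    omega
  refine ⟨C, c, hc, ?_, hdeg⟩
  have h2 := two_mul_sum_card_nbrsIn_le hc
  zify at h2 hquarter hCn ht ⊢
  by_contra! hlt
  nlinarith

/-- The hypotheses on a bipartite subgraph under which it contains paths between any two vertices
of all short lengths of the right parity. -/
structure WellConnected (G : SimpleGraph V) [DecidableRel G.Adj] (k : ℕ) (C : Finset V)
    (c : V → Bool) : Prop where
  proper : ∀ u ∈ C, ∀ v ∈ C, G.Adj u v → c u ≠ c v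
  codegree : ∀ u ∈ C, ∀ v ∈ C, c u = c v → 2 * k ≤ #(nbrsIn G C u ∩ nbrsIn G C v)

namespace WellConnected

variable {C : Finset V} {c : V → Bool}

theorem exists_isPath (hC : WellConnected G k C c) {u v : V} (hu : u ∈ C) (hv : v ∈ C)
    (huv : u ≠ v) {ℓ : ℕ} (hℓ : 2 ≤ ℓ) (hℓk : ℓ ≤ 2 * k) (hpar : c u = c v ↔ Even ℓ) :
    ∃ p : G.Walk u v, p.IsPath ∧ p.length = ℓ ∧ ∀ x ∈ p.support, x ∈ C := by
  obtain ⟨m, rfl⟩ := Nat.exists_eq_add_of_le' hℓ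
  obtain ⟨p, hp, hl, hs⟩ := exists_isPath_of_codegree hC.proper hC.codegree m u hu v hv huv ∅
    (notMem_empty _) (notMem_empty _) hpar (by simpa using hℓk)
  exact ⟨p, hp, hl, fun x hx => (hs x hx).1⟩

/-- A vertex outside `C` has neighbours in one colour class only. -/
theorem color_eq_of_adj (hC : WellConnected G k C c) (h : CycleFree G (2 * k + 1)) (hk : 2 ≤ k)
    {v a b : V} (hv : v ∉ C) (ha : a ∈ C) (hb : b ∈ C) (hva : G.Adj v a) (hvb : G.Adj v b) :
    c a = c b := by
  by_contra hab
  obtain ⟨p, hp, hl, hs⟩ := hC.exists_isPath ha hb (fun e => hab (e ▸ rfl))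
    (ℓ := 2 * k - 1) (by omega) (by omega)
    (iff_of_false hab (Nat.not_even_iff_odd.2 ⟨k - 1, by omega⟩))
  refine h.not_adj_of_isPath (by omega) (.cons hva p) ?_ ?_ hvb.symm
  · rw [Walk.cons_isPath_iff]
    exact ⟨hp, fun h' => hv (hs v h')⟩
  · rw [Walk.length_cons, hl]
    omega

/-- Adjacent vertices outside `C` attached to the same colour class have a unique neighbour
there. -/
theorem eq_of_adj_adj (hC : WellConnected G k C c) (h : CycleFree G (2 * k + 1)) (hk : 2 ≤ k)
    {v w a b : V} (hv : v ∉ C) (hw : w ∉ C) (hvw : G.Adj v w) (ha : a ∈ C) (hb : b ∈ C)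
    (hva : G.Adj v a) (hwb : G.Adj w b) (hab : c a = c b) : a = b := by
  by_contra hne
  obtain ⟨p, hp, hl, hs⟩ := hC.exists_isPath ha hb hne (ℓ := 2 * k - 2) (by omega) (by omega)
    (iff_of_true hab ⟨k - 1, by omega⟩)
  refine h.not_adj_of_isPath (by omega) (.cons hvw.symm (.cons hva p)) ?_ ?_ hwb.symm
  · rw [Walk.cons_isPath_iff, Walk.cons_isPath_iff, Walk.support_cons, List.mem_cons, not_or]
    exact ⟨⟨hp, fun h' => hv (hs v h')⟩, hvw.ne.symm, fun h' => hw (hs w h')⟩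
  · rw [Walk.length_cons, Walk.length_cons, hl]
    omega

/-- A path on three vertices outside `C` cannot have its ends attached to adjacent vertices
of `C`. -/
theorem not_adj_of_adj_adj (hC : WellConnected G k C c) (h : CycleFree G (2 * k + 1))
    (hk : 2 ≤ k) {u v w a b : V} (hu : u ∉ C) (hv : v ∉ C) (hw : w ∉ C) (huw : u ≠ w)
    (hvu : G.Adj v u) (hvw : G.Adj v w) (ha : a ∈ C) (hb : b ∈ C)
    (hua : G.Adj u a) (hwb : G.Adj w b) : ¬ G.Adj a b := by
  intro hab
  obtain ⟨p, hp, hl, hs⟩ : ∃ p : G.Walk a b, p.IsPath ∧ p.length = 2 * k - 3 ∧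
      ∀ x ∈ p.support, x ∈ C := by
    obtain rfl | hk3 := hk.eq_or_lt
    · refine ⟨.cons hab .nil, by simp [Walk.isPath_def, hab.ne], by simp, ?_⟩
      simp [ha, hb]
    · exact hC.exists_isPath ha hb hab.ne (by omega) (by omega)
        (iff_of_false (hC.proper a ha b hb hab) (Nat.not_even_iff_odd.2 ⟨k - 2, by omega⟩))
  refine h.not_adj_of_isPath (by omega) (.cons hvw.symm (.cons hvu (.cons hua p))) ?_ ?_
    hwb.symm
  · rw [Walk.cons_isPath_iff, Walk.cons_isPath_iff, Walk.cons_isPath_iff]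
    simp only [Walk.support_cons, List.mem_cons, not_or]
    exact ⟨⟨⟨hp, fun h' => hu (hs u h')⟩, hvu.ne, fun h' => hv (hs v h')⟩, hvw.ne.symm,
      huw.symm, fun h' => hw (hs w h')⟩
  · rw [Walk.length_cons, Walk.length_cons, Walk.length_cons, hl]
    omega

end WellConnected

/-- In a bipartite graph on `C` of large minimum degree, vertices of the same colour with many
neighbours in `C` have many common neighbours there. -/
theorem card_nbrsIn_add_le {C : Finset V} {c : V → Bool}
    (hc : ∀ u ∈ C, ∀ v ∈ C, G.Adj u v → c u ≠ c v)
    (hmin : ∀ v ∈ C, 18 * #C ≤ 40 * #(nbrsIn G C v) + 9) {u v : V}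
    (hu : ∀ w ∈ C, G.Adj u w → c u ≠ c w) (hv : ∀ w ∈ C, G.Adj v w → c v ≠ c w)
    (huv : c u = c v) (hpos : 0 < #(nbrsIn G C u)) :
    40 * (#(nbrsIn G C u) + #(nbrsIn G C v)) ≤
      40 * #(nbrsIn G C u ∩ nbrsIn G C v) + 22 * #C + 9 := by
  obtain ⟨w, hw⟩ := card_pos.1 hpos
  rw [mem_nbrsIn] at hw
  have h1 := hmin w hw.1
  have h2 : #(nbrsIn G C w) ≤ #{x ∈ C | c x = c u} := by
    refine card_le_card fun x hx => ?_
    rw [mem_nbrsIn] at hx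
    rw [mem_filter]
    have h3 := hc w hw.1 x hx.1 hx.2
    have h4 := hu w hw.1 hw.2
    refine ⟨hx.1, ?_⟩
    revert h3 h4
    cases c u <;> cases c w <;> cases c x <;> simp
  have h3 : #(nbrsIn G C u ∪ nbrsIn G C v) ≤ #{x ∈ C | ¬ c x = c u} := by
    refine card_le_card fun x hx => ?_
    simp only [mem_union, mem_nbrsIn] at hx
    rw [mem_filter]
    rcases hx with hx | hx
    · exact ⟨hx.1, (hu x hx.1 hx.2).symm⟩
    · exact ⟨hx.1, huv ▸ (hv x hx.1 hx.2).symm⟩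
  have h4 := card_filter_add_card_filter_not (s := C) (fun x => c x = c u)
  have h5 := card_union_add_card_inter (nbrsIn G C u) (nbrsIn G C v)
  omega

/-- The colouring of a well connected set extends to all vertices in a way that respects all
edges leaving the set. -/
theorem WellConnected.exists_extension {C : Finset V} {c : V → Bool}
    (hC : WellConnected G k C c) (h : CycleFree G (2 * k + 1)) (hk : 2 ≤ k) :
    ∃ c' : V → Bool, (∀ u ∈ C, c' u = c u) ∧ ∀ u ∈ C, ∀ v, G.Adj u v → c' u ≠ c' v := by
  classical
  let c' : V → Bool := fun v => if v ∈ C then c v else ! decide (∃ b ∈ C, G.Adj v b ∧ c b = true)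
  have hin : ∀ u ∈ C, c' u = c u := fun u hu => if_pos hu
  refine ⟨c', hin, fun u hu v huv => ?_⟩
  rw [hin u hu]
  by_cases hv : v ∈ C
  · rw [hin v hv]
    exact hC.proper u hu v hv huv
  · by_cases hex : ∃ b ∈ C, G.Adj v b ∧ c b = true
    · obtain ⟨b, hb, hvb, hcb⟩ := hex
      have := hC.color_eq_of_adj h hk hv hu hb huv.symm hvb
      have hv' : c' v = false := by
        simp only [c', if_neg hv, Bool.not_eq_false', decide_eq_true_eq]
        exact ⟨b, hb, hvb, hcb⟩
      rw [this, hcb, hv']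
      simp
    · have hv' : c' v = true := by
        simp only [c', if_neg hv, Bool.not_eq_true', decide_eq_false_iff_not]
        exact hex
      rw [hv']
      exact fun e => hex ⟨u, hu, huv.symm, e⟩

/-- Deleting `X` loses too many edges when `X` is a set of more than `t + 1` vertices sending few
edges to the complement of a small set. -/
theorem card_edgeFinset_le_of_few_edges [Fintype V] {n t : ℕ} {X C : Finset V} {c : V → Bool}
    (ht : 1 ≤ t) (hn : 636 * t ^ 2 ≤ n) (hcard : Fintype.card V = n) (hC : n ≤ #C + 32 * t)
    (hXC : Disjoint X C) (hX : t + 2 ≤ #X) (hc : ∀ u ∉ X, ∀ v ∉ X, G.Adj u v → c u ≠ c v)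
    (hsum : 10 * ∑ v ∈ X, #(nbrsIn G C v) ≤ 10 * #X + 3 * n) :
    #G.edgeFinset ≤ (n - t - 1) ^ 2 / 4 := by
  have hle : #X + #C ≤ n := by
    rw [← card_union_of_disjoint hXC, ← hcard]
    exact card_le_univ _
  have h1 := card_edgeFinset_le (G := G) hc
  have h2 : ∑ v ∈ X, #(nbrsIn G (univ \ X) v) ≤
      ∑ v ∈ X, #(nbrsIn G C v) + #X * (n - #X - #C) := by
    rw [← smul_eq_mul, ← sum_const, ← sum_add_distrib]
    refine sum_le_sum fun v _ => ?_
    have h3 : #(univ \ (X ∪ C)) = n - #X - #C := by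
      rw [card_sdiff_of_subset (subset_univ _), card_union_of_disjoint hXC, card_univ, hcard]
      omega
    rw [← h3]
    refine (card_le_card ?_).trans (card_union_le _ _)
    intro w hw
    simp only [mem_nbrsIn, mem_sdiff, mem_univ, true_and, mem_union] at hw ⊢
    tauto
  have h4 : 2 * (#X).choose 2 = #X * (#X - 1) := by
    rw [Nat.choose_two_right, Nat.mul_div_cancel' (Nat.even_mul_pred_self _).two_dvd]
  rw [hcard] at h1
  generalize ∑ v ∈ X, #(nbrsIn G C v) = s at *
  generalize ∑ v ∈ X, #(nbrsIn G (univ \ X) v) = s' at *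
  obtain ⟨j, hj⟩ := Nat.exists_eq_add_of_le hX
  have hb : t ≤ t ^ 2 := by nlinarith
  have hd : n - #X - #C ≤ 32 * t - #X := by omega
  obtain ⟨r, hr⟩ : ∃ r, 32 * t = #X + r := Nat.exists_eq_add_of_le (by omega)
  have hd' : #X * (n - #X - #C) ≤ #X * r := Nat.mul_le_mul_left _ (by omega)
  obtain ⟨m, hm⟩ : ∃ m, n = #X + m := Nat.exists_eq_add_of_le (by omega)
  have e1 : n - #X = m := by omega
  have e2 : n - t - 1 = m + (j + 1) := by omega
  have e3 : #X * (#X - 1) ≤ #X * #X := Nat.mul_le_mul_left _ (by omega)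
  rw [e1] at h1
  rw [e2, Nat.le_div_iff_mul_le (by norm_num)]
  have h5 : 20 * #G.edgeFinset ≤ 5 * m ^ 2 + 10 * (#X * #X) + 20 * #X + 6 * n + 20 * (#X * r) := by
    omega
  generalize #X = x at *
  generalize #G.edgeFinset = e at *
  have h6 : 10 * (x * x) + 20 * (x * r) ≤ 640 * (t * x) := by
    calc 10 * (x * x) + 20 * (x * r) ≤ 20 * (x * x) + 20 * (x * r) := by omega
      _ = 20 * (x * (x + r)) := by ring
      _ = 640 * (t * x) := by rw [← hr]; ring
  have h7 : x ≤ 3 * (t * (j + 1)) := by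
    have : j ≤ t * j := Nat.le_mul_of_pos_left _ ht
    rw [hj, mul_add]
    omega
  have h8 : t * x ≤ 3 * (t ^ 2 * (j + 1)) :=
    (Nat.mul_le_mul_left t h7).trans_eq (by ring)
  have h9 : 636 * (t ^ 2 * (j + 1)) ≤ n * (j + 1) := by
    rw [← mul_assoc]
    exact Nat.mul_le_mul_right _ hn
  have h10 : t * (j + 1) ≤ t ^ 2 * (j + 1) := Nat.mul_le_mul_right _ hb
  have h11 : 18 * n ≤ 19 * m := by omega
  have h12 : 18 * (n * (j + 1)) ≤ 19 * (m * (j + 1)) := by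
    rw [← mul_assoc, ← mul_assoc]
    exact Nat.mul_le_mul_right _ h11
  have h13 : n ≤ n * (j + 1) := Nat.le_mul_of_pos_right _ (by omega)
  have h14 : m ^ 2 + 2 * (m * (j + 1)) ≤ (m + (j + 1)) ^ 2 := by
    rw [add_sq, mul_assoc 2 m]
    exact Nat.le_add_right _ _
  omega

/-- A dense `C_{2k+1}`-free graph becomes bipartite after deleting at most `t - 1` vertices. -/
theorem CycleFree.exists_deletion [Fintype V] {n t : ℕ} (h : CycleFree G (2 * k + 1))
    (hk : 2 ≤ k) (ht : 1 ≤ t) (hn : 318 * t ^ 2 * k ≤ n) (hcard : Fintype.card V = n)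
    (hedge : (n - t - 1) ^ 2 / 4 + (t + 2).choose 2 < #G.edgeFinset) :
    ∃ T : Finset V, #T ≤ t - 1 ∧ (G.induce ((↑T : Set V)ᶜ)).Colorable 2 := by
  by_contra! hcon
  have hd2 : ∀ (T : Finset V) (c : V → Bool), #T ≤ t - 1 →
      ¬ ∀ u ∉ T, ∀ v ∉ T, G.Adj u v → c u ≠ c v :=
    fun T c hT hc => hcon T hT (colorable_induce_compl hc)
  have hn1 : 636 * t ^ 2 ≤ n := by nlinarith
  have hn2 : 318 * k ≤ n := by
    have : k ≤ t ^ 2 * k := Nat.le_mul_of_pos_left _ (by positivity)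
    nlinarith
  have hn3 : 636 * t ≤ n := by nlinarith
  have hchoose : 3 ≤ (t + 2).choose 2 := Nat.choose_le_choose 2 (show 3 ≤ t + 2 by omega)
  obtain ⟨C, c₀, hc₀, hCn, hmin⟩ := h.exists_core hk ht hn hcard (by omega)
  have hCn' : #C ≤ n := hcard ▸ card_le_univ C
  have hwc₀ : WellConnected G k C c₀ := by
    refine ⟨hc₀, fun u hu v hv huv => ?_⟩
    have hu' := hmin u hu
    have hv' := hmin v hv
    have := card_nbrsIn_add_le hc₀ hmin (hc₀ u hu) (hc₀ v hv) huv (by omega)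
    omega
  obtain ⟨c, hcc₀, hc⟩ := hwc₀.exists_extension h hk
  have hwc : WellConnected G k C c :=
    ⟨fun u hu v _ => hc u hu v, fun u hu v hv huv =>
      hwc₀.codegree u hu v hv (by rwa [← hcc₀ u hu, ← hcc₀ v hv])⟩
  have hc' : ∀ v, ∀ w ∈ C, G.Adj v w → c v ≠ c w := fun v w hw hvw => (hc w hw v hvw.symm).symm
  set S : Finset V := {v | v ∉ C ∧ #(nbrsIn G C v) ≤ 1} with hS
  have hSC : ∀ v ∈ S, v ∉ C := fun v hv => (mem_filter.1 hv).2.1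
  have hSn : ∀ v ∈ S, #(nbrsIn G C v) ≤ 1 := fun v hv => (mem_filter.1 hv).2.2
  have hnS : ∀ v ∉ S, v ∉ C → 1 < #(nbrsIn G C v) := by
    intro v hv hvC
    by_contra! hlt
    exact hv (mem_filter.2 ⟨mem_univ _, hvC, hlt⟩)
  have hproper : ∀ u ∉ S, ∀ v ∉ S, G.Adj u v → c u ≠ c v := by
    intro u hu v hv huv heq
    by_cases huC : u ∈ C
    · exact hc u huC v huv heq
    by_cases hvC : v ∈ C
    · exact hc' u v hvC huv heq
    obtain ⟨a, ha⟩ := card_pos.1 (zero_lt_one.trans (hnS u hu huC))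
    obtain ⟨b, hb, hba⟩ := exists_mem_ne (hnS v hv hvC) a
    rw [mem_nbrsIn] at ha hb
    refine hba (hwc.eq_of_adj_adj h hk huC hvC huv ha.1 hb.1 ha.2 hb.2 ?_).symm
    have h1 := hc' u a ha.1 ha.2
    have h2 := hc' v b hb.1 hb.2
    revert h1 h2 heq
    cases c u <;> cases c v <;> cases c a <;> cases c b <;> simp
  have hcount : ∀ X : Finset V, S ⊆ X → (∀ v ∈ X, v ∉ C) → t + 2 ≤ #X →
      10 * ∑ v ∈ X, #(nbrsIn G C v) ≤ 10 * #X + 3 * n → False := by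
    intro X hSX hXC hX hsum
    have := card_edgeFinset_le_of_few_edges ht hn1 hcard hCn (Finset.disjoint_left.2 hXC) hX
      (fun u hu v hv => hproper u (fun h' => hu (hSX h')) v (fun h' => hv (hSX h'))) hsum
    omega
  have hSsum : ∑ v ∈ S, #(nbrsIn G C v) ≤ #S := by
    simpa using sum_le_card_nsmul S _ 1 hSn
  have hs1 : t ≤ #S := by
    by_contra! hlt
    exact hd2 S c (by omega) hproper
  have hs2 : #S ≤ t + 1 := by
    by_contra! hlt
    exact hcount S Subset.rfl hSC hlt (by omega)
  obtain hs | hs : #S = t ∨ #S = t + 1 := by omega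
  · have hfew : ∀ u ∉ S, u ∉ C → ∀ w ∉ S, w ∉ C → u ≠ w →
        n < 8 * #(nbrsIn G C u) ∨ n < 8 * #(nbrsIn G C w) := by
      intro u hu huC w hw hwC huw
      by_contra! hlt
      have hu' : u ∉ insert w S := by simp [huw, hu]
      refine hcount (insert u (insert w S)) ?_ ?_ ?_ ?_
      · exact (subset_insert _ _).trans (subset_insert _ _)
      · simp only [mem_insert]
        rintro v (rfl | rfl | hv)
        exacts [huC, hwC, hSC v hv]
      · rw [card_insert_of_notMem hu', card_insert_of_notMem hw, hs]
      · rw [card_insert_of_notMem hu', card_insert_of_notMem hw, sum_insert hu', sum_insert hw]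
        omega
    have hkey : ∀ v ∈ S, ∀ x ∉ S, ∀ y ∉ S, x ∉ C → y ∉ C → G.Adj v x → G.Adj v y →
        n < 8 * #(nbrsIn G C x) → c x = c y := by
      intro v hv x hx y hy hxC hyC hvx hvy hbig
      by_contra hxy
      obtain ⟨b, hb⟩ := card_pos.1 (zero_lt_one.trans (hnS y hy hyC))
      rw [mem_nbrsIn] at hb
      have hb' := hmin b hb.1
      have hcb : c b = c x := by
        have h1 := hc' y b hb.1 hb.2
        revert h1 hxy
        cases c x <;> cases c y <;> cases c b <;> simp
      have := card_nbrsIn_add_le hwc.proper hmin (hc' b) (hc' x) hcb (by omega)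
      obtain ⟨a, ha⟩ := card_pos.1 (show 0 < #(nbrsIn G C b ∩ nbrsIn G C x) by omega)
      simp only [mem_inter, mem_nbrsIn] at ha
      exact hwc.not_adj_of_adj_adj h hk hyC (hSC v hv) hxC (fun e => hxy (e ▸ rfl)) hvy hvx
        hb.1 ha.1.1 hb.2 ha.2.2 ha.1.2
    have hmixed : ∀ v ∈ S, ∀ x ∈ C, ∀ y ∉ S, y ∉ C → G.Adj v x → G.Adj v y → c x = c y := by
      intro v hv x hx y hy hyC hvx hvy
      by_contra hxy
      obtain ⟨b, hb, hbx⟩ := exists_mem_ne (hnS y hy hyC) x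
      rw [mem_nbrsIn] at hb
      refine hbx (hwc.eq_of_adj_adj h hk (hSC v hv) hyC hvy hx hb.1 hvx hb.2 ?_).symm
      have h1 := hc' y b hb.1 hb.2
      revert h1 hxy
      cases c x <;> cases c y <;> cases c b <;> simp
    have hmono : ∀ v ∈ S, ∀ x ∉ S, ∀ y ∉ S, G.Adj v x → G.Adj v y → c x = c y := by
      intro v hv x hx y hy hvx hvy
      by_cases hxC : x ∈ C
      · by_cases hyC : y ∈ C
        · exact hwc.color_eq_of_adj h hk (hSC v hv) hxC hyC hvx hvy
        · exact hmixed v hv x hxC y hy hyC hvx hvy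
      · by_cases hyC : y ∈ C
        · exact (hmixed v hv y hyC x hx hxC hvy hvx).symm
        · by_cases hxy : x = y
          · rw [hxy]
          rcases hfew x hx hxC y hy hyC hxy with hbig | hbig
          · exact hkey v hv x hx y hy hxC hyC hvx hvy hbig
          · exact (hkey v hv y hy x hx hyC hxC hvy hvx hbig).symm
    obtain ⟨v, hv⟩ := card_pos.1 (show 0 < #S by omega)
    obtain ⟨b, hb⟩ : ∃ b, ∀ x ∉ S, G.Adj v x → c x ≠ b := by
      by_cases hex : ∃ x ∉ S, G.Adj v x
      · obtain ⟨x, hx, hvx⟩ := hex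
        refine ⟨! c x, fun y hy hvy => ?_⟩
        rw [hmono v hv y hy x hx hvy hvx]
        simp
      · exact ⟨true, fun x hx hvx => absurd ⟨x, hx, hvx⟩ hex⟩
    refine hd2 (S.erase v) (Function.update c v b) (by rw [card_erase_of_mem hv, hs]) ?_
    intro u hu w hw huw
    simp only [mem_erase, not_and] at hu hw
    by_cases huv : u = v
    · subst huv
      have hwu := huw.ne.symm
      rw [Function.update_self, Function.update_of_ne hwu]
      exact (hb w (hw hwu) huw).symm
    · rw [Function.update_of_ne huv]
      by_cases hwv : w = v
      · subst hwv
        rw [Function.update_self]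
        exact hb u (hu huv) huw.symm
      · rw [Function.update_of_ne hwv]
        exact hproper u (hu huv) w (hw hwv) huw
  · have hbig : ∀ u ∉ S, 3 * n < 10 * #(nbrsIn G C u) := by
      intro u hu
      by_cases huC : u ∈ C
      · have := hmin u huC
        omega
      by_contra! hlt
      refine hcount (insert u S) (subset_insert _ _) ?_ ?_ ?_
      · simp only [mem_insert]
        rintro v (rfl | hv)
        exacts [huC, hSC v hv]
      · rw [card_insert_of_notMem hu, hs]
      · rw [card_insert_of_notMem hu, sum_insert hu]
        omega
    have hmem : ∀ u, u ∈ univ \ S ↔ u ∉ S := by simp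
    have hws : WellConnected G k (univ \ S) c := by
      refine ⟨fun u hu v hv => hproper u ((hmem u).1 hu) v ((hmem v).1 hv),
        fun u hu v hv huv => ?_⟩
      have hu' := hbig u ((hmem u).1 hu)
      have hv' := hbig v ((hmem v).1 hv)
      have h1 := card_nbrsIn_add_le hwc.proper hmin (hc' u) (hc' v) huv (by omega)
      have h2 : #(nbrsIn G C u ∩ nbrsIn G C v) ≤
          #(nbrsIn G (univ \ S) u ∩ nbrsIn G (univ \ S) v) := by
        have hsub : C ⊆ univ \ S := fun w hw => (hmem w).2 fun hwS => hSC w hwS hw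
        exact card_le_card (inter_subset_inter (filter_subset_filter _ hsub)
          (filter_subset_filter _ hsub))
      omega
    have hout : ∀ v ∈ S, v ∉ univ \ S := fun v hv hv' => (hmem v).1 hv' hv
    have hone : ∀ v ∈ S, #(nbrsIn G (univ \ S) v) ≤ 1 := by
      intro v hv
      by_contra! hlt
      obtain ⟨x, hx, y, hy, hxy⟩ := one_lt_card.1 hlt
      rw [mem_nbrsIn] at hx hy
      have hmono : ∀ w ∈ S, ∀ a ∉ S, ∀ b ∉ S, G.Adj w a → G.Adj w b → c a = c b :=
        fun w hw a ha b hb => hws.color_eq_of_adj h hk (hout w hw) ((hmem a).2 ha) ((hmem b).2 hb)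
      obtain ⟨w, hw, hwv⟩ := exists_mem_ne (show 1 < #S by omega) v
      have hv' : ∀ z ∉ S, G.Adj v z → c z ≠ ! c x := by
        intro z hz hvz
        rw [hmono v hv z hz x ((hmem x).1 hx.1) hvz hx.2]
        simp
      obtain ⟨b, hb, hbv⟩ : ∃ b, (∀ z ∉ S, G.Adj w z → c z ≠ b) ∧ (G.Adj v w → b = c x) := by
        by_cases hex : ∃ z ∉ S, G.Adj w z
        · obtain ⟨z, hz, hwz⟩ := hex
          refine ⟨! c z, fun z' hz' hwz' => ?_, fun hvw => ?_⟩
          · rw [hmono w hw z' hz' z hz hwz' hwz]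
            simp
          · by_contra hne
            have hxz : c x = c z := by
              revert hne
              cases c x <;> cases c z <;> simp
            have hyz : c y = c z := by
              rw [← hxz]
              exact hmono v hv y ((hmem y).1 hy.1) x ((hmem x).1 hx.1) hy.2 hx.2
            have h1 := hws.eq_of_adj_adj h hk (hout v hv) (hout w hw) hvw hx.1 ((hmem z).2 hz)
              hx.2 hwz hxz
            have h2 := hws.eq_of_adj_adj h hk (hout v hv) (hout w hw) hvw hy.1 ((hmem z).2 hz)
              hy.2 hwz hyz
            exact hxy (h1.trans h2.symm)
        · exact ⟨c x, fun z hz hwz => absurd ⟨z, hz, hwz⟩ hex, fun _ => rfl⟩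
      refine hd2 ((S.erase v).erase w) (Function.update (Function.update c v (! c x)) w b) ?_ ?_
      · rw [card_erase_of_mem (mem_erase.2 ⟨hwv, hw⟩), card_erase_of_mem hv, hs]
        omega
      have hcases : ∀ u, u ∉ (S.erase v).erase w → u = w ∨ u = v ∨ (u ≠ w ∧ u ≠ v ∧ u ∉ S) := by
        intro u hu
        simp only [mem_erase] at hu
        tauto
      have hcw : Function.update (Function.update c v (! c x)) w b w = b := by simp
      have hcv : Function.update (Function.update c v (! c x)) w b v = ! c x := by
        simp [Function.update_of_ne hwv.symm]
      have hcu : ∀ u, u ≠ w → u ≠ v →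
          Function.update (Function.update c v (! c x)) w b u = c u := by
        intro u h1 h2
        rw [Function.update_of_ne h1, Function.update_of_ne h2]
      intro u hu z hz huz
      rcases hcases u hu with rfl | rfl | ⟨hu1, hu2, hu3⟩ <;>
        rcases hcases z hz with rfl | rfl | ⟨hz1, hz2, hz3⟩
      · exact absurd rfl huz.ne
      · rw [hcw, hcv, hbv huz.symm]
        simp
      · rw [hcw, hcu z hz1 hz2]
        exact (hb z hz3 huz).symm
      · rw [hcw, hcv, hbv huz]
        simp
      · exact absurd rfl huz.ne
      · rw [hcv, hcu z hz1 hz2]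
        exact (hv' z hz3 huz).symm
      · rw [hcw, hcu u hu1 hu2]
        exact hb u hu3 huz.symm
      · rw [hcv, hcu u hu1 hu2]
        exact hv' u hu3 huz.symm
      · rw [hcu u hu1 hu2, hcu z hz1 hz2]
        exact hproper u hu3 z hz3 huz
    have h1 := card_edgeFinset_le hproper
    have h2 : ∑ v ∈ S, #(nbrsIn G (univ \ S) v) ≤ t + 1 := by
      simpa [hs] using sum_le_card_nsmul S _ 1 hone
    have h3 : (t + 2).choose 2 = (t + 1) + (t + 1).choose 2 := by
      rw [Nat.choose_succ_succ' (t + 1) 1, Nat.choose_one_right]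
    rw [hs, hcard, Nat.sub_add_eq] at h1
    omega

end OddCycle

/-- Theorem: if `G` is a `C_{2k+1}`-free graph on `n` vertices with
`e(G) > ⌊(n-t-1)²/4⌋ + C(t+2,2)`, `1 ≤ t ≤ 2k-2` and `n ≥ 318 t² k`, then `G` can be made
bipartite by deleting at most `t-1` vertices, or by deleting at most
`C(⌊(t+2)/2⌋,2) + C(⌈(t+2)/2⌉,2) - 1` edges. -/
theorem stmt4 {V : Type*} [Fintype V] [DecidableEq V]
    (k n t : ℕ) (hk : 2 ≤ k) (ht1 : 1 ≤ t) (ht2 : t ≤ 2 * k - 2)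
    (hn : 318 * t ^ 2 * k ≤ n)
    (G : SimpleGraph V) [DecidableRel G.Adj]
    (hcard : Fintype.card V = n)
    (hfree : CycleFree G (2 * k + 1))
    (hedge : (n - t - 1) ^ 2 / 4 + (t + 2).choose 2 < G.edgeFinset.card) :
    (∃ T : Finset V, T.card ≤ t - 1 ∧ (G.induce ((↑T : Set V)ᶜ)).Colorable 2) ∨
    (∃ E' : Finset (Sym2 V), (↑E' : Set (Sym2 V)) ⊆ G.edgeSet ∧
      E'.card ≤ ((t + 2) / 2).choose 2 + ((t + 3) / 2).choose 2 - 1 ∧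
      (G.deleteEdges ↑E').Colorable 2) := by
  exact Or.inl (hfree.exists_deletion hk ht1 hn hcard hedge)
end

section
/- Let G be a graph that contains an odd cycle, and let C be a shortest odd cycle of G (an odd cycle of minimum length among all odd cycles of G). If C has length at least 5, then every vertex v ∈ V(G) \ V(C) has at most two neighbors on C. -/
namespace SimpleGraph.Walk

variable {V : Type*} {G : SimpleGraph V}

/-- Closing a path through a vertex off the path that is adjacent to both of its
(distinct) ends gives a cycle. -/
lemma IsPath.isCycle_cons_concat {x y w : V} {p : G.Walk x y} (hp : p.IsPath) (hxy : x ≠ y)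
    (hx : G.Adj w x) (hy : G.Adj y w) (hw : w ∉ p.support) :
    (cons hx (p.concat hy)).IsCycle := by
  refine (cons_isCycle_iff _ _).2 ⟨hp.concat hw hy, fun he => ?_⟩
  rw [edges_concat, List.concat_eq_append, List.mem_append, List.mem_singleton] at he
  rcases he with he | he
  · exact hw (p.fst_mem_support_of_mem_edges he)
  · have := hx.ne
    have := hy.ne
    grind

/-- If every odd cycle has length at least `n`, then so does every odd path between two distinct
neighbors of a vertex off the path, extended by that vertex. -/
lemma IsPath.le_length_add_two {n : ℕ}
    (hmin : ∀ (u : V) (d : G.Walk u u), d.IsCycle → Odd d.length → n ≤ d.length)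
    {x y w : V} {p : G.Walk x y} (hp : p.IsPath) (hxy : x ≠ y)
    (hx : G.Adj w x) (hy : G.Adj w y) (hw : w ∉ p.support) (hodd : Odd p.length) :
    n ≤ p.length + 2 := by
  have h := hmin w _ (hp.isCycle_cons_concat hxy hx hy.symm hw)
  simp only [length_cons, length_concat] at h
  exact h (by grind)

/-- A vertex off a shortest odd cycle of length at least `5` cannot be adjacent to three vertices
cutting that cycle into three nontrivial arcs. -/
lemma IsCycle.false_of_three_adj {x y z w : V} {p : G.Walk x y} {q : G.Walk y z} {r : G.Walk z x}
    (hc : (p.append (q.append r)).IsCycle) (hodd : Odd (p.append (q.append r)).length)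
    (hmin : ∀ (u : V) (d : G.Walk u u), d.IsCycle → Odd d.length →
      (p.append (q.append r)).length ≤ d.length)
    (hlen : 5 ≤ (p.append (q.append r)).length) (hw : w ∉ (p.append (q.append r)).support)
    (hxy : x ≠ y) (hyz : y ≠ z) (hzx : z ≠ x)
    (hx : G.Adj w x) (hy : G.Adj w y) (hz : G.Adj w z) : False := by
  have hpn : ¬ p.Nil := not_nil_of_ne hxy
  have hqn : ¬ q.Nil := not_nil_of_ne hyz
  have hrn : ¬ r.Nil := not_nil_of_ne hzx
  have hqr : (q.append r).IsPath := hc.isPath_of_append_right hpn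
  have hp : p.IsPath := hc.isPath_of_append_left (by
    rw [← length_eq_zero_iff] at hrn ⊢
    rw [length_append]
    omega)
  rw [← length_eq_zero_iff] at hpn hqn hrn
  simp only [mem_support_append_iff, not_or] at hw
  have h₁ := hp.le_length_add_two hmin hxy hx hy hw.1
  have h₂ := hqr.of_append_left.le_length_add_two hmin hyz hy hz hw.2.1
  have h₃ := hqr.of_append_right.le_length_add_two hmin hzx hz hx hw.2.2
  simp only [length_append, Nat.odd_iff] at *
  omega

end SimpleGraph.Walk

/-- Fact: if `C` is a shortest odd cycle of `G` and `C` has length at least `5`, then every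
vertex outside `C` has at most two neighbors on `C`. -/
theorem stmt5 {V : Type*} [DecidableEq V] (G : SimpleGraph V) [DecidableRel G.Adj]
    {v : V} (c : G.Walk v v) (hc : c.IsCycle) (hodd : Odd c.length)
    (hmin : ∀ (u : V) (d : G.Walk u u), d.IsCycle → Odd d.length → c.length ≤ d.length)
    (hlen : 5 ≤ c.length)
    (w : V) (hw : w ∉ c.support) :
    (c.support.toFinset.filter (fun x => G.Adj w x)).card ≤ 2 := by
  by_contra! hcard
  obtain ⟨x, hx, y, hy, z, hz, hxy, hxz, hyz⟩ := Finset.two_lt_card.1 hcard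
  simp only [Finset.mem_filter, List.mem_toFinset] at hx hy hz
  obtain ⟨hxc, hx⟩ := hx
  obtain ⟨hyc, hy⟩ := hy
  obtain ⟨hzc, hz⟩ := hz
  rw [← SimpleGraph.Walk.mem_support_rotate_iff c x hxc] at hw hyc hzc
  rw [← SimpleGraph.Walk.length_rotate c x hxc] at hodd hmin hlen
  replace hc := hc.rotate hxc
  generalize c.rotate x hxc = d at *
  obtain ⟨p, q, rfl⟩ := SimpleGraph.Walk.mem_support_iff_exists_append.1 hyc
  rcases (SimpleGraph.Walk.mem_support_append_iff _ _).1 hzc with h | h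
  · obtain ⟨p, r, rfl⟩ := SimpleGraph.Walk.mem_support_iff_exists_append.1 h
    rw [← SimpleGraph.Walk.append_assoc] at *
    exact hc.false_of_three_adj hodd hmin hlen hw hxz hyz.symm hxy.symm hx hz hy
  · obtain ⟨q, r, rfl⟩ := SimpleGraph.Walk.mem_support_iff_exists_append.1 h
    exact hc.false_of_three_adj hodd hmin hlen hw hxy hyz hxz.symm hx hy hz
end

section
/- Let t ≥ 1 and n ≥ 6(t+1) be integers, and let G be a non-bipartite graph on n vertices with e(G) > (n−t−1)²/4. Then every shortest odd cycle of G has length at most 2n/3. -/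
namespace SimpleGraph

variable {V : Type*} {G : SimpleGraph V}

/-- The part of a walk between two of its positions. -/
theorem Walk.exists_length_eq_sub {u v : V} (p : G.Walk u v) {i j : ℕ} (hij : i ≤ j)
    (hj : j ≤ p.length) :
    ∃ q : G.Walk (p.getVert i) (p.getVert j), q.length = j - i := by
  have h : (p.drop i).getVert (j - i) = p.getVert j := by
    rw [Walk.drop_getVert, Nat.add_sub_cancel' hij]
  refine ⟨((p.drop i).take (j - i)).copy rfl h, ?_⟩
  rw [Walk.length_copy, Walk.take_length, Walk.drop_length]
  omega

/-- A closed walk of odd length contains an odd cycle. -/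
theorem Walk.exists_odd_cycle_of_odd_length {u : V} (p : G.Walk u u) (hp : Odd p.length) :
    ∃ (w : V) (d : G.Walk w w), d.IsCycle ∧ Odd d.length ∧ d.length ≤ p.length := by
  induction hm : p.length using Nat.strong_induction_on generalizing u with
  | _ m ih =>
  have hne : p.length ≠ 1 := fun h ↦ G.irrefl (Walk.adj_of_length_eq_one h)
  have h3 : 3 ≤ p.length := by grind
  by_cases hpath : p.tail.IsPath
  · exact ⟨u, p, Walk.isCycle_iff_isPath_tail_and_le_length.mpr ⟨hpath, h3⟩, hp, hm.le⟩
  have htail : p.tail.length + 1 = p.length := p.length_tail_add_one (by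
    rw [← Walk.length_eq_zero_iff]; omega)
  obtain ⟨i, j, hij, hj, heq⟩ : ∃ i j, i < j ∧ j ≤ p.length - 1 ∧
      p.getVert (i + 1) = p.getVert (j + 1) := by
    rw [← Walk.IsPath.getVert_injOn_iff] at hpath
    simp only [Set.InjOn, Set.mem_ofPred_eq, Walk.getVert_tail] at hpath
    push Not at hpath
    obtain ⟨a, ha, b, hb, hab, hne⟩ := hpath
    rcases lt_or_gt_of_ne hne with h | h
    · exact ⟨a, b, h, by omega, hab⟩
    · exact ⟨b, a, h, by omega, hab.symm⟩
  obtain ⟨q, hq⟩ := p.exists_length_eq_sub (i := i + 1) (j := j + 1) (by omega) (by omega)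
  obtain hodd | heven := (Nat.even_or_odd q.length).symm
  · obtain ⟨w, d, hd, hdo, hdl⟩ := ih q.length (by omega) (q.copy rfl heq.symm)
      (by simpa using hodd) (by simp)
    exact ⟨w, d, hd, hdo, by omega⟩
  · obtain ⟨r, hr⟩ : ∃ r : G.Walk u u, r.length = p.length - q.length := by
      refine ⟨((p.take (i + 1)).copy rfl heq).append (p.drop (j + 1)), ?_⟩
      rw [Walk.length_append, Walk.length_copy, Walk.take_length, Walk.drop_length]
      omega
    obtain ⟨w, d, hd, hdo, hdl⟩ := ih r.length (by omega) r (by grind) rfl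
    exact ⟨w, d, hd, hdo, by omega⟩

/-- Two neighbours of a vertex on a shortest odd cycle are at distance two along the cycle. -/
theorem Walk.sub_eq_two_of_shortest_odd {v : V} (c : G.Walk v v) (hodd : Odd c.length)
    (hmin : ∀ (u : V) (d : G.Walk u u), d.IsCycle → Odd d.length → c.length ≤ d.length)
    {w : V} {i j : ℕ} (hij : i < j) (hj : j < c.length)
    (hi' : G.Adj w (c.getVert i)) (hj' : G.Adj w (c.getVert j)) :
    j - i = 2 ∨ j - i + 2 = c.length := by
  have hclosed (a b : V) (ha : G.Adj w a) (hb : G.Adj w b) (q : G.Walk a b)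
      (hq : Odd q.length) : c.length ≤ q.length + 2 := by
    obtain ⟨x, d, hd, hdo, hdl⟩ :=
      (Walk.cons ha (q.concat hb.symm)).exists_odd_cycle_of_odd_length (by
        simp only [Walk.length_cons, Walk.length_concat]; grind)
    simp only [Walk.length_cons, Walk.length_concat] at hdl
    exact (hmin x d hd hdo).trans hdl
  obtain ⟨q, hq⟩ := c.exists_length_eq_sub hij.le hj.le
  obtain ⟨r, hr⟩ : ∃ r : G.Walk (c.getVert j) (c.getVert i), r.length = c.length - j + i := by
    refine ⟨(c.drop j).append (c.take i), ?_⟩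
    rw [Walk.length_append, Walk.take_length, Walk.drop_length]
    omega
  obtain h | h := Nat.even_or_odd q.length
  · have := hclosed _ _ hj' hi' r (by grind)
    have : 0 < q.length := by omega
    grind
  · have := hclosed _ _ hi' hj' q h
    grind

open Finset

/-- Every vertex has at most two neighbours on a shortest odd cycle of length at least five. -/
theorem Walk.card_neighbors_le_two_of_shortest_odd [DecidableEq V] [DecidableRel G.Adj]
    {v : V} (c : G.Walk v v) (hodd : Odd c.length) (h5 : 5 ≤ c.length)
    (hmin : ∀ (u : V) (d : G.Walk u u), d.IsCycle → Odd d.length → c.length ≤ d.length) (w : V) :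
    #{x ∈ c.support.toFinset | G.Adj w x} ≤ 2 := by
  have hidx (x : V) (hx : x ∈ c.support) : ∃ i < c.length, c.getVert i = x := by
    obtain ⟨i, rfl, hi⟩ := Walk.mem_support_iff_exists_getVert.mp hx
    rcases hi.lt_or_eq with h | rfl
    · exact ⟨i, h, rfl⟩
    · exact ⟨0, by omega, by simp⟩
  by_contra! hcard
  obtain ⟨x, y, z, hx, hy, hz, hxy, hxz, hyz⟩ := two_lt_card_iff.mp hcard
  simp only [mem_filter, List.mem_toFinset] at hx hy hz
  obtain ⟨i, hi, rfl⟩ := hidx x hx.1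
  obtain ⟨j, hj, rfl⟩ := hidx y hy.1
  obtain ⟨k, hk, rfl⟩ := hidx z hz.1
  have hdist {a b : ℕ} (ha : a < c.length) (hb : b < c.length)
      (ha' : G.Adj w (c.getVert a)) (hb' : G.Adj w (c.getVert b))
      (hab : c.getVert a ≠ c.getVert b) :
      a < b ∧ (b - a = 2 ∨ b - a + 2 = c.length) ∨
        b < a ∧ (a - b = 2 ∨ a - b + 2 = c.length) := by
    rcases lt_trichotomy a b with h | rfl | h
    · exact .inl ⟨h, c.sub_eq_two_of_shortest_odd hodd hmin h hb ha' hb'⟩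
    · exact absurd rfl hab
    · exact .inr ⟨h, c.sub_eq_two_of_shortest_odd hodd hmin h ha hb' ha'⟩
  have h₁ := hdist hi hj hx.2 hy.2 hxy
  have h₂ := hdist hi hk hx.2 hz.2 hxz
  have h₃ := hdist hj hk hy.2 hz.2 hyz
  obtain ⟨m, hm⟩ := hodd
  omega

theorem Walk.IsCycle.card_support_toFinset [DecidableEq V] {v : V} {c : G.Walk v v}
    (hc : c.IsCycle) : #c.support.toFinset = c.length := by
  have h : c.support.toFinset = c.support.tail.toFinset := by
    ext x
    rw [List.mem_toFinset, List.mem_toFinset]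
    refine ⟨fun hx ↦ ?_, List.mem_of_mem_tail⟩
    rcases c.mem_support_iff.mp hx with rfl | hx
    · exact Walk.end_mem_tail_support hc.not_nil
    · exact hx
  rw [h, List.toFinset_card_of_nodup hc.support_nodup]
  simp

variable [Fintype V]

/-- If every vertex has at most `k` neighbours in `s`, then `G` has few edges. -/
theorem two_mul_card_edgeFinset_le_s6 [DecidableEq V] [DecidableRel G.Adj] (s : Finset V) (k : ℕ)
    (h : ∀ w, #{x ∈ s | G.Adj w x} ≤ k) :
    2 * #G.edgeFinset ≤ k * Fintype.card V + #sᶜ * (k + (#sᶜ - 1)) := by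
  have hsplit (w : V) : G.degree w = #{x ∈ s | G.Adj w x} + #{x ∈ sᶜ | G.Adj w x} := by
    rw [← card_neighborFinset_eq_degree, neighborFinset_eq_filter,
      ← card_union_of_disjoint (disjoint_filter_filter disjoint_compl_right), ← filter_union,
      union_compl]
  have hswap : ∑ w, #{x ∈ sᶜ | G.Adj w x} = ∑ x ∈ sᶜ, G.degree x := by
    refine (sum_card_bipartiteAbove_eq_sum_card_bipartiteBelow G.Adj).trans
      (sum_congr rfl fun x _ ↦ ?_)
    simp only [← card_neighborFinset_eq_degree, neighborFinset_eq_filter, bipartiteBelow,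
      G.adj_comm x]
  have hdeg (x : V) (hx : x ∈ sᶜ) : G.degree x ≤ k + (#sᶜ - 1) := by
    rw [hsplit, ← card_erase_of_mem hx]
    refine Nat.add_le_add (h x) (card_le_card fun y hy ↦ ?_)
    rw [mem_filter] at hy
    exact mem_erase.mpr ⟨hy.2.ne', hy.1⟩
  calc
    2 * #G.edgeFinset = ∑ w, #{x ∈ s | G.Adj w x} + ∑ x ∈ sᶜ, G.degree x := by
      rw [← sum_degrees_eq_twice_card_edges, ← hswap, ← sum_add_distrib]
      exact sum_congr rfl fun w _ ↦ hsplit w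
    _ ≤ ∑ _w : V, k + ∑ _x ∈ sᶜ, (k + (#sᶜ - 1)) :=
      Nat.add_le_add (sum_le_sum fun w _ ↦ h w) (sum_le_sum hdeg)
    _ = k * Fintype.card V + #sᶜ * (k + (#sᶜ - 1)) := by
      simp [mul_comm]

end SimpleGraph


/-- Fact: let `t ≥ 1`, `n ≥ 6(t+1)`, and let `G` be a non-bipartite graph on `n` vertices with
`e(G) > (n-t-1)²/4`.  Then every shortest odd cycle of `G` has length at most `2n/3`. -/
theorem stmt6 {V : Type*} [Fintype V] (G : SimpleGraph V) [DecidableRel G.Adj]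
    (n t : ℕ) (ht : 1 ≤ t) (hn : 6 * (t + 1) ≤ n)
    (hcard : Fintype.card V = n)
    (hnonbip : ¬ G.Colorable 2)
    (hedge : ((n : ℝ) - t - 1) ^ 2 / 4 < (G.edgeFinset.card : ℝ))
    {v : V} (c : G.Walk v v) (hc : c.IsCycle) (hodd : Odd c.length)
    (hmin : ∀ (u : V) (d : G.Walk u u), d.IsCycle → Odd d.length → c.length ≤ d.length) :
    (c.length : ℝ) ≤ 2 * n / 3 := by
  classical
  by_contra! hlen
  have hlen' : 2 * n < 3 * c.length := by
    have : (2 * n : ℝ) < 3 * c.length := by linarith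
    exact_mod_cast this
  have hbound := G.two_mul_card_edgeFinset_le_s6 c.support.toFinset 2
    (c.card_neighbors_le_two_of_shortest_odd hodd (by omega) hmin)
  have hcompl : c.support.toFinsetᶜ.card + c.length = n := by
    rw [← hc.card_support_toFinset, Finset.card_compl_add_card, hcard]
  generalize c.support.toFinsetᶜ.card = x at hbound hcompl
  have hx : 3 * x < n := by omega
  have hbound' : 2 * G.edgeFinset.card ≤ 2 * n + x * (x + 2) := by
    rw [hcard] at hbound
    refine hbound.trans (Nat.add_le_add_left (Nat.mul_le_mul_left x (by omega)) _)
  have hE : 2 * (G.edgeFinset.card : ℝ) ≤ 2 * n + x * (x + 2) := by exact_mod_cast hbound'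
  have hxR : 3 * (x : ℝ) ≤ n := by exact_mod_cast hx.le
  have hnR : 6 * ((t : ℝ) + 1) ≤ n := by exact_mod_cast hn
  have htR : (1 : ℝ) ≤ t := by exact_mod_cast ht
  have h₁ : (5 * n / 6 : ℝ) ^ 2 ≤ ((n : ℝ) - t - 1) ^ 2 := by
    apply pow_le_pow_left₀ <;> linarith
  have h₂ : (x : ℝ) * (x + 2) ≤ n / 3 * (n / 3 + 2) := by
    gcongr <;> linarith
  nlinarith
end

section
/- Let k ≥ 2 and ℓ ≥ k+1 be integers, let G be a C_{2k+1}-free graph, and let C be an odd cycle in G of length 2ℓ+1. Then every vertex x ∈ V(G) \ V(C) has at most ℓ neighbors on C. -/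
/-- A path on `m` vertices together with a vertex outside it adjacent to both ends is a cycle of
length `m + 1`. -/
theorem not_cycleFree_of_path {V : Type*} {G : SimpleGraph V} {m : ℕ} (hm : 2 ≤ m)
    (p : ℕ → V) (hadj : ∀ i, i + 1 < m → G.Adj (p i) (p (i + 1)))
    (hinj : Set.InjOn p (Set.Iio m)) (x : V) (hx : ∀ i < m, p i ≠ x)
    (hstart : G.Adj x (p 0)) (hend : G.Adj x (p (m - 1))) : ¬ CycleFree G (m + 1) := by
  intro hfree
  let g : Fin (m + 1) → V := fun i => if i.val < m then p i.val else x
  have hstep : ∀ u v : Fin (m + 1), (v - u).val = 1 → G.Adj (g u) (g v) := by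
    intro u v huv
    have hu := u.isLt
    have hv := v.isLt
    have hcases : v.val = u.val + 1 ∨ (u.val = m ∧ v.val = 0) := by
      rcases le_or_gt u v with h | h
      · rw [Fin.sub_val_of_le h] at huv
        omega
      · rw [Fin.coe_sub_iff_lt.2 h] at huv
        omega
    rcases hcases with h | ⟨h, h0⟩
    · rcases Nat.lt_or_ge v.val m with hvm | hvm
      · simpa [g, show u.val < m by omega, h, show u.val + 1 < m by omega] using hadj u (by omega)
      · simpa [g, show u.val < m by omega, show ¬ v.val < m by omega,
          show u.val = m - 1 by omega, show m - 1 < m by omega] using hend.symm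
    · simpa [g, h, h0, show 0 < m by omega] using hstart
  refine hfree ⟨g, fun {u v} huv => ?_⟩ fun u v huv => ?_
  · rcases SimpleGraph.cycleGraph_adj'.1 huv with h | h
    · exact (hstep v u h).symm
    · exact hstep u v h
  · change g u = g v at huv
    have hu := u.isLt
    have hv := v.isLt
    apply Fin.ext
    by_cases h₁ : u.val < m <;> by_cases h₂ : v.val < m <;> simp only [g, h₁, h₂, if_true,
      if_false] at huv
    · exact hinj h₁ h₂ huv
    · exact absurd huv (hx _ h₁)
    · exact absurd huv.symm (hx _ h₂)
    · omega

/-- A set of residues modulo `n` that is disjoint from a translate of itself contains at most half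
of them. -/
theorem two_mul_card_le_of_disjoint_translate {n d : ℕ} (I : Finset ℕ)
    (hI : I ⊆ Finset.range n) (hd : ∀ i ∈ I, (i + d) % n ∉ I) : 2 * I.card ≤ n := by
  have himage : (I.image fun i => (i + d) % n).card = I.card := by
    refine Finset.card_image_of_injOn fun i hi j hj hij => ?_
    have h : i ≡ j [MOD n] := Nat.ModEq.add_right_cancel' d hij
    exact h.eq_of_lt_of_lt (Finset.mem_range.1 (hI hi)) (Finset.mem_range.1 (hI hj))
  have hdisj : Disjoint I (I.image fun i => (i + d) % n) := by
    refine Finset.disjoint_right.2 fun a ha => ?_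
    obtain ⟨i, hi, rfl⟩ := Finset.mem_image.1 ha
    exact hd i hi
  have hsub : I ∪ (I.image fun i => (i + d) % n) ⊆ Finset.range n := by
    refine Finset.union_subset hI fun a ha => ?_
    obtain ⟨i, hi, rfl⟩ := Finset.mem_image.1 ha
    have := Finset.mem_range.1 (hI hi)
    exact Finset.mem_range.2 (Nat.mod_lt _ (by omega))
  have hcard := Finset.card_le_card hsub
  rw [Finset.card_union_of_disjoint hdisj, himage, Finset.card_range] at hcard
  omega

/-- Consecutive vertices of a closed walk, indexed modulo its length, are adjacent. -/
theorem SimpleGraph.Walk.adj_getVert_mod_succ {V : Type*} {G : SimpleGraph V} {v : V}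
    (c : G.Walk v v) (hc : 0 < c.length) (i : ℕ) :
    G.Adj (c.getVert (i % c.length)) (c.getVert ((i + 1) % c.length)) := by
  have hi := Nat.mod_lt i hc
  have h := c.adj_getVert_succ hi
  rcases Nat.lt_or_ge (i % c.length + 1) c.length with hlt | hge
  · rwa [← Nat.mod_add_mod, Nat.mod_eq_of_lt hlt]
  · have heq : i % c.length + 1 = c.length := by omega
    rw [← Nat.mod_add_mod, heq, Nat.mod_self, c.getVert_zero]
    rwa [heq, c.getVert_length] at h

/-- Fact: let `k ≥ 2`, `ℓ ≥ k+1`, `G` a `C_{2k+1}`-free graph and `C` an odd cycle of length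
`2ℓ+1` in `G`.  Then every vertex outside `C` has at most `ℓ` neighbors on `C`. -/
theorem stmt7 {V : Type*} [DecidableEq V] (G : SimpleGraph V) [DecidableRel G.Adj]
    (k ℓ : ℕ) (hk : 2 ≤ k) (hℓ : k + 1 ≤ ℓ)
    (hfree : CycleFree G (2 * k + 1))
    {v : V} (c : G.Walk v v) (hc : c.IsCycle) (hlen : c.length = 2 * ℓ + 1)
    (x : V) (hx : x ∉ c.support) :
    (c.support.toFinset.filter (fun y => G.Adj x y)).card ≤ ℓ := by
  set n := c.length with hn
  have hpos : 0 < n := by omega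
  let I := (Finset.range n).filter fun i => G.Adj x (c.getVert i)
  have hsub : c.support.toFinset.filter (fun y => G.Adj x y) ⊆ I.image c.getVert := by
    intro y hy
    obtain ⟨hy, hxy⟩ := Finset.mem_filter.1 hy
    obtain ⟨i, rfl, hi⟩ := SimpleGraph.Walk.mem_support_iff_exists_getVert.1
      (List.mem_toFinset.1 hy)
    rcases hi.lt_or_eq with hlt | rfl
    · exact Finset.mem_image_of_mem _ (Finset.mem_filter.2 ⟨Finset.mem_range.2 hlt, hxy⟩)
    · rw [c.getVert_length] at hxy ⊢
      exact Finset.mem_image.2 ⟨0, Finset.mem_filter.2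
        ⟨Finset.mem_range.2 hpos, by rwa [c.getVert_zero]⟩, c.getVert_zero⟩
  have hcard : 2 * I.card ≤ n := by
    refine two_mul_card_le_of_disjoint_translate (d := 2 * k - 1) I
      (Finset.filter_subset _ _) fun i hi hj => ?_
    obtain ⟨hin, hxi⟩ := Finset.mem_filter.1 hi
    have hxj := (Finset.mem_filter.1 hj).2
    refine not_cycleFree_of_path (m := 2 * k) (by omega) (fun j => c.getVert ((i + j) % n))
      (fun j _ => c.adj_getVert_mod_succ hpos (i + j)) (fun a ha b hb hab => ?_) x
      (fun j _ h => hx (h ▸ c.getVert_mem_support _)) ?_ hxj hfree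
    · have hlt : ∀ j, (i + j) % n ≤ c.length - 1 := fun j =>
        Nat.le_sub_one_of_lt (Nat.mod_lt _ hpos)
      have h : a ≡ b [MOD n] :=
        Nat.ModEq.add_left_cancel' i (hc.getVert_injOn' (hlt a) (hlt b) hab)
      have ha : a < 2 * k := ha
      have hb : b < 2 * k := hb
      exact h.eq_of_lt_of_lt (by omega) (by omega)
    · simpa [Nat.mod_eq_of_lt (Finset.mem_range.1 hin)] using hxi
  have := (Finset.card_le_card hsub).trans Finset.card_image_le
  omega
end
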